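/- Let d ≥ 2 and κ_i ≥ 0 (i = 1,…,d+1), and let â be an admissible cutoff function. For every γ > 2|κ| + 2 there exist δ_0 ∈ (0,1) and a constant c_γ > 0, depending only on γ, κ and d, such that for all n ∈ ℕ, all 0 < δ ≤ δ_0, all x, y ∈ △^d and all z ∈ △^d with d_△(x,z) ≤ δ/n: |L_n^κ(x,y) − L_n^κ(z,y)| ≤ c_γ n^{d+1} d_△(x,z) / ( √(W_κ(n;x)) √(W_κ(n;y)) (1 + n d_△(x,y))^{γ − 2|κ| − 2} ). -/

import Mathlib

open MeasureTheory Finset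

noncomputable section

/-- The simplex `△^d = {x : x_i ≥ 0, x_1 + ⋯ + x_d ≤ 1}`. -/
def Splx (d : ℕ) : Set (Fin d → ℝ) := {x | (∀ i, 0 ≤ x i) ∧ ∑ i, x i ≤ 1}

/-- The `i`-th partial derivative. -/
def pd {d : ℕ} (i : Fin d) (f : (Fin d → ℝ) → ℝ) : (Fin d → ℝ) → ℝ :=
  fun x => fderiv ℝ f x (Pi.single i 1)

/-- `∂_{i,j} = ∂_i - ∂_j`. -/
def pdd {d : ℕ} (i j : Fin d) (f : (Fin d → ℝ) → ℝ) : (Fin d → ℝ) → ℝ :=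
  fun x => pd i f x - pd j f x

/-- `⟨x,∇⟩ = ∑ x_i ∂_i`. -/
def xgrad {d : ℕ} (f : (Fin d → ℝ) → ℝ) : (Fin d → ℝ) → ℝ :=
  fun x => ∑ i, x i * pd i f x

/-- The Jacobi weight `W_κ(x) = x_1^{κ_1} ⋯ x_d^{κ_d} (1-|x|)^{κ_{d+1}}`. -/
def Wk {d : ℕ} (κ : Fin (d+1) → ℝ) (x : Fin d → ℝ) : ℝ :=
  (∏ i : Fin d, x i ^ κ i.castSucc) * (1 - ∑ i, x i) ^ κ (Fin.last d)

/-- The spectral operator `D_κ`. -/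
def Dk {d : ℕ} (κ : Fin (d+1) → ℝ) (f : (Fin d → ℝ) → ℝ) (x : Fin d → ℝ) : ℝ :=
  (∑ i, x i * (1 - x i) * pd i (pd i f) x)
    - 2 * ∑ i, ∑ j ∈ Finset.univ.filter (fun j => i < j), x i * x j * pd i (pd j f) x
    + ∑ i, (κ i.castSucc + 1 - ((∑ k, κ k) + (d : ℝ) + 1) * x i) * pd i f x

/-- The normalizing constant `b_κ`. -/
def bk {d : ℕ} (κ : Fin (d+1) → ℝ) : ℝ :=
  Real.Gamma ((∑ i, κ i) + (d : ℝ) + 1) / ∏ i, Real.Gamma (κ i + 1)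

/-- The inner product `⟨f,g⟩_κ = b_κ ∫_{△^d} f g W_κ`. -/
def ipk {d : ℕ} (κ : Fin (d+1) → ℝ) (f g : (Fin d → ℝ) → ℝ) : ℝ :=
  bk κ * ∫ x in Splx d, f x * g x * Wk κ x

/-- The norm `‖f‖_{κ,2}`. -/
def nrm2 {d : ℕ} (κ : Fin (d+1) → ℝ) (f : (Fin d → ℝ) → ℝ) : ℝ :=
  Real.sqrt (ipk κ f f)

/-- Membership in `V_n^d(W_κ)`: a polynomial of degree (at most) `n` orthogonal to all
polynomials of lower degree. -/
def InVn (d n : ℕ) (κ : Fin (d+1) → ℝ) (f : MvPolynomial (Fin d) ℝ) : Prop :=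
  f.totalDegree ≤ n ∧ ∀ g : MvPolynomial (Fin d) ℝ, g.totalDegree < n →
    ipk κ (fun x => MvPolynomial.eval x f) (fun x => MvPolynomial.eval x g) = 0

/-- `x_k` for `1 ≤ k ≤ d+1`, with the convention `x_{d+1} = 1 - |x|`. -/
def xe {d : ℕ} (x : Fin d → ℝ) (k : Fin (d+1)) : ℝ :=
  if h : (k : ℕ) < d then x ⟨(k : ℕ), h⟩ else 1 - ∑ i, x i

/-- The distance `d_△(x,y) = arccos(Σ_{i=1}^{d+1} √(x_i) √(y_i))` on the simplex. -/
def dT {d : ℕ} (x y : Fin d → ℝ) : ℝ :=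
  Real.arccos ((∑ i, Real.sqrt (x i) * Real.sqrt (y i)) +
    Real.sqrt (1 - ∑ i, x i) * Real.sqrt (1 - ∑ i, y i))

/-- The ball `B(x,r)` of the metric `d_△` inside the simplex. -/
def ballT {d : ℕ} (x : Fin d → ℝ) (r : ℝ) : Set (Fin d → ℝ) :=
  {y ∈ Splx d | dT x y ≤ r}

/-- A doubling weight on the simplex: a nonnegative integrable function `w` such that
`w(B(x,2r)) ≤ c_w w(B(x,r))` uniformly in `x` and `r`. -/
def IsDoubling {d : ℕ} (w : (Fin d → ℝ) → ℝ) : Prop :=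
  (∀ x, 0 ≤ w x) ∧ MeasureTheory.IntegrableOn w (Splx d) ∧
    ∃ cw > 0, ∀ x ∈ Splx d, ∀ r : ℝ, 0 < r →
      (∫ y in ballT x (2 * r), w y) ≤ cw * ∫ y in ballT x r, w y

/-- `P` is the family of reproducing kernels of the spaces `V_j^d(W_κ)`:
`P j (·, y)` belongs to `V_j^d(W_κ)` for each fixed `y`, it is symmetric, and it
reproduces every element of `V_j^d(W_κ)`. -/
def IsRK (d : ℕ) (κ : Fin (d+1) → ℝ) (P : ℕ → (Fin d → ℝ) → (Fin d → ℝ) → ℝ) : Prop :=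
  ∀ j : ℕ,
    (∀ x y, P j x y = P j y x) ∧
    (∀ y, ∃ p : MvPolynomial (Fin d) ℝ, InVn d j κ p ∧ ∀ x, P j x y = MvPolynomial.eval x p) ∧
    (∀ p : MvPolynomial (Fin d) ℝ, InVn d j κ p → ∀ x,
      bk κ * ∫ y in Splx d, P j x y * MvPolynomial.eval y p * Wk κ y = MvPolynomial.eval x p)

/-- An admissible cutoff function: smooth, supported in `[0,2]` and equal to `1` on `[0,1]`. -/
def IsCutoff (a : ℝ → ℝ) : Prop :=
  ContDiff ℝ (⊤ : ℕ∞) a ∧ (∀ t, 2 < t → a t = 0) ∧ ∀ t, 0 ≤ t → t ≤ 1 → a t = 1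

/-- The localized kernel `L_n^κ(x,y) = Σ_{j=0}^∞ â(j/n) P_j^κ(x,y)`. -/
def Lk {d : ℕ} (a : ℝ → ℝ) (P : ℕ → (Fin d → ℝ) → (Fin d → ℝ) → ℝ) (n : ℕ)
    (x y : Fin d → ℝ) : ℝ :=
  ∑' j : ℕ, a ((j : ℝ) / (n : ℝ)) * P j x y

/-- `W_κ(n;x) = Π_{i=1}^{d+1} (x_i + n^{-2})^{κ_i + 1/2}` with `x_{d+1} = 1 - |x|`. -/
def Wkn {d : ℕ} (κ : Fin (d+1) → ℝ) (n : ℕ) (x : Fin d → ℝ) : ℝ :=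
  ∏ i : Fin (d+1), (xe x i + 1 / (n : ℝ) ^ 2) ^ (κ i + 1/2)


section Barycentric

variable {d : ℕ}

@[simp] lemma xe_castSucc (x : Fin d → ℝ) (i : Fin d) : xe x i.castSucc = x i := by
  simp [xe]

@[simp] lemma xe_last (x : Fin d → ℝ) : xe x (Fin.last d) = 1 - ∑ i, x i := by
  simp [xe]

lemma sum_xe (x : Fin d → ℝ) : ∑ k, xe x k = 1 := by
  simp [Fin.sum_univ_castSucc]

lemma mem_Splx_iff {x : Fin d → ℝ} : x ∈ Splx d ↔ ∀ k, 0 ≤ xe x k := by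
  refine ⟨fun h k => ?_, fun h => ⟨fun i => by simpa using h i.castSucc, ?_⟩⟩
  · induction k using Fin.lastCases with
    | last => simpa using h.2
    | cast i => simpa using h.1 i
  · simpa using h (Fin.last d)

lemma xe_nonneg {x : Fin d → ℝ} (hx : x ∈ Splx d) (k : Fin (d+1)) : 0 ≤ xe x k :=
  mem_Splx_iff.1 hx k

lemma xe_le_one {x : Fin d → ℝ} (hx : x ∈ Splx d) (k : Fin (d+1)) : xe x k ≤ 1 := by
  rw [← sum_xe x]
  exact Finset.single_le_sum (fun i _ => xe_nonneg hx i) (Finset.mem_univ k)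

lemma xe_ext {x y : Fin d → ℝ} (h : ∀ k, xe x k = xe y k) : x = y := by
  ext i; simpa using h i.castSucc

lemma Wk_eq_prod (κ : Fin (d+1) → ℝ) (x : Fin d → ℝ) : Wk κ x = ∏ k, xe x k ^ κ k := by
  simp [Wk, Fin.prod_univ_castSucc]

lemma dT_eq (x y : Fin d → ℝ) :
    dT x y = Real.arccos (∑ k, √(xe x k) * √(xe y k)) := by
  simp [dT, Fin.sum_univ_castSucc]

lemma continuous_xe (k : Fin (d+1)) : Continuous fun x : Fin d → ℝ => xe x k := by
  induction k using Fin.lastCases with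
  | last => simp only [xe_last]; fun_prop
  | cast i => simp only [xe_castSucc]; fun_prop

lemma isCompact_Splx (d : ℕ) : IsCompact (Splx d) := by
  refine (isCompact_univ_pi (fun _ : Fin d => isCompact_Icc (a := (0:ℝ)) (b := 1))
    ).of_isClosed_subset
    ?_ ?_
  · have : Splx d = ⋂ k, {x | 0 ≤ xe x k} := by
      ext x; simp [mem_Splx_iff]
    rw [this]
    exact isClosed_iInter fun k => isClosed_le continuous_const (continuous_xe k)
  · intro x hx i _
    have h1 := xe_nonneg hx i.castSucc
    have h2 := xe_le_one hx i.castSucc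
    simp only [xe_castSucc] at h1 h2
    exact ⟨h1, h2⟩

/-- The `ℓ¹`-distance between the square roots of the barycentric coordinates. -/
def rootDist (x y : Fin d → ℝ) : ℝ := ∑ k, |√(xe x k) - √(xe y k)|

lemma rootDist_nonneg (x y : Fin d → ℝ) : 0 ≤ rootDist x y :=
  Finset.sum_nonneg fun _ _ => abs_nonneg _

lemma rootDist_comm (x y : Fin d → ℝ) : rootDist x y = rootDist y x :=
  Finset.sum_congr rfl fun _ _ => abs_sub_comm _ _

lemma rootDist_triangle (x y z : Fin d → ℝ) :
    rootDist x z ≤ rootDist x y + rootDist y z := by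
  unfold rootDist
  rw [← Finset.sum_add_distrib]
  exact Finset.sum_le_sum fun k _ => abs_sub_le _ _ _

lemma abs_sub_le_rootDist (x y : Fin d → ℝ) (k : Fin (d+1)) :
    |√(xe x k) - √(xe y k)| ≤ rootDist x y :=
  Finset.single_le_sum (f := fun k => |√(xe x k) - √(xe y k)|)
    (fun _ _ => abs_nonneg _) (Finset.mem_univ k)

lemma sum_sq_sqrt_xe {x : Fin d → ℝ} (hx : x ∈ Splx d) : ∑ k, √(xe x k) ^ 2 = 1 := by
  rw [← sum_xe x]
  exact Finset.sum_congr rfl fun k _ => Real.sq_sqrt (xe_nonneg hx k)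

lemma sum_mul_sqrt_nonneg (x y : Fin d → ℝ) : 0 ≤ ∑ k, √(xe x k) * √(xe y k) :=
  Finset.sum_nonneg fun _ _ => by positivity

lemma sum_sq_sub_sqrt {x y : Fin d → ℝ} (hx : x ∈ Splx d) (hy : y ∈ Splx d) :
    ∑ k, (√(xe x k) - √(xe y k)) ^ 2 = 2 - 2 * ∑ k, √(xe x k) * √(xe y k) := by
  have : ∀ k, (√(xe x k) - √(xe y k)) ^ 2 =
      √(xe x k) ^ 2 + √(xe y k) ^ 2 - 2 * (√(xe x k) * √(xe y k)) := fun k => by ring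
  simp only [this, Finset.sum_sub_distrib, Finset.sum_add_distrib, sum_sq_sqrt_xe hx,
    sum_sq_sqrt_xe hy, ← Finset.mul_sum]
  ring

lemma sum_mul_sqrt_le_one {x y : Fin d → ℝ} (hx : x ∈ Splx d) (hy : y ∈ Splx d) :
    ∑ k, √(xe x k) * √(xe y k) ≤ 1 := by
  have := sum_sq_sub_sqrt hx hy
  have h2 : 0 ≤ ∑ k, (√(xe x k) - √(xe y k)) ^ 2 := Finset.sum_nonneg fun _ _ => sq_nonneg _
  linarith

lemma cos_dT {x y : Fin d → ℝ} (hx : x ∈ Splx d) (hy : y ∈ Splx d) :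
    Real.cos (dT x y) = ∑ k, √(xe x k) * √(xe y k) := by
  rw [dT_eq, Real.cos_arccos (by linarith [sum_mul_sqrt_nonneg x y]) (sum_mul_sqrt_le_one hx hy)]

lemma dT_nonneg (x y : Fin d → ℝ) : 0 ≤ dT x y := Real.arccos_nonneg _

lemma dT_le_pi_div_two (x y : Fin d → ℝ) : dT x y ≤ Real.pi / 2 := by
  rw [dT_eq]; exact Real.arccos_le_pi_div_two.2 (sum_mul_sqrt_nonneg x y)

lemma abs_sqrt_sub_le_dT {x y : Fin d → ℝ} (hx : x ∈ Splx d) (hy : y ∈ Splx d)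
    (k : Fin (d+1)) : |√(xe x k) - √(xe y k)| ≤ dT x y := by
  refine abs_le_of_sq_le_sq ?_ (dT_nonneg x y)
  have h1 : (√(xe x k) - √(xe y k)) ^ 2 ≤ ∑ k, (√(xe x k) - √(xe y k)) ^ 2 :=
    Finset.single_le_sum (f := fun k => (√(xe x k) - √(xe y k)) ^ 2)
      (fun _ _ => sq_nonneg _) (Finset.mem_univ k)
  have h2 := Real.one_sub_sq_div_two_le_cos (x := dT x y)
  rw [sum_sq_sub_sqrt hx hy, ← cos_dT hx hy] at h1
  linarith

lemma rootDist_le_dT {x y : Fin d → ℝ} (hx : x ∈ Splx d) (hy : y ∈ Splx d) :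
    rootDist x y ≤ (d + 1) * dT x y := by
  refine (Finset.sum_le_sum fun k _ => abs_sqrt_sub_le_dT hx hy k).trans ?_
  simp

lemma dT_le_rootDist {x y : Fin d → ℝ} (hx : x ∈ Splx d) (hy : y ∈ Splx d) :
    dT x y ≤ 2 * rootDist x y := by
  have hpi := Real.pi_pos
  have h0 := dT_nonneg x y
  have h2 : Real.cos (dT x y) ≤ 1 - 2 / Real.pi ^ 2 * dT x y ^ 2 :=
    Real.cos_le_one_sub_mul_cos_sq (by
      rw [abs_of_nonneg h0]; linarith [dT_le_pi_div_two x y])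
  have h3 : ∑ k, (√(xe x k) - √(xe y k)) ^ 2 ≤ rootDist x y ^ 2 := by
    have := Finset.sum_sq_le_sq_sum_of_nonneg (s := Finset.univ)
      (f := fun k => |√(xe x k) - √(xe y k)|) (fun _ _ => abs_nonneg _)
    simpa [rootDist, sq_abs] using this
  rw [sum_sq_sub_sqrt hx hy, ← cos_dT hx hy] at h3
  have h4 : dT x y ^ 2 * 4 / Real.pi ^ 2 ≤ rootDist x y ^ 2 := by
    have : dT x y ^ 2 * 4 / Real.pi ^ 2 = 2 * (2 / Real.pi ^ 2 * dT x y ^ 2) := by ring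
    rw [this]; linarith
  rw [div_le_iff₀ (by positivity)] at h4
  have h5 : Real.pi ^ 2 ≤ 16 := by nlinarith [Real.pi_le_four]
  refine abs_le_of_sq_le_sq' ?_ (by linarith [rootDist_nonneg x y]) |>.2
  nlinarith [sq_nonneg (rootDist x y)]

lemma Wkn_pos {κ : Fin (d+1) → ℝ} {n : ℕ} (hn : 0 < n) {x : Fin d → ℝ} (hx : x ∈ Splx d) :
    0 < Wkn κ n x :=
  Finset.prod_pos fun k _ => Real.rpow_pos_of_pos
    (add_pos_of_nonneg_of_pos (xe_nonneg hx k) (by positivity)) _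

lemma Wkn_le {κ : Fin (d+1) → ℝ} (hκ : ∀ i, 0 ≤ κ i) {n : ℕ} (hn : 0 < n) {x w : Fin d → ℝ}
    (hx : x ∈ Splx d) (hw : w ∈ Splx d) :
    Wkn κ n w ≤ Wkn κ n x * (1 + n * rootDist x w) ^ (2 * ∑ i, κ i + (d + 1)) := by
  have hn' : (0:ℝ) < n := by exact_mod_cast hn
  set r := rootDist x w with hr
  have hr0 : 0 ≤ r := rootDist_nonneg _ _
  have hbase : 0 < 1 + n * r := by positivity
  have key : ∀ k, (xe w k + 1 / (n:ℝ) ^ 2) ^ (κ k + 1/2) ≤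
      (xe x k + 1 / (n:ℝ) ^ 2) ^ (κ k + 1/2) * (1 + n * r) ^ (2 * κ k + 1) := by
    intro k
    have hx0 := xe_nonneg hx k
    have hw0 := xe_nonneg hw k
    have h1 : √(xe w k) ≤ √(xe x k) + r := by
      have := abs_sub_le_rootDist x w k
      rw [abs_le] at this; linarith
    have h2 : xe w k ≤ (√(xe x k) + r) ^ 2 := by
      rw [← Real.sq_sqrt hw0]; gcongr
    have h3 : xe w k + 1 / (n:ℝ) ^ 2 ≤ (xe x k + 1 / (n:ℝ) ^ 2) * (1 + n * r) ^ 2 := by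
      set a := √(xe x k) with ha
      have ha2 : xe x k = a ^ 2 := (Real.sq_sqrt hx0).symm
      have ha0 : 0 ≤ a := Real.sqrt_nonneg _
      set m := 1 / (n:ℝ) with hm
      have hm2 : 1 / (n:ℝ)^2 = m ^ 2 := by rw [hm]; ring
      have hmn : m * n = 1 := by rw [hm]; field_simp
      rw [hm2, ha2]
      have e : (a ^ 2 + m ^ 2) * (1 + n * r) ^ 2 =
          a^2 + m^2 + 2 * r * (n * a^2 + m * (m*n)) + r^2 * (n^2*a^2 + (m*n)^2) := by ring
      rw [e, hmn]
      have : 2 * a ≤ 2 * (n * a^2 + m) := by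
        have : 0 ≤ n * (a - m/1) ^ 2 := by positivity
        have e2 : n * (a - m/1) ^ 2 = n * a^2 - 2 * a * (m * n) + m * (m * n) := by ring
        rw [e2, hmn] at this
        nlinarith [mul_nonneg hn'.le (sq_nonneg a)]
      have h5 : 0 ≤ r^2 * (n^2 * a^2) := by positivity
      nlinarith
    calc _ ≤ ((xe x k + 1 / (n:ℝ) ^ 2) * (1 + n * r) ^ 2) ^ (κ k + 1/2) := by
          apply Real.rpow_le_rpow (by positivity) h3; linarith [hκ k]
      _ = _ := by
          rw [Real.mul_rpow (by positivity) (by positivity), ← Real.rpow_natCast (1 + n * r) 2,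
            ← Real.rpow_mul hbase.le]
          congr 2; push_cast; ring
  calc Wkn κ n w ≤ ∏ k, ((xe x k + 1 / (n:ℝ) ^ 2) ^ (κ k + 1/2) * (1 + n * r) ^ (2 * κ k + 1)) :=
        Finset.prod_le_prod (fun k _ => by have := xe_nonneg hw k; positivity) fun k _ => key k
    _ = _ := by
        rw [Finset.prod_mul_distrib, ← Real.rpow_sum_of_pos hbase]
        congr 2
        rw [Finset.sum_add_distrib, ← Finset.mul_sum]; simp

/-- The barycentric coordinates as polynomials. -/
def baryPoly (k : Fin (d+1)) : MvPolynomial (Fin d) ℝ :=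
  Fin.lastCases (1 - ∑ i, MvPolynomial.X i) (fun i => MvPolynomial.X i) k

@[simp] lemma eval_baryPoly (x : Fin d → ℝ) (k : Fin (d+1)) :
    MvPolynomial.eval x (baryPoly k) = xe x k := by
  induction k using Fin.lastCases with
  | last => simp [baryPoly]
  | cast i => simp [baryPoly]

lemma totalDegree_baryPoly (k : Fin (d+1)) : (baryPoly (d := d) k).totalDegree ≤ 1 := by
  induction k using Fin.lastCases with
  | last =>
    simp only [baryPoly, Fin.lastCases_last]
    refine (MvPolynomial.totalDegree_sub _ _).trans (max_le (by simp) ?_)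
    exact MvPolynomial.totalDegree_finsetSum_le fun i _ => by simp
  | cast i => simp [baryPoly]

end Barycentric

section Peak

lemma abs_sin_nat_mul_le (n : ℕ) (x : ℝ) : |Real.sin (n * x)| ≤ n * |Real.sin x| := by
  induction n with
  | zero => simp
  | succ n ih =>
    have : ((n + 1 : ℕ) : ℝ) * x = n * x + x := by push_cast; ring
    rw [this, Real.sin_add]
    push_cast
    calc _ ≤ |Real.sin (n * x)| * |Real.cos x| + |Real.cos (n * x)| * |Real.sin x| := by
          rw [← abs_mul, ← abs_mul]; exact abs_add_le _ _
      _ ≤ (n * |Real.sin x|) * 1 + 1 * |Real.sin x| := by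
          gcongr
          · exact Real.abs_cos_le_one _
          · exact Real.abs_cos_le_one _
      _ = _ := by ring

open Polynomial in
/-- The Fejér kernel as an algebraic polynomial in `sin²(θ/2)`. -/
lemma exists_fejer (n : ℕ) (hn : 0 < n) : ∃ F : ℝ[X], F.natDegree ≤ n ∧ F.eval 0 = 1 ∧
    ∀ τ ∈ Set.Icc (0:ℝ) 1, 0 ≤ F.eval τ ∧ F.eval τ ≤ 1 ∧ n ^ 2 * τ * F.eval τ ≤ 1 := by
  have hn' : (0:ℝ) < n := by exact_mod_cast hn
  set P : ℝ[X] := 1 - (Chebyshev.T ℝ n).comp (1 - C 2 * X) with hP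
  have hP0 : P.eval 0 = 0 := by simp [hP]
  obtain ⟨G, hG⟩ : X ∣ P := by rwa [X_dvd_iff, coeff_zero_eq_eval_zero]
  have hdeg : P.natDegree ≤ n := by
    refine (natDegree_sub_le _ _).trans (max_le (by simp) ?_)
    refine natDegree_comp_le.trans ?_
    have h1 : (1 - C 2 * X : ℝ[X]).natDegree ≤ 1 := by compute_degree
    have h2 : (Chebyshev.T ℝ n).natDegree ≤ n := by
      simp
    calc _ ≤ n * 1 := Nat.mul_le_mul h2 h1
      _ = n := by simp
  have hGdeg : G.natDegree ≤ n := by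
    by_cases h0 : G = 0
    · simp [h0]
    · rw [hG, natDegree_X_mul h0] at hdeg; omega
  have hG0 : G.eval 0 = 2 * n ^ 2 := by
    have h1 : (derivative P).eval 0 = G.eval 0 := by rw [hG]; simp
    rw [← h1, hP]
    simp [derivative_comp, Chebyshev.derivative_T_eval_one]
    
  refine ⟨C (1 / (2 * (n:ℝ) ^ 2)) * G, (natDegree_C_mul_le _ _).trans hGdeg, ?_, ?_⟩
  · rw [eval_mul, eval_C, hG0]; field_simp
  · rintro τ ⟨h0, h1⟩
    rcases h0.eq_or_lt with rfl | hpos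
    · rw [eval_mul, eval_C, hG0]
      have : 1 / (2 * (n:ℝ) ^ 2) * (2 * n ^ 2) = 1 := by field_simp
      rw [this]; simp
    · set ψ := Real.arcsin √τ
      have hs : Real.sin ψ = √τ := Real.sin_arcsin (by linarith [Real.sqrt_nonneg τ])
        (Real.sqrt_le_one.2 h1)
      have hs2 : Real.sin ψ ^ 2 = τ := by rw [hs, Real.sq_sqrt h0]
      have hc : 1 - 2 * τ = Real.cos (2 * ψ) := by
        rw [Real.cos_two_mul', Real.cos_sq', hs2]; ring
      have hPe : P.eval τ = 2 * Real.sin (n * ψ) ^ 2 := by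
        have : P.eval τ = 1 - (Chebyshev.T ℝ n).eval (1 - 2 * τ) := by simp [hP]
        rw [this, hc, Chebyshev.T_real_cos]
        have : ((n:ℤ):ℝ) * (2 * ψ) = 2 * (n * ψ) := by push_cast; ring
        rw [this, Real.cos_two_mul', Real.cos_sq']; ring
      have hGe : τ * G.eval τ = 2 * Real.sin (n * ψ) ^ 2 := by rw [← hPe, hG]; simp
      have hb : Real.sin (n * ψ) ^ 2 ≤ n ^ 2 * τ := by
        rw [← hs2, ← sq_abs, ← sq_abs (Real.sin ψ), ← mul_pow]
        exact pow_le_pow_left₀ (abs_nonneg _) (abs_sin_nat_mul_le n ψ) 2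
      have hGe' : G.eval τ = 2 * Real.sin (n * ψ) ^ 2 / τ := by
        rw [← hGe]; field_simp
      rw [eval_mul, eval_C, hGe']
      refine ⟨by positivity, ?_, ?_⟩
      · rw [div_mul_div_comm, div_le_one (by positivity)]; linarith
      · have : n ^ 2 * τ * (1 / (2 * (n:ℝ) ^ 2) * (2 * Real.sin (n * ψ) ^ 2 / τ)) =
            Real.sin (n * ψ) ^ 2 := by field_simp
        rw [this]; exact Real.sin_sq_le_one _

open Polynomial in
lemma exists_even_part (v : ℝ) (H : ℝ[X]) : ∃ q : ℝ[X], q.natDegree ≤ H.natDegree ∧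
    ∀ u : ℝ, q.eval (u ^ 2) = H.eval ((u - v) ^ 2) + H.eval ((u + v) ^ 2) := by
  have mono : ∀ k : ℕ, (∃ q : ℝ[X], q.natDegree ≤ k ∧
      ∀ u : ℝ, q.eval (u ^ 2) = ((u - v) ^ 2) ^ k + ((u + v) ^ 2) ^ k) := by
    intro k
    induction k using Nat.strong_induction_on with
    | _ k ih =>
      match k with
      | 0 => exact ⟨2, by simp, fun u => by norm_num⟩
      | 1 => exact ⟨2 * X + C (2 * v ^ 2), by compute_degree, fun u => by simp; ring⟩
      | k + 2 =>
        obtain ⟨q, hq, hq'⟩ := ih k (by omega)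
        obtain ⟨r, hr, hr'⟩ := ih (k + 1) (by omega)
        refine ⟨(2 * X + C (2 * v ^ 2)) * r - (X - C (v ^ 2)) ^ 2 * q, ?_, fun u => ?_⟩
        · refine (natDegree_sub_le _ _).trans (max_le ?_ ?_)
          · have : (2 * X + C (2 * v ^ 2) : ℝ[X]).natDegree ≤ 1 := by compute_degree
            exact natDegree_mul_le.trans (by omega)
          · have : ((X - C (v ^ 2)) ^ 2 : ℝ[X]).natDegree ≤ 2 := by compute_degree
            exact natDegree_mul_le.trans (by omega)
        · simp only [eval_sub, eval_mul, hq', hr', eval_add, eval_X, eval_C, eval_pow, eval_ofNat]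
          ring
  choose q hq hq' using mono
  refine ⟨∑ k ∈ range (H.natDegree + 1), C (H.coeff k) * q k, ?_, fun u => ?_⟩
  · refine natDegree_sum_le_of_forall_le _ _ fun k hk => ?_
    exact (natDegree_C_mul_le _ _).trans ((hq k).trans (by simp at hk; omega))
  · rw [eval_finsetSum, H.eval_eq_sum_range, H.eval_eq_sum_range, ← Finset.sum_add_distrib]
    refine Finset.sum_congr rfl fun k _ => ?_
    rw [eval_mul, eval_C, hq']; ring

open Polynomial in
lemma exists_peak_one (r n : ℕ) (hn : 0 < n) (v : ℝ) (hv : v ∈ Set.Icc (0:ℝ) 1) :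
    ∃ q : ℝ[X], q.natDegree ≤ r * n ∧ q.eval (v ^ 2) = 1 ∧ ∀ u ∈ Set.Icc (0:ℝ) 1,
      |q.eval (u ^ 2)| * (1 + n * |u - v|) ^ (2 * r) ≤ 2 * 10 ^ r := by
  obtain ⟨F, hF, hF0, hF1⟩ := exists_fejer n hn
  set H : ℝ[X] := (F.comp (C (1/4) * X)) ^ r with hH
  have hHdeg : H.natDegree ≤ r * n := by
    refine natDegree_pow_le.trans (Nat.mul_le_mul_left _ (natDegree_comp_le.trans ?_))
    have : (C (1/4) * X : ℝ[X]).natDegree ≤ 1 := by compute_degree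
    calc _ ≤ n * 1 := Nat.mul_le_mul hF this
      _ = n := by simp
  have hHe : ∀ s, H.eval s = F.eval (s / 4) ^ r := fun s => by
    simp [hH, eval_comp]; congr 2; ring
  obtain ⟨q, hq, hq'⟩ := exists_even_part v H
  have hH0 : H.eval 0 = 1 := by rw [hHe]; simp [hF0]
  have hHnn : ∀ s ∈ Set.Icc (0:ℝ) 4, 0 ≤ H.eval s := fun s hs => by
    rw [hHe]; exact pow_nonneg (hF1 _ ⟨by linarith [hs.1], by linarith [hs.2]⟩).1 _
  have hdec : ∀ s a : ℝ, s ∈ Set.Icc (0:ℝ) 4 → 0 ≤ a → a ^ 2 ≤ s →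
      H.eval s * (1 + n * a) ^ (2 * r) ≤ 10 ^ r := by
    intro s a hs ha has
    rw [hHe, pow_mul, ← mul_pow]
    obtain ⟨h1, h2, h3⟩ := hF1 (s/4) ⟨by linarith [hs.1], by linarith [hs.2]⟩
    refine pow_le_pow_left₀ (by positivity) ?_ r
    have h4 : (1 + n * a) ^ 2 ≤ 2 * (1 + n ^ 2 * s) := by
      nlinarith [sq_nonneg (1 - n * a), mul_le_mul_of_nonneg_left has (sq_nonneg (n:ℝ))]
    calc _ ≤ F.eval (s/4) * (2 * (1 + n ^ 2 * s)) := by gcongr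
      _ = 2 * F.eval (s/4) + 8 * (n ^ 2 * (s/4) * F.eval (s/4)) := by ring
      _ ≤ _ := by linarith
  set N := 1 + H.eval ((v + v) ^ 2) with hN
  have hN1 : 1 ≤ N := by
    have := hHnn ((v+v)^2) ⟨by positivity, by nlinarith [hv.1, hv.2]⟩
    linarith
  refine ⟨C (1 / N) * q, (natDegree_C_mul_le _ _).trans (hq.trans hHdeg), ?_, fun u hu => ?_⟩
  · rw [eval_mul, eval_C, hq', sub_self, zero_pow two_ne_zero, hH0, ← hN]
    field_simp
  · have m1 : (u - v) ^ 2 ∈ Set.Icc (0:ℝ) 4 := ⟨by positivity, by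
      nlinarith [hv.1, hv.2, hu.1, hu.2]⟩
    have m2 : (u + v) ^ 2 ∈ Set.Icc (0:ℝ) 4 := ⟨by positivity, by
      nlinarith [hv.1, hv.2, hu.1, hu.2]⟩
    have d1 := hdec _ |u - v| m1 (abs_nonneg _) (by rw [sq_abs])
    have d2 := hdec _ |u - v| m2 (abs_nonneg _) (by
      rw [sq_abs]; nlinarith [mul_nonneg hu.1 hv.1])
    have n1 := hHnn _ m1
    have n2 := hHnn _ m2
    rw [eval_mul, eval_C, hq', abs_of_nonneg (by positivity)]
    have : 1 / N ≤ 1 := by rw [div_le_one (by linarith)]; exact hN1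
    calc _ ≤ 1 * (H.eval ((u - v) ^ 2) + H.eval ((u + v) ^ 2)) * (1 + n * |u - v|) ^ (2 * r) := by
          gcongr
      _ ≤ _ := by linarith

lemma one_add_sum_le_prod {ι : Type*} (s : Finset ι) {f : ι → ℝ} (hf : ∀ i, 0 ≤ f i) :
    1 + ∑ i ∈ s, f i ≤ ∏ i ∈ s, (1 + f i) := by
  classical
  induction s using Finset.induction_on with
  | empty => simp
  | insert a s ha ih =>
    rw [Finset.sum_insert ha, Finset.prod_insert ha]
    have := Finset.sum_nonneg fun i (_ : i ∈ s) => hf i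
    nlinarith [hf a, mul_le_mul_of_nonneg_left ih (hf a), mul_nonneg (hf a) this]

variable {d : ℕ}

lemma totalDegree_aeval_le (p : MvPolynomial (Fin d) ℝ) (q : Polynomial ℝ)
    (hp : p.totalDegree ≤ 1) : (Polynomial.aeval p q).totalDegree ≤ q.natDegree := by
  rw [Polynomial.aeval_eq_sum_range]
  refine MvPolynomial.totalDegree_finsetSum_le fun i hi => ?_
  refine (MvPolynomial.totalDegree_smul_le _ _).trans ((MvPolynomial.totalDegree_pow _ _).trans ?_)
  simp only [Finset.mem_range] at hi
  calc i * p.totalDegree ≤ i * 1 := Nat.mul_le_mul_left _ hp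
    _ ≤ _ := by omega

/-- Polynomials of degree `O(n)` peaking at a given point of the simplex. -/
lemma exists_peak (d m : ℕ) : ∃ C : ℝ, 0 < C ∧ ∃ D : ℕ, ∀ n : ℕ, 0 < n → ∀ x ∈ Splx d,
    ∃ Q : MvPolynomial (Fin d) ℝ, Q.totalDegree ≤ D * n ∧ MvPolynomial.eval x Q = 1 ∧
      ∀ w ∈ Splx d, |MvPolynomial.eval w Q| * (1 + n * rootDist w x) ^ m ≤ C := by
  refine ⟨(2 * 10 ^ m) ^ (d + 1), by positivity, (d + 1) * m, fun n hn x hx => ?_⟩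
  have hv : ∀ k, √(xe x k) ∈ Set.Icc (0:ℝ) 1 := fun k =>
    ⟨Real.sqrt_nonneg _, Real.sqrt_le_one.2 (xe_le_one hx k)⟩
  choose q hq hq1 hq2 using fun k => exists_peak_one m n hn _ (hv k)
  have hev : ∀ w, MvPolynomial.eval w (∏ k, Polynomial.aeval (baryPoly k) (q k)) =
      ∏ k, (q k).eval (xe w k) := by
    intro w
    rw [map_prod]
    refine Finset.prod_congr rfl fun k _ => ?_
    have := Polynomial.hom_eval₂ (q k) (algebraMap ℝ (MvPolynomial (Fin d) ℝ))
      (MvPolynomial.eval w) (baryPoly k)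
    rw [Polynomial.aeval_def, this, eval_baryPoly, Polynomial.eval₂_eq_eval_map]
    congr 1
    have : (MvPolynomial.eval w).comp (algebraMap ℝ (MvPolynomial (Fin d) ℝ)) = RingHom.id ℝ := by
      ext; simp
    rw [this, Polynomial.map_id]
  refine ⟨∏ k, Polynomial.aeval (baryPoly k) (q k), ?_, ?_, fun w hw => ?_⟩
  · refine (MvPolynomial.totalDegree_finsetProd _ _).trans ?_
    calc _ ≤ ∑ k : Fin (d+1), m * n := Finset.sum_le_sum fun k _ =>
          (totalDegree_aeval_le _ _ (totalDegree_baryPoly k)).trans (hq k)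
      _ = _ := by simp; ring
  · rw [hev]
    refine Finset.prod_eq_one fun k _ => ?_
    have := hq1 k
    rwa [Real.sq_sqrt (xe_nonneg hx k)] at this
  · rw [hev, Finset.abs_prod]
    have hb : ∀ k, |(q k).eval (xe w k)| * (1 + n * |√(xe w k) - √(xe x k)|) ^ m ≤ 2 * 10 ^ m := by
      intro k
      have := hq2 k (√(xe w k)) ⟨Real.sqrt_nonneg _, Real.sqrt_le_one.2 (xe_le_one hw k)⟩
      rw [Real.sq_sqrt (xe_nonneg hw k)] at this
      refine le_trans ?_ this
      gcongr
      · have : 0 ≤ n * |√(xe w k) - √(xe x k)| := by positivity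
        linarith
      · omega
    have hsum : 1 + n * rootDist w x ≤ ∏ k, (1 + n * |√(xe w k) - √(xe x k)|) := by
      rw [rootDist, Finset.mul_sum]
      exact one_add_sum_le_prod _ fun k => by positivity
    calc _ ≤ (∏ k, |(q k).eval (xe w k)|) * (∏ k, (1 + n * |√(xe w k) - √(xe x k)|)) ^ m := by
          have := rootDist_nonneg w x
          gcongr
      _ = ∏ k, (|(q k).eval (xe w k)| * (1 + n * |√(xe w k) - √(xe x k)|) ^ m) := by
          rw [Finset.prod_mul_distrib, Finset.prod_pow]
      _ ≤ ∏ k : Fin (d+1), (2 * 10 ^ m : ℝ) :=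
          Finset.prod_le_prod (fun k _ => by positivity) fun k _ => hb k
      _ = _ := by simp

end Peak

section Bernstein

open Polynomial in
lemma norm_eval_le_of_norm_le_one {P : ℂ[X]} {M : ℝ} (hP : ∀ z : ℂ, ‖z‖ = 1 → ‖P.eval z‖ ≤ M)
    {z : ℂ} (hz : ‖z‖ ≤ 1) : ‖P.eval z‖ ≤ M := by
  have hb : Bornology.IsBounded (Metric.ball (0:ℂ) 1) := Metric.isBounded_ball
  refine Complex.norm_le_of_forall_mem_frontier_norm_le (f := fun z => P.eval z) hb
    (P.differentiable.diffContOnCl) (fun w hw => ?_) (z := z) ?_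
  · rw [frontier_ball _ one_ne_zero] at hw
    exact hP w (by simpa using hw)
  · rw [closure_ball _ one_ne_zero]; simpa using hz

open Polynomial in
lemma norm_eval_le_of_one_le_norm {P : ℂ[X]} {m : ℕ} (hm : P.natDegree ≤ m) {M : ℝ}
    (hP : ∀ z : ℂ, ‖z‖ = 1 → ‖P.eval z‖ ≤ M) {z : ℂ} (hz : 1 ≤ ‖z‖) :
    ‖P.eval z‖ ≤ M * ‖z‖ ^ m := by
  have hrev : ∀ w : ℂ, w ≠ 0 → (P.reflect m).eval w⁻¹ * w ^ m = P.eval w := fun w hw => by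
    let _ := invertibleOfNonzero hw
    have := eval₂_reflect_mul_pow (RingHom.id ℂ) w m P hm
    simpa [eval₂_id] using this
  have hR : ∀ w : ℂ, ‖w‖ = 1 → ‖(P.reflect m).eval w‖ ≤ M := fun w hw => by
    have hw0 : w ≠ 0 := by rintro rfl; simp at hw
    have h1 := hrev w⁻¹ (inv_ne_zero hw0)
    rw [inv_inv] at h1
    have h2 := hP w⁻¹ (by simp [hw])
    rwa [← h1, norm_mul, norm_pow, norm_inv, hw, inv_one, one_pow, mul_one] at h2
  have hz0 : z ≠ 0 := by rintro rfl; simp at hz; linarith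
  rw [← hrev z hz0, norm_mul, norm_pow]
  gcongr
  refine norm_eval_le_of_norm_le_one hR ?_
  rw [norm_inv]; exact inv_le_one_of_one_le₀ hz

open Polynomial in
/-- A weak form of the Bernstein inequality on the unit circle. -/
lemma norm_eval_derivative_le {P : ℂ[X]} {m : ℕ} (hm : P.natDegree ≤ m) {M : ℝ}
    (hP : ∀ z : ℂ, ‖z‖ = 1 → ‖P.eval z‖ ≤ M) {z : ℂ} (hz : ‖z‖ = 1) :
    ‖P.derivative.eval z‖ ≤ 3 * m * M := by
  have hM : 0 ≤ M := (norm_nonneg _).trans (hP z hz)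
  rcases Nat.eq_zero_or_pos m with rfl | hpos
  · rw [eq_C_of_natDegree_le_zero hm]; simp
  have hm' : (0:ℝ) < m := by exact_mod_cast hpos
  have key : ∀ w ∈ Metric.sphere z (1 / (m:ℝ)), ‖P.eval w‖ ≤ 3 * M := by
    intro w hw
    have hw1 : ‖w‖ ≤ 1 + 1 / m := by
      have : ‖w - z‖ = 1 / m := by simpa [dist_eq_norm] using hw
      calc ‖w‖ = ‖z + (w - z)‖ := by ring_nf
        _ ≤ _ := (norm_add_le _ _).trans (by rw [hz, this])
    rcases le_total ‖w‖ 1 with h | h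
    · exact (norm_eval_le_of_norm_le_one hP h).trans (by linarith)
    · refine (norm_eval_le_of_one_le_norm hm hP h).trans ?_
      have h3 : ‖w‖ ^ m ≤ 3 := by
        calc ‖w‖ ^ m ≤ (Real.exp (1 / m)) ^ m := by
              gcongr
              exact hw1.trans (by linarith [Real.add_one_le_exp (1 / (m:ℝ))])
          _ = Real.exp 1 := by rw [← Real.exp_nat_mul]; congr 1; field_simp
          _ ≤ 3 := by linarith [Real.exp_one_lt_d9]
      nlinarith
  have := Complex.norm_deriv_le_of_forall_mem_sphere_norm_le (by positivity)
    (P.differentiable.diffContOnCl) key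
  rw [Polynomial.deriv] at this
  refine this.trans (le_of_eq ?_)
  field_simp

variable {d : ℕ}

open Polynomial in
lemma exists_trig_rep (A B : Fin d → ℝ) (N : ℕ) (p : MvPolynomial (Fin d) ℝ)
    (hp : p.totalDegree ≤ N) : ∃ P : ℂ[X], P.natDegree ≤ 2 * N ∧ ∀ t : ℝ,
      P.eval (Complex.exp (2 * t * Complex.I)) =
      (MvPolynomial.eval (fun k => (A k * Real.cos t + B k * Real.sin t) ^ 2) p : ℝ) *
        Complex.exp (2 * t * Complex.I) ^ N := by
  set q : Fin d → ℂ[X] := fun k =>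
    C (1/4) * (C (A k - B k * Complex.I) * X + C (A k + B k * Complex.I)) ^ 2 with hq
  have hqd : ∀ k, (q k).natDegree ≤ 2 := fun k => by
    refine (natDegree_C_mul_le _ _).trans (natDegree_pow_le.trans ?_)
    have : (C (A k - B k * Complex.I) * X + C (A k + B k * Complex.I) : ℂ[X]).natDegree ≤ 1 := by
      compute_degree
    omega
  have hqe : ∀ (k) (t : ℝ), (q k).eval (Complex.exp (2 * t * Complex.I)) =
      (((A k * Real.cos t + B k * Real.sin t) ^ 2 : ℝ) : ℂ) * Complex.exp (2 * t * Complex.I) := by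
    intro k t
    have h2 : Complex.exp (2 * t * Complex.I) = Complex.exp (t * Complex.I) ^ 2 := by
      rw [← Complex.exp_nat_mul]; congr 1; push_cast; ring
    have hcs : Complex.exp (t * Complex.I) = Complex.cos t + Complex.sin t * Complex.I :=
      Complex.exp_mul_I _
    have h1 := Complex.cos_sq_add_sin_sq (t:ℂ)
    simp only [hq, eval_mul, eval_C, eval_pow, eval_add, eval_X, h2, hcs]
    push_cast
    set c := Complex.cos t
    set s := Complex.sin t
    have key : (A k - B k * Complex.I) * (c + s * Complex.I) ^ 2 + (A k + B k * Complex.I) =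
        2 * (c + s * Complex.I) * (A k * c + B k * s) := by
      have hI := Complex.I_sq
      have : (A k + B k * Complex.I : ℂ) = (A k + B k * Complex.I) * (c ^ 2 + s ^ 2) := by
        rw [h1, mul_one]
      rw [this]
      linear_combination ((A k : ℂ) * s^2 - B k * s ^ 2 * Complex.I - 2 * B k * c * s) * hI
    rw [key]; ring
  refine ⟨∑ s ∈ p.support, C (Complex.ofReal (MvPolynomial.coeff s p)) *
    ((∏ k, q k ^ s k) * X ^ (N - ∑ k, s k)), ?_,
    fun t => ?_⟩
  · refine natDegree_sum_le_of_forall_le _ _ fun s hs => ?_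
    refine (natDegree_C_mul_le _ _).trans (natDegree_mul_le.trans ?_)
    have h1 : (∏ k, q k ^ s k).natDegree ≤ ∑ k, s k * 2 :=
      (natDegree_prod_le _ _).trans (Finset.sum_le_sum fun k _ =>
        natDegree_pow_le.trans (Nat.mul_le_mul_left _ (hqd k)))
    have h2 : ∑ k, s k ≤ N := by
      have := MvPolynomial.le_totalDegree hs
      rw [Finsupp.sum_fintype _ _ (fun _ => rfl)] at this
      exact this.trans hp
    rw [← Finset.sum_mul] at h1
    rw [natDegree_X_pow]
    omega
  · rw [eval_finsetSum, MvPolynomial.eval_eq', Complex.ofReal_sum, Finset.sum_mul]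
    refine Finset.sum_congr rfl fun s hs => ?_
    have h2 : ∑ k, s k ≤ N := by
      have := MvPolynomial.le_totalDegree hs
      rw [Finsupp.sum_fintype _ _ (fun _ => rfl)] at this
      exact this.trans hp
    rw [eval_mul, eval_C, eval_mul, eval_prod, eval_pow, eval_X]
    simp only [eval_pow, hqe, mul_pow, Finset.prod_mul_distrib]
    rw [Finset.prod_pow_eq_pow_sum, mul_assoc (∏ k, _), ← pow_add, Nat.add_sub_cancel' h2]
    push_cast
    ring

lemma abs_sub_le_of_trig_bound (A B : Fin d → ℝ) (N : ℕ) (p : MvPolynomial (Fin d) ℝ)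
    (hp : p.totalDegree ≤ N) {M : ℝ}
    (hM : ∀ t : ℝ, |MvPolynomial.eval (fun k => (A k * Real.cos t + B k * Real.sin t) ^ 2) p| ≤ M)
    (s t : ℝ) : |MvPolynomial.eval (fun k => (A k * Real.cos t + B k * Real.sin t) ^ 2) p -
      MvPolynomial.eval (fun k => (A k * Real.cos s + B k * Real.sin s) ^ 2) p| ≤
      14 * N * M * |t - s| := by
  obtain ⟨P, hPd, hP⟩ := exists_trig_rep A B N p hp
  set e : ℝ → ℂ := fun t => Complex.exp (2 * t * Complex.I) with he
  have hen : ∀ t, ‖e t‖ = 1 := fun t => by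
    have : e t = Complex.exp ((2 * t : ℝ) * Complex.I) := by simp [he]
    rw [this, Complex.norm_exp_ofReal_mul_I]
  have hP1 : ∀ z : ℂ, ‖z‖ = 1 → ‖P.eval z‖ ≤ M := by
    intro z hz
    have : z = e (Complex.arg z / 2) := by
      have h := Complex.norm_mul_exp_arg_mul_I z
      rw [hz, Complex.ofReal_one, one_mul] at h
      have h2 : 2 * ((Complex.arg z / 2 : ℝ) : ℂ) * Complex.I = Complex.arg z * Complex.I := by
        push_cast; ring
      simp only [he]
      rw [h2, h]
    rw [this, hP, norm_mul, norm_pow, hen, one_pow, mul_one, Complex.norm_real]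
    exact hM _
  set f : ℝ → ℂ := fun t => P.eval (e t) * e (-t) ^ N with hf
  have hfe : ∀ t, f t =
      (MvPolynomial.eval (fun k => (A k * Real.cos t + B k * Real.sin t) ^ 2) p : ℝ) := fun t => by
    have h1 : e t * e (-t) = 1 := by
      simp only [he]
      rw [← Complex.exp_add]; simp
    simp only [hf]
    rw [hP, mul_assoc, ← mul_pow]
    have h1' : Complex.exp (2 * t * Complex.I) * e (-t) = 1 := h1
    rw [h1', one_pow, mul_one]
  have hed : ∀ t, HasDerivAt e (e t * (2 * Complex.I)) t := fun t => by
    have h1 : HasDerivAt (fun t : ℝ => 2 * (t:ℂ) * Complex.I) (2 * Complex.I) t := by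
      have := (((hasDerivAt_id t).ofReal_comp).const_mul (2:ℂ)).mul_const Complex.I
      simpa using this
    exact h1.cexp
  have hed' : ∀ t, HasDerivAt (fun t => e (-t)) (-(e (-t) * (2 * Complex.I))) t := fun t => by
    have h1 : HasDerivAt (fun t : ℝ => 2 * ((-t : ℝ) : ℂ) * Complex.I) (-(2 * Complex.I)) t := by
      have := (((hasDerivAt_neg t).ofReal_comp).const_mul (2:ℂ)).mul_const Complex.I
      simpa using this
    have h2 := h1.cexp
    rw [mul_neg] at h2
    exact h2
  have hfd : ∀ t, HasDerivAt f (P.derivative.eval (e t) * (e t * (2 * Complex.I)) * e (-t) ^ N +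
      P.eval (e t) * (N * e (-t) ^ (N - 1) * (-(e (-t) * (2 * Complex.I))))) t := fun t =>
    (((P.hasDerivAt (e t)).comp t (hed t))).mul ((hed' t).pow N)
  have hM0 : 0 ≤ M := (abs_nonneg _).trans (hM 0)
  have hbound : ∀ t ∈ (Set.univ : Set ℝ), ‖P.derivative.eval (e t) * (e t * (2 * Complex.I)) *
      e (-t) ^ N + P.eval (e t) * (N * e (-t) ^ (N - 1) * (-(e (-t) * (2 * Complex.I))))‖ ≤
      14 * N * M := by
    intro t _
    refine (norm_add_le _ _).trans ?_
    simp only [norm_mul, norm_neg, norm_pow, hen, one_pow, Complex.norm_I, Complex.norm_natCast,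
      Complex.norm_ofNat, mul_one, one_mul]
    have h1 := norm_eval_derivative_le hPd hP1 (hen t)
    have h2 := hP1 _ (hen t)
    push_cast at h1
    have hN : (0:ℝ) ≤ N := Nat.cast_nonneg N
    nlinarith [mul_le_mul_of_nonneg_right h2 hN]
  have := Convex.norm_image_sub_le_of_norm_hasDerivWithin_le
    (fun t _ => (hfd t).hasDerivWithinAt) hbound convex_univ (Set.mem_univ s) (Set.mem_univ t)
  rwa [hfe, hfe, ← Complex.ofReal_sub, Complex.norm_real, Real.norm_eq_abs, Real.norm_eq_abs]
    at this

/-- The Bernstein inequality on the simplex, as a Lipschitz bound for the geodesic distance. -/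
lemma abs_eval_sub_le (N : ℕ) (p : MvPolynomial (Fin d) ℝ) (hp : p.totalDegree ≤ N) {M : ℝ}
    (hM : ∀ w ∈ Splx d, |MvPolynomial.eval w p| ≤ M) {x z : Fin d → ℝ} (hx : x ∈ Splx d)
    (hz : z ∈ Splx d) :
    |MvPolynomial.eval x p - MvPolynomial.eval z p| ≤ 14 * N * M * dT x z := by
  set θ := dT x z with hθ
  rcases (dT_nonneg x z).eq_or_lt with h0 | hpos
  · have : x = z := xe_ext fun k => by
      have := abs_sqrt_sub_le_dT hx hz k
      rw [← h0] at this
      have h1 : √(xe x k) = √(xe z k) := by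
        have := abs_nonpos_iff.1 this; linarith
      exact (Real.sqrt_inj (xe_nonneg hx k) (xe_nonneg hz k)).1 h1
    subst this
    rw [hθ, ← h0]; simp
  have hsin : 0 < Real.sin θ :=
    Real.sin_pos_of_pos_of_lt_pi hpos (by linarith [dT_le_pi_div_two x z, Real.pi_pos])
  have hcos : Real.cos θ = ∑ k, √(xe x k) * √(xe z k) := cos_dT hx hz
  set a : Fin (d+1) → ℝ := fun k => √(xe x k) with ha
  set c : Fin (d+1) → ℝ := fun k => √(xe z k) with hc
  set b : Fin (d+1) → ℝ := fun k => (c k - Real.cos θ * a k) / Real.sin θ with hb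
  have haa : ∑ k, a k ^ 2 = 1 := sum_sq_sqrt_xe hx
  have hcc : ∑ k, c k ^ 2 = 1 := sum_sq_sqrt_xe hz
  have hac : ∑ k, a k * c k = Real.cos θ := hcos.symm
  have hab : ∑ k, a k * b k = 0 := by
    have : ∀ k, a k * b k = (a k * c k - Real.cos θ * a k ^ 2) / Real.sin θ := fun k => by
      simp only [hb]; ring
    simp only [this]
    rw [← Finset.sum_div, Finset.sum_sub_distrib, ← Finset.mul_sum, haa, hac]; simp
  have hbb : ∑ k, b k ^ 2 = 1 := by
    have : ∀ k, b k ^ 2 = (c k ^ 2 - 2 * Real.cos θ * (a k * c k) + Real.cos θ ^ 2 * a k ^ 2) /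
        Real.sin θ ^ 2 := fun k => by simp only [hb]; ring
    simp only [this]
    rw [← Finset.sum_div, Finset.sum_add_distrib, Finset.sum_sub_distrib, ← Finset.mul_sum,
      ← Finset.mul_sum, haa, hac, hcc, div_eq_one_iff_eq (by positivity)]
    have := Real.sin_sq_add_cos_sq θ
    linarith
  set g : ℝ → Fin d → ℝ := fun t k =>
    (a k.castSucc * Real.cos t + b k.castSucc * Real.sin t) ^ 2 with hg
  have hgsum : ∀ t, ∑ k, (a k * Real.cos t + b k * Real.sin t) ^ 2 = 1 := fun t => by
    have : ∀ k, (a k * Real.cos t + b k * Real.sin t) ^ 2 = a k ^ 2 * Real.cos t ^ 2 +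
      a k * b k * (2 * Real.cos t * Real.sin t) + b k ^ 2 * Real.sin t ^ 2 := fun k => by ring
    simp only [this, Finset.sum_add_distrib, ← Finset.sum_mul, haa, hab, hbb]
    linarith [Real.sin_sq_add_cos_sq t]
  have hgxe : ∀ t k, xe (g t) k = (a k * Real.cos t + b k * Real.sin t) ^ 2 := fun t k => by
    induction k using Fin.lastCases with
    | last =>
      have := hgsum t
      rw [Fin.sum_univ_castSucc] at this
      rw [xe_last]; simp only [hg]; linarith
    | cast i => simp [hg]
  have hgS : ∀ t, g t ∈ Splx d := fun t => mem_Splx_iff.2 fun k => by rw [hgxe]; positivity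
  have hg0 : g 0 = x := xe_ext fun k => by
    rw [hgxe]; simp [ha, Real.sq_sqrt (xe_nonneg hx k)]
  have hg1 : g θ = z := xe_ext fun k => by
    rw [hgxe]
    have : a k * Real.cos θ + b k * Real.sin θ = c k := by
      simp only [hb]; field_simp; ring
    rw [this]; exact Real.sq_sqrt (xe_nonneg hz k)
  have := abs_sub_le_of_trig_bound (fun k : Fin d => a k.castSucc) (fun k => b k.castSucc) N p hp
    (M := M) (fun t => hM _ (hgS t)) θ 0
  rw [zero_sub, abs_neg, abs_of_pos hpos] at this
  change |MvPolynomial.eval (g 0) p - MvPolynomial.eval (g θ) p| ≤ _ at this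
  rwa [hg0, hg1] at this

end Bernstein

section JacobiMeasure

variable {d : ℕ} {κ : Fin (d+1) → ℝ}

/-- The probability measure with density `b_κ W_κ` on the simplex. -/
def jacobiMeasure (κ : Fin (d+1) → ℝ) : Measure (Fin d → ℝ) :=
  (volume.restrict (Splx d)).withDensity fun x => ENNReal.ofReal (bk κ * Wk κ x)

lemma bk_pos (hκ : ∀ i, 0 ≤ κ i) : 0 < bk κ :=
  div_pos (Real.Gamma_pos_of_pos (by
      have := Finset.sum_nonneg fun i (_ : i ∈ univ) => hκ i
      positivity))
    (Finset.prod_pos fun i _ => Real.Gamma_pos_of_pos (by linarith [hκ i]))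

lemma Wk_nonneg {x : Fin d → ℝ} (hx : x ∈ Splx d) : 0 ≤ Wk κ x := by
  rw [Wk_eq_prod]
  exact Finset.prod_nonneg fun k _ => Real.rpow_nonneg (xe_nonneg hx k) _

lemma continuous_Wk (hκ : ∀ i, 0 ≤ κ i) : Continuous (Wk κ) := by
  rw [show Wk κ = fun x => ∏ k, xe x k ^ κ k from funext (Wk_eq_prod κ)]
  exact continuous_finsetProd _ fun k _ => (continuous_xe k).rpow_const fun x => Or.inr (hκ k)

lemma measurableSet_Splx (d : ℕ) : MeasurableSet (Splx d) := (isCompact_Splx d).measurableSet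

lemma isFiniteMeasure_jacobiMeasure (hκ : ∀ i, 0 ≤ κ i) : IsFiniteMeasure (jacobiMeasure κ) := by
  refine isFiniteMeasure_withDensity_ofReal (Integrable.hasFiniteIntegral ?_)
  exact ((continuous_const.mul (continuous_Wk hκ)).continuousOn).integrableOn_compact
    (isCompact_Splx d)

lemma ae_mem_Splx (κ : Fin (d+1) → ℝ) : ∀ᵐ x ∂jacobiMeasure κ, x ∈ Splx d :=
  (withDensity_absolutelyContinuous _ _).ae_le (ae_restrict_mem (measurableSet_Splx d))

lemma integral_jacobiMeasure (hκ : ∀ i, 0 ≤ κ i) (f : (Fin d → ℝ) → ℝ) :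
    ∫ x, f x ∂jacobiMeasure κ = bk κ * ∫ x in Splx d, f x * Wk κ x := by
  rw [jacobiMeasure, integral_withDensity_eq_integral_toReal_smul
    (by have := (continuous_Wk hκ).measurable; fun_prop) (by simp), ← integral_const_mul]
  refine setIntegral_congr_fun (measurableSet_Splx d) fun x hx => ?_
  simp only [smul_eq_mul]
  rw [ENNReal.toReal_ofReal (mul_nonneg (bk_pos hκ).le (Wk_nonneg hx))]
  ring

lemma ipk_eq_integral (hκ : ∀ i, 0 ≤ κ i) (f g : (Fin d → ℝ) → ℝ) :
    ipk κ f g = ∫ x, f x * g x ∂jacobiMeasure κ := (integral_jacobiMeasure hκ _).symm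

lemma integrable_jacobiMeasure (hκ : ∀ i, 0 ≤ κ i) {f : (Fin d → ℝ) → ℝ} (hf : Continuous f) :
    Integrable f (jacobiMeasure κ) := by
  have := isFiniteMeasure_jacobiMeasure hκ
  obtain ⟨C, hC⟩ := (isCompact_Splx d).exists_bound_of_continuousOn hf.continuousOn
  exact Integrable.of_bound hf.aestronglyMeasurable C ((ae_mem_Splx κ).mono hC)

end JacobiMeasure

section BallMass

variable {d : ℕ} {κ : Fin (d+1) → ℝ}

lemma exists_measurePreserving_swap (m : Fin (d+1)) : ∃ T : (Fin d → ℝ) → (Fin d → ℝ),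
    MeasurePreserving T volume volume ∧
      ∀ y k, xe (T y) k = xe y (Equiv.swap m (Fin.last d) k) := by
  induction m using Fin.lastCases with
  | last => exact ⟨id, MeasurePreserving.id _, fun y k => by simp⟩
  | cast i =>
    let L : (Fin d → ℝ) →ₗ[ℝ] (Fin d → ℝ) :=
      { toFun := fun y => Function.update y i (-∑ j, y j)
        map_add' := fun x y => by
          ext j; by_cases h : j = i
          · subst h; simp [Finset.sum_add_distrib]; ring
          · simp [h]
        map_smul' := fun c y => by
          ext j; by_cases h : j = i
          · subst h; simp [Finset.mul_sum]
          · simp [h] }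
    have hL : ∀ y, L y = Function.update y i (-∑ j, y j) := fun y => rfl
    have hLL : L ∘ₗ L = LinearMap.id := by
      refine LinearMap.ext fun y => ?_
      ext j
      simp only [LinearMap.comp_apply, hL, LinearMap.id_apply]
      by_cases h : j = i
      · subst h
        simp only [Function.update_self]
        rw [Finset.sum_update_of_mem (Finset.mem_univ j),
          ← Finset.add_sum_erase _ _ (Finset.mem_univ j), Finset.sdiff_singleton_eq_erase]
        ring
      · simp [h]
    have hdet : |LinearMap.det L| = 1 := by
      have h1 : LinearMap.det L * LinearMap.det L = 1 := by
        rw [← LinearMap.det_comp, hLL, LinearMap.det_id]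
      have h2 : |LinearMap.det L| * |LinearMap.det L| = 1 := by rw [← abs_mul, h1, abs_one]
      nlinarith [abs_nonneg (LinearMap.det L)]
    have hdet0 : LinearMap.det L ≠ 0 := fun h => by simp [h] at hdet
    have hLm : MeasurePreserving L volume volume := by
      refine ⟨(LinearMap.continuous_of_finiteDimensional L).measurable, ?_⟩
      rw [Measure.map_linearMap_addHaar_eq_smul_addHaar volume hdet0, abs_inv, hdet]; simp
    refine ⟨fun y => L y + Pi.single i 1, (measurePreserving_add_right volume _).comp hLm,
      fun y k => ?_⟩
    have hsum : ∑ j, (L y + Pi.single i 1 : Fin d → ℝ) j = 1 - y i := by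
      simp only [hL, Pi.add_apply, Finset.sum_add_distrib]
      rw [Finset.sum_update_of_mem (Finset.mem_univ i),
          ← Finset.add_sum_erase _ _ (Finset.mem_univ i), Finset.sdiff_singleton_eq_erase]
      simp; ring
    induction k using Fin.lastCases with
    | last => rw [Equiv.swap_apply_right, xe_last, xe_castSucc, hsum]; ring
    | cast j =>
      by_cases h : j = i
      · subst h
        rw [Equiv.swap_apply_left, xe_last, xe_castSucc]
        simp [hL]; ring
      · rw [Equiv.swap_apply_of_ne_of_ne (by simpa using h) (Fin.castSucc_ne_last j)]
        simp [hL, h]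

lemma continuous_rootDist (x : Fin d → ℝ) : Continuous (rootDist x) :=
  continuous_finsetSum _ fun k _ =>
    (continuous_const.sub (Real.continuous_sqrt.comp (continuous_xe k))).abs

lemma exists_le_xe {x : Fin d → ℝ} : ∃ m : Fin (d+1), 1 / ((d:ℝ)+1) ≤ xe x m := by
  obtain ⟨m, -, hm⟩ := Finset.exists_le_of_sum_le (s := univ)
    (f := fun _ : Fin (d+1) => 1 / ((d:ℝ)+1))
    (g := xe x) Finset.univ_nonempty (by
      rw [sum_xe, Finset.sum_const, Finset.card_univ, Fintype.card_fin, nsmul_eq_mul]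
      push_cast; rw [mul_one_div_cancel (by positivity)])
  exact ⟨m, hm⟩

/-- The geometric estimates behind the lower bound for the mass of a ball: a box near a point
whose last barycentric coordinate is not small. -/
lemma box_estimate {b ν : ℝ} (hb : 0 < b) (hb1 : 8 * ((d:ℝ)+1) ^ 2 * b ≤ 1) (hν : 0 < ν)
    (hν1 : ν ≤ 1) {y : Fin d → ℝ} (hy : y ∈ Splx d) (hyl : 1 / ((d:ℝ)+1) ≤ xe y (Fin.last d))
    {w : Fin d → ℝ} (hw : ∀ k, w k ∈ Set.Icc (y k + b ^ 2 / 2 * (√(y k) * ν + ν ^ 2))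
      (y k + 2 * (b ^ 2 / 2 * (√(y k) * ν + ν ^ 2)))) :
    (∀ k, b ^ 2 / 2 * (xe y k + ν ^ 2) ≤ xe w k) ∧ rootDist y w ≤ 8 * ((d:ℝ)+1) ^ 2 * b * ν := by
  have hd0 : (0:ℝ) ≤ d := Nat.cast_nonneg d
  have hbd : 8 * ((d:ℝ)+1) ^ 2 * b ^ 2 ≤ b := by nlinarith
  have hb8 : 8 * b ≤ 1 := by
    have : 1 ≤ ((d:ℝ)+1) ^ 2 := by nlinarith
    nlinarith
  have hb2 : b ^ 2 ≤ b := by nlinarith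
  have hy0 : ∀ k, 0 ≤ y k := fun k => by simpa using xe_nonneg hy k.castSucc
  have hy1 : ∀ k, √(y k) ≤ 1 := fun k =>
    Real.sqrt_le_one.2 (by simpa using xe_le_one hy k.castSucc)
  have hinc : ∀ k, b ^ 2 / 2 * (√(y k) * ν + ν ^ 2) ≤ b ^ 2 * ν := fun k => by
    have : √(y k) * ν + ν ^ 2 ≤ 2 * ν := by nlinarith [hy1 k]
    nlinarith [sq_nonneg b]
  have hsum : |xe w (Fin.last d) - xe y (Fin.last d)| ≤ 2 * d * b ^ 2 * ν := by
    rw [xe_last, xe_last]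
    have : (1 - ∑ i, w i) - (1 - ∑ i, y i) = ∑ i, (y i - w i) := by
      rw [Finset.sum_sub_distrib]; ring
    rw [this]
    refine (Finset.abs_sum_le_sum_abs _ _).trans ?_
    calc _ ≤ ∑ _i : Fin d, 2 * b ^ 2 * ν := Finset.sum_le_sum fun k _ => by
          have h1 := hw k
          have h2 : 0 ≤ b ^ 2 / 2 * (√(y k) * ν + ν ^ 2) := by positivity
          rw [abs_le]; constructor <;> linarith [h1.1, h1.2, hinc k, mul_nonneg (sq_nonneg b) hν.le]
      _ = _ := by simp; ring
  have hdb : 4 * (d:ℝ) * ((d:ℝ) + 1) * b ^ 2 ≤ 1 := by nlinarith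
  have hdb' : 2 * (d:ℝ) * b ^ 2 * ν ≤ 1 / ((d:ℝ)+1) / 2 := by
    rw [le_div_iff₀ (by norm_num), le_div_iff₀ (by positivity)]
    nlinarith [mul_le_mul_of_nonneg_left hν1 (by positivity : (0:ℝ) ≤ 4 * d * (d+1) * b^2)]
  have hwl : 1 / ((d:ℝ)+1) / 2 ≤ xe w (Fin.last d) := by
    rw [abs_le] at hsum; linarith
  refine ⟨fun k => ?_, ?_⟩
  · induction k using Fin.lastCases with
    | last =>
      refine le_trans ?_ hwl
      have h1 := xe_le_one hy (Fin.last d)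
      have h2 : ν ^ 2 ≤ 1 := by nlinarith
      rw [div_div, le_div_iff₀ (by positivity)]
      have h3 : b ^ 2 / 2 * (xe y (Fin.last d) + ν ^ 2) ≤ b ^ 2 := by nlinarith [sq_nonneg b]
      have h4 : b ^ 2 * ((d + 1) * 2) ≤ 1 := by nlinarith
      calc _ ≤ b ^ 2 * (((d:ℝ) + 1) * 2) := by gcongr
        _ ≤ 1 := h4
    | cast i =>
      simp only [xe_castSucc]
      refine le_trans ?_ (hw i).1
      have : 0 ≤ b ^ 2 / 2 * (√(y i) * ν) := by positivity
      nlinarith [hy0 i]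
  · unfold rootDist
    rw [Fin.sum_univ_castSucc]
    have h1 : ∀ i : Fin d, |√(xe y i.castSucc) - √(xe w i.castSucc)| ≤ b * ν := fun i => by
      simp only [xe_castSucc]
      have hle : y i ≤ w i := by
        have : 0 ≤ b ^ 2 / 2 * (√(y i) * ν + ν ^ 2) := by positivity
        linarith [(hw i).1]
      have h2 : √(w i) ≤ √(y i) + b * ν := by
        rw [Real.sqrt_le_left (by positivity)]
        refine (hw i).2.trans ?_
        have h5 := Real.sq_sqrt (hy0 i)
        have h6 : 0 ≤ √(y i) * ν := by positivity
        nlinarith [mul_le_mul_of_nonneg_right hb2 h6, mul_nonneg hb.le h6]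
      rw [abs_le]
      constructor <;> linarith [Real.sqrt_le_sqrt hle, mul_pos hb hν]
    have h2 : |√(xe y (Fin.last d)) - √(xe w (Fin.last d))| ≤ 2 * d * (d + 1) * b ^ 2 * ν := by
      have hyl0 := xe_nonneg hy (Fin.last d)
      have hwl0 : 0 ≤ xe w (Fin.last d) := le_trans (by positivity) hwl
      have e : xe w (Fin.last d) - xe y (Fin.last d) = -((√(xe y (Fin.last d)) - √(xe w (Fin.last d))) *
          (√(xe y (Fin.last d)) + √(xe w (Fin.last d)))) := by
        linear_combination Real.sq_sqrt hyl0 - Real.sq_sqrt hwl0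
      rw [e, abs_neg, abs_mul] at hsum
      have h3 : 1 / ((d:ℝ) + 1) ≤ |√(xe y (Fin.last d)) + √(xe w (Fin.last d))| := by
        rw [abs_of_nonneg (by positivity)]
        have h4 : 1 / ((d:ℝ)+1) ≤ √(xe y (Fin.last d)) := by
          refine hyl.trans (Real.le_sqrt_of_sq_le ?_)
          nlinarith [xe_le_one hy (Fin.last d)]
        linarith [Real.sqrt_nonneg (xe w (Fin.last d))]
      have h4 := (mul_le_mul_of_nonneg_left h3 (abs_nonneg _)).trans hsum
      rw [mul_one_div, div_le_iff₀ (by positivity)] at h4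
      linarith
    have h3 := Finset.sum_le_sum fun i (_ : i ∈ univ) => h1 i
    simp only [Finset.sum_const, Finset.card_univ, Fintype.card_fin, nsmul_eq_mul] at h3
    have h4 : 2 * (d:ℝ) * (d + 1) * b ^ 2 ≤ b := by nlinarith
    have h5 : ((d:ℝ) + 1) * b ≤ 8 * ((d:ℝ)+1) ^ 2 * b := by nlinarith [mul_nonneg hd0 hb.le]
    calc _ ≤ (d:ℝ) * (b * ν) + 2 * d * (d + 1) * b ^ 2 * ν := add_le_add h3 h2
      _ = (d * b + 2 * d * (d + 1) * b ^ 2) * ν := by ring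
      _ ≤ _ := by gcongr; linarith

/-- Lower bound for the mass of balls of radius comparable to `1/n`. -/
lemma exists_ballMass (hκ : ∀ i, 0 ≤ κ i) {c₀ : ℝ} (hc₀ : 0 < c₀) :
    ∃ c > 0, ∀ n : ℕ, 0 < n → ∀ x ∈ Splx d,
      c * Wkn κ n x / (n:ℝ) ^ d ≤
        (jacobiMeasure κ).real {w ∈ Splx d | rootDist x w ≤ c₀ / n} := by
  have hfin := isFiniteMeasure_jacobiMeasure hκ
  set b : ℝ := min 1 c₀ / (8 * ((d:ℝ)+1) ^ 2) with hbdef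
  have hb : 0 < b := by have := lt_min one_pos hc₀; positivity
  have hb0 : 8 * ((d:ℝ)+1) ^ 2 * b = min 1 c₀ := by rw [hbdef]; field_simp
  have hb1 : 8 * ((d:ℝ)+1) ^ 2 * b ≤ 1 := hb0.trans_le (min_le_left _ _)
  set c := b ^ 2 / 2 with hc
  have hc0 : 0 < c := by positivity
  have hbk := bk_pos hκ
  refine ⟨bk κ * (∏ k, c ^ κ k) * c ^ d / 2, ?_, fun n hn x hx => ?_⟩
  · have := Finset.prod_pos fun k (_ : k ∈ univ) => Real.rpow_pos_of_pos hc0 (κ k)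
    positivity
  have hn' : (0:ℝ) < n := by exact_mod_cast hn
  set ν := 1 / (n:ℝ) with hν
  have hν0 : 0 < ν := by positivity
  have hν1 : ν ≤ 1 := by
    rw [hν, div_le_one hn']; exact_mod_cast hn
  have hν2 : 1 / (n:ℝ) ^ 2 = ν ^ 2 := by rw [hν]; ring
  obtain ⟨m, hm⟩ := exists_le_xe (x := x)
  obtain ⟨T, hT, hTx⟩ := exists_measurePreserving_swap m
  set σ := Equiv.swap m (Fin.last d) with hσ
  set y := T x with hy
  have hyS : y ∈ Splx d := mem_Splx_iff.2 fun k => by rw [hy, hTx]; exact xe_nonneg hx _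
  have hyl : 1 / ((d:ℝ)+1) ≤ xe y (Fin.last d) := by
    rw [hy, hTx, hσ, Equiv.swap_apply_right]; exact hm
  set V : ℝ := ∏ k, (c * (xe x k + ν ^ 2)) ^ κ k with hV
  have hx0 : ∀ k, 0 < xe x k + ν ^ 2 := fun k => by
    have := xe_nonneg hx k; positivity
  have hV0 : 0 ≤ V := Finset.prod_nonneg fun k _ => by have := hx0 k; positivity
  set A : Set (Fin d → ℝ) := {w | w ∈ Splx d ∧ rootDist x w ≤ c₀ / n ∧ V ≤ Wk κ w} with hA
  have hAm : MeasurableSet A := by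
    have e : A = Splx d ∩ ({w | rootDist x w ≤ c₀ / n} ∩ {w | V ≤ Wk κ w}) := rfl
    rw [e]
    refine (measurableSet_Splx d).inter ((measurableSet_le ?_ measurable_const).inter
      (measurableSet_le measurable_const ?_))
    · exact (continuous_rootDist x).measurable
    · exact (continuous_Wk hκ).measurable
  set B : Set (Fin d → ℝ) := Set.Icc (fun k => y k + c * (√(y k) * ν + ν ^ 2))
      (fun k => y k + 2 * (c * (√(y k) * ν + ν ^ 2))) with hB
  have hBA : B ⊆ T ⁻¹' A := by
    intro w hw
    obtain ⟨h1, h2⟩ := box_estimate hb hb1 hν0 hν1 hyS hyl (w := w)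
      (fun k => ⟨hw.1 k, hw.2 k⟩)
    have h3 : ∀ k, c * (xe x k + ν ^ 2) ≤ xe (T w) k := fun k => by
      have := h1 (σ k)
      rw [hy, hTx, hσ, Equiv.swap_apply_self] at this
      rwa [hTx]
    refine ⟨mem_Splx_iff.2 fun k => le_trans (by have := hx0 k; positivity) (h3 k), ?_, ?_⟩
    · have h4 : rootDist x (T w) = rootDist y w := by
        unfold rootDist
        rw [← Equiv.sum_comp σ]
        refine Finset.sum_congr rfl fun k _ => ?_
        rw [hTx, hy, hTx, hσ, Equiv.swap_apply_self]
      rw [h4]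
      refine h2.trans ?_
      rw [hb0, hν, mul_one_div]
      gcongr
      exact min_le_right _ _
    · rw [Wk_eq_prod]
      refine Finset.prod_le_prod (fun k _ => by have := hx0 k; positivity) fun k _ =>
        Real.rpow_le_rpow (by have := hx0 k; positivity) (h3 k) (hκ k)
  have hy0 : ∀ k, 0 ≤ y k := fun k => by simpa using xe_nonneg hyS k.castSucc
  have hvolB : volume B = ENNReal.ofReal (∏ k, c * (√(y k) * ν + ν ^ 2)) := by
    rw [hB, Real.volume_Icc_pi, ENNReal.ofReal_prod_of_nonneg]
    · refine Finset.prod_congr rfl fun k _ => ?_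
      congr 1; ring
    · intro k _; positivity
  have hvol : ENNReal.ofReal (∏ k, c * (√(y k) * ν + ν ^ 2)) ≤ volume A := by
    rw [← hvolB, ← hT.measure_preimage hAm.nullMeasurableSet]
    exact measure_mono hBA
  have hmu : ENNReal.ofReal (bk κ * V * ∏ k, c * (√(y k) * ν + ν ^ 2)) ≤ jacobiMeasure κ A := by
    rw [jacobiMeasure, withDensity_apply _ hAm, Measure.restrict_restrict hAm,
      Set.inter_eq_left.2 (fun w hw => hw.1), ENNReal.ofReal_mul (by positivity)]
    calc _ ≤ ENNReal.ofReal (bk κ * V) * volume A := by gcongr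
      _ = ∫⁻ _ in A, ENNReal.ofReal (bk κ * V) := by simp
      _ ≤ _ := setLIntegral_mono' hAm fun w hw => by
        gcongr; exact hw.2.2
  have hmur : bk κ * V * ∏ k, c * (√(y k) * ν + ν ^ 2) ≤ (jacobiMeasure κ).real
      {w ∈ Splx d | rootDist x w ≤ c₀ / n} := by
    refine (ENNReal.ofReal_le_iff_le_toReal (measure_ne_top _ _)).1 (hmu.trans (measure_mono ?_))
    exact fun w hw => ⟨hw.1, hw.2.1⟩
  refine le_trans ?_ hmur
  have hprod : (c * ν) ^ d / 2 * ∏ k, (xe x k + ν ^ 2) ^ ((1:ℝ)/2) ≤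
      ∏ k, c * (√(y k) * ν + ν ^ 2) := by
    have e1 : ∏ k, (xe x k + ν ^ 2) ^ ((1:ℝ)/2) = ∏ k, √(xe y k + ν ^ 2) := by
      rw [← Equiv.prod_comp σ]
      refine Finset.prod_congr rfl fun k _ => ?_
      rw [hy, hTx, Real.sqrt_eq_rpow]
    rw [e1, Fin.prod_univ_castSucc]
    have h1 : √(xe y (Fin.last d) + ν ^ 2) ≤ 2 := by
      rw [Real.sqrt_le_left (by norm_num)]
      nlinarith [xe_le_one hyS (Fin.last d)]
    have h2 : (c * ν) ^ d * ∏ k : Fin d, √(xe y k.castSucc + ν ^ 2) ≤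
        ∏ k, c * (√(y k) * ν + ν ^ 2) := by
      have : (c * ν) ^ d = ∏ _k : Fin d, c * ν := by simp
      rw [this, ← Finset.prod_mul_distrib]
      refine Finset.prod_le_prod (fun k _ => by positivity) fun k _ => ?_
      have h3 : √(xe y k.castSucc + ν ^ 2) ≤ √(y k) + ν := by
        rw [Real.sqrt_le_left (by positivity), xe_castSucc]
        nlinarith [Real.sq_sqrt (hy0 k), mul_nonneg (Real.sqrt_nonneg (y k)) hν0.le]
      calc _ ≤ c * ν * (√(y k) + ν) := by gcongr
        _ = _ := by ring
    have h3 : 0 ≤ (c * ν) ^ d * ∏ k : Fin d, √(xe y k.castSucc + ν ^ 2) := by positivity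
    calc _ = ((c * ν) ^ d * ∏ k : Fin d, √(xe y k.castSucc + ν ^ 2)) *
          (√(xe y (Fin.last d) + ν ^ 2) / 2) := by ring
      _ ≤ ((c * ν) ^ d * ∏ k : Fin d, √(xe y k.castSucc + ν ^ 2)) * 1 := by gcongr; linarith
      _ ≤ _ := by rwa [mul_one]
  have hWV : bk κ * (∏ k, c ^ κ k) * c ^ d / 2 * Wkn κ n x / (n:ℝ) ^ d =
      bk κ * V * ((c * ν) ^ d / 2 * ∏ k, (xe x k + ν ^ 2) ^ ((1:ℝ)/2)) := by
    have e1 : V = (∏ k, c ^ κ k) * ∏ k, (xe x k + ν ^ 2) ^ κ k := by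
      rw [hV, ← Finset.prod_mul_distrib]
      exact Finset.prod_congr rfl fun k _ => Real.mul_rpow hc0.le (hx0 k).le
    have e2 : Wkn κ n x = (∏ k, (xe x k + ν ^ 2) ^ κ k) * ∏ k, (xe x k + ν ^ 2) ^ ((1:ℝ)/2) := by
      rw [Wkn, ← Finset.prod_mul_distrib]
      exact Finset.prod_congr rfl fun k _ => by rw [hν2, Real.rpow_add (hx0 k)]
    have e3 : ν ^ d = 1 / (n:ℝ) ^ d := by rw [hν, div_pow, one_pow]
    rw [e1, e2, mul_pow, e3]; ring
  rw [hWV]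
  gcongr

end BallMass

section Christoffel

variable {d : ℕ} {κ : Fin (d+1) → ℝ}

lemma continuous_eval (p : MvPolynomial (Fin d) ℝ) :
    Continuous fun x : Fin d → ℝ => MvPolynomial.eval x p := MvPolynomial.continuous_eval p

lemma continuous_Wkn (hκ : ∀ i, 0 ≤ κ i) (n : ℕ) : Continuous (Wkn κ n) :=
  continuous_finsetProd _ fun k _ => ((continuous_xe k).add continuous_const).rpow_const
    fun _ => Or.inr (by linarith [hκ k])

/-- The pointwise bound of polynomials of degree `O(n)` by their `L²` norm. -/
lemma exists_christoffel (hκ : ∀ i, 0 ≤ κ i) (D : ℕ) : ∃ C > 0, ∀ n : ℕ, 0 < n →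
    ∀ p : MvPolynomial (Fin d) ℝ, p.totalDegree ≤ D * n → ∀ x ∈ Splx d,
      (MvPolynomial.eval x p) ^ 2 * Wkn κ n x ≤
        C * (n:ℝ) ^ d * ∫ w, (MvPolynomial.eval w p) ^ 2 ∂jacobiMeasure κ := by
  have hfin := isFiniteMeasure_jacobiMeasure hκ
  set s := 2 * ∑ i, κ i + ((d:ℝ) + 1) with hs
  obtain ⟨C₁, hC₁, D₁, hpeak⟩ := exists_peak d ⌈s⌉₊
  obtain ⟨c, hc, hball⟩ := exists_ballMass hκ (c₀ := 1 / (56 * ((D:ℝ) + D₁ + 1) * C₁))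
    (by positivity)
  refine ⟨4 * C₁ ^ 2 / c, by positivity, fun n hn p hp x hx => ?_⟩
  have hn' : (0:ℝ) < n := by exact_mod_cast hn
  obtain ⟨w₀, hw₀, hmax⟩ := (isCompact_Splx d).exists_isMaxOn ⟨x, hx⟩
    (f := fun w => (MvPolynomial.eval w p) ^ 2 * Wkn κ n w)
    (((continuous_eval p).pow 2).mul (continuous_Wkn hκ n)).continuousOn
  refine (hmax hx).trans ?_
  simp only
  obtain ⟨Q, hQd, hQ1, hQ⟩ := hpeak n hn w₀ hw₀
  have hbase : ∀ w, 1 ≤ 1 + n * rootDist w w₀ := fun w => by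
    have := rootDist_nonneg w w₀
    have : 0 ≤ n * rootDist w w₀ := by positivity
    linarith
  have hpw : ∀ w ∈ Splx d, |MvPolynomial.eval w p| ≤
      |MvPolynomial.eval w₀ p| * (1 + n * rootDist w w₀) ^ ⌈s⌉₊ := fun w hw => by
    refine abs_le_of_sq_le_sq ?_ (by have := hbase w; positivity)
    have h1 : (MvPolynomial.eval w p) ^ 2 * Wkn κ n w ≤ (MvPolynomial.eval w₀ p) ^ 2 * Wkn κ n w₀ :=
      hmax hw
    have h2 : Wkn κ n w₀ ≤ Wkn κ n w * (1 + n * rootDist w w₀) ^ s := Wkn_le hκ hn hw hw₀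
    have hW := Wkn_pos (κ := κ) hn hw
    have h3 : (1 + n * rootDist w w₀) ^ s ≤ ((1 + n * rootDist w w₀) ^ ⌈s⌉₊) ^ 2 := by
      have h4 : (1 + n * rootDist w w₀) ^ s ≤ (1 + n * rootDist w w₀) ^ ⌈s⌉₊ := by
        rw [← Real.rpow_natCast]
        exact Real.rpow_le_rpow_of_exponent_le (hbase w) (Nat.le_ceil s)
      have h5 : 1 ≤ (1 + n * rootDist w w₀) ^ ⌈s⌉₊ := one_le_pow₀ (hbase w)
      nlinarith
    rw [mul_pow, sq_abs]
    refine le_of_mul_le_mul_right ?_ hW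
    calc _ ≤ (MvPolynomial.eval w₀ p) ^ 2 * (Wkn κ n w * ((1 + n * rootDist w w₀) ^ ⌈s⌉₊) ^ 2) :=
          h1.trans (by gcongr; exact h2.trans (by gcongr))
      _ = _ := by ring
  have hQC : ∀ w ∈ Splx d, |MvPolynomial.eval w Q| ≤ C₁ := fun w hw => by
    refine le_trans ?_ (hQ w hw)
    exact le_mul_of_one_le_right (abs_nonneg _) (one_le_pow₀ (hbase w))
  have hGM : ∀ w ∈ Splx d, |MvPolynomial.eval w (p * Q)| ≤ C₁ * |MvPolynomial.eval w₀ p| :=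
    fun w hw => by
    rw [map_mul, abs_mul]
    calc _ ≤ |MvPolynomial.eval w₀ p| * (1 + n * rootDist w w₀) ^ ⌈s⌉₊ * |MvPolynomial.eval w Q| := by
          gcongr; exact hpw w hw
      _ = |MvPolynomial.eval w₀ p| * (|MvPolynomial.eval w Q| * (1 + n * rootDist w w₀) ^ ⌈s⌉₊) := by
          ring
      _ ≤ |MvPolynomial.eval w₀ p| * C₁ := by gcongr; exact hQ w hw
      _ = _ := mul_comm _ _
  have hGd : (p * Q).totalDegree ≤ (D + D₁) * n := by
    refine (MvPolynomial.totalDegree_mul _ _).trans ?_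
    rw [add_mul]; exact add_le_add hp hQd
  set r := 1 / (56 * ((D:ℝ) + D₁ + 1) * C₁) / n with hr
  have hlow : ∀ w ∈ {w ∈ Splx d | rootDist w₀ w ≤ r}, (MvPolynomial.eval w₀ p) ^ 2 / (4 * C₁ ^ 2) ≤
      (MvPolynomial.eval w p) ^ 2 := by
    rintro w ⟨hw, hwr⟩
    have h1 := abs_eval_sub_le _ _ hGd hGM hw₀ hw
    have h2 := (dT_le_rootDist hw₀ hw).trans (mul_le_mul_of_nonneg_left hwr zero_le_two)
    have h3 : 14 * (((D + D₁) * n : ℕ) : ℝ) * (C₁ * |MvPolynomial.eval w₀ p|) * dT w₀ w ≤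
        |MvPolynomial.eval w₀ p| / 2 := by
      calc _ ≤ 14 * (((D:ℝ) + D₁ + 1) * n) * (C₁ * |MvPolynomial.eval w₀ p|) * (2 * r) := by
            have hK : (((D + D₁) * n : ℕ) : ℝ) ≤ ((D:ℝ) + D₁ + 1) * n := by
              push_cast; nlinarith
            gcongr
            exact dT_nonneg _ _
        _ = _ := by rw [hr]; field_simp; ring
    have h4 := h1.trans h3
    rw [map_mul, map_mul, hQ1, mul_one] at h4
    have h5 : |MvPolynomial.eval w₀ p| / 2 ≤ C₁ * |MvPolynomial.eval w p| := by
      have h6 := abs_sub_abs_le_abs_sub (MvPolynomial.eval w₀ p)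
        (MvPolynomial.eval w p * MvPolynomial.eval w Q)
      rw [abs_mul] at h6
      have h7 := mul_le_mul_of_nonneg_left (hQC w hw) (abs_nonneg (MvPolynomial.eval w p))
      linarith
    rw [div_le_iff₀ (by positivity), ← sq_abs, ← sq_abs (MvPolynomial.eval w p)]
    have h8 := mul_self_le_mul_self (by positivity) h5
    nlinarith
  have hint : Integrable (fun w => (MvPolynomial.eval w p) ^ 2) (jacobiMeasure κ) :=
    integrable_jacobiMeasure hκ ((continuous_eval p).pow 2)
  have hSm : MeasurableSet {w ∈ Splx d | rootDist w₀ w ≤ r} :=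
    (measurableSet_Splx d).inter (measurableSet_le (continuous_rootDist w₀).measurable
      measurable_const)
  have h1 : (MvPolynomial.eval w₀ p) ^ 2 / (4 * C₁ ^ 2) *
      (jacobiMeasure κ).real {w ∈ Splx d | rootDist w₀ w ≤ r} ≤
      ∫ w, (MvPolynomial.eval w p) ^ 2 ∂jacobiMeasure κ :=
    (setIntegral_ge_of_const_le_real hSm (measure_ne_top _ _) hlow hint.integrableOn).trans
      (setIntegral_le_integral hint (Filter.Eventually.of_forall fun w => sq_nonneg _))
  have h2 : (MvPolynomial.eval w₀ p) ^ 2 / (4 * C₁ ^ 2) * (c * Wkn κ n w₀ / (n:ℝ) ^ d) ≤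
      ∫ w, (MvPolynomial.eval w p) ^ 2 ∂jacobiMeasure κ := by
    refine le_trans ?_ h1
    gcongr
    exact hball n hn w₀ hw₀
  calc _ = 4 * C₁ ^ 2 / c * (n:ℝ) ^ d *
        ((MvPolynomial.eval w₀ p) ^ 2 / (4 * C₁ ^ 2) * (c * Wkn κ n w₀ / (n:ℝ) ^ d)) := by
        field_simp
    _ ≤ _ := by gcongr

end Christoffel

section Decomposition

variable {d : ℕ} {κ : Fin (d+1) → ℝ}

/-- The bilinear form `(p, q) ↦ ∫ ρ p q dμ_κ` on polynomials. -/
def weightedForm (hκ : ∀ i, 0 ≤ κ i) (ρ : (Fin d → ℝ) → ℝ) (hρ : Continuous ρ) :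
    MvPolynomial (Fin d) ℝ →ₗ[ℝ] MvPolynomial (Fin d) ℝ →ₗ[ℝ] ℝ :=
  LinearMap.mk₂ ℝ (fun p q => ∫ w, ρ w * (MvPolynomial.eval w p * MvPolynomial.eval w q)
      ∂jacobiMeasure κ)
    (fun p p' q => by
      rw [← integral_add]
      · congr 1; ext w; simp; ring
      · exact integrable_jacobiMeasure hκ (hρ.mul ((continuous_eval p).mul (continuous_eval q)))
      · exact integrable_jacobiMeasure hκ (hρ.mul ((continuous_eval p').mul (continuous_eval q))))
    (fun c p q => by
      rw [smul_eq_mul, ← integral_const_mul]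
      congr 1; ext w; simp; ring)
    (fun p q q' => by
      rw [← integral_add]
      · congr 1; ext w; simp; ring
      · exact integrable_jacobiMeasure hκ (hρ.mul ((continuous_eval p).mul (continuous_eval q)))
      · exact integrable_jacobiMeasure hκ (hρ.mul ((continuous_eval p).mul (continuous_eval q'))))
    (fun c p q => by
      rw [smul_eq_mul, ← integral_const_mul]
      congr 1; ext w; simp; ring)

lemma weightedForm_apply (hκ : ∀ i, 0 ≤ κ i) (ρ : (Fin d → ℝ) → ℝ) (hρ : Continuous ρ)
    (p q : MvPolynomial (Fin d) ℝ) : weightedForm hκ ρ hρ p q =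
      ∫ w, ρ w * (MvPolynomial.eval w p * MvPolynomial.eval w q) ∂jacobiMeasure κ := rfl

lemma weightedForm_comm (hκ : ∀ i, 0 ≤ κ i) (ρ : (Fin d → ℝ) → ℝ) (hρ : Continuous ρ)
    (p q : MvPolynomial (Fin d) ℝ) : weightedForm hκ ρ hρ p q = weightedForm hκ ρ hρ q p := by
  simp only [weightedForm_apply]
  congr 1; ext w; ring

/-- The inner product of `L²(W_κ)` on polynomials. -/
def innerForm (hκ : ∀ i, 0 ≤ κ i) :
    MvPolynomial (Fin d) ℝ →ₗ[ℝ] MvPolynomial (Fin d) ℝ →ₗ[ℝ] ℝ :=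
  weightedForm hκ (fun _ => 1) continuous_const

lemma innerForm_apply (hκ : ∀ i, 0 ≤ κ i) (p q : MvPolynomial (Fin d) ℝ) :
    innerForm hκ p q = ∫ w, MvPolynomial.eval w p * MvPolynomial.eval w q ∂jacobiMeasure κ := by
  simp [innerForm, weightedForm_apply]

lemma innerForm_comm (hκ : ∀ i, 0 ≤ κ i) (p q : MvPolynomial (Fin d) ℝ) :
    innerForm hκ p q = innerForm hκ q p := weightedForm_comm _ _ _ _ _

lemma ipk_eval (hκ : ∀ i, 0 ≤ κ i) (p q : MvPolynomial (Fin d) ℝ) :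
    ipk κ (fun x => MvPolynomial.eval x p) (fun x => MvPolynomial.eval x q) = innerForm hκ p q := by
  rw [ipk_eq_integral hκ, innerForm_apply]

lemma eq_zero_of_eval_Splx {p : MvPolynomial (Fin d) ℝ}
    (hp : ∀ x ∈ Splx d, MvPolynomial.eval x p = 0) : p = 0 := by
  refine MvPolynomial.funext_set (fun _ : Fin d => Set.Icc (0:ℝ) (1 / ((d:ℝ)+1)))
    (fun _ => (Set.Icc_infinite (by positivity))) fun x hx => ?_
  rw [map_zero]
  refine hp x ⟨fun i => (hx i trivial).1, ?_⟩
  calc ∑ i, x i ≤ ∑ _i : Fin d, 1 / ((d:ℝ)+1) := Finset.sum_le_sum fun i _ => (hx i trivial).2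
    _ ≤ 1 := by
      rw [Finset.sum_const, Finset.card_univ, Fintype.card_fin, nsmul_eq_mul, mul_one_div,
        div_le_one (by positivity)]
      linarith

lemma eq_zero_of_innerForm_self (hκ : ∀ i, 0 ≤ κ i) {p : MvPolynomial (Fin d) ℝ}
    (hp : innerForm hκ p p = 0) : p = 0 := by
  refine eq_zero_of_eval_Splx fun x hx => ?_
  obtain ⟨C, -, hC⟩ := exists_christoffel hκ 1
  have h1 := hC (p.totalDegree + 1) (Nat.succ_pos _) p (by omega) x hx
  rw [innerForm_apply] at hp
  simp only [← pow_two] at hp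
  rw [hp, mul_zero] at h1
  have h2 := Wkn_pos (κ := κ) (Nat.succ_pos p.totalDegree) hx
  have h3 : (MvPolynomial.eval x p) ^ 2 ≤ 0 := by
    by_contra h
    exact absurd h1 (not_le.2 (mul_pos (not_le.1 h) h2))
  nlinarith [sq_nonneg (MvPolynomial.eval x p), pow_eq_zero_iff (two_ne_zero) |>.1
    (le_antisymm h3 (sq_nonneg (MvPolynomial.eval x p)))]

/-- Riesz representation on polynomials of bounded degree. -/
lemma exists_representer (hκ : ∀ i, 0 ≤ κ i) (N : ℕ) (φ : MvPolynomial (Fin d) ℝ →ₗ[ℝ] ℝ) :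
    ∃ q : MvPolynomial (Fin d) ℝ, q.totalDegree ≤ N ∧
      ∀ g : MvPolynomial (Fin d) ℝ, g.totalDegree ≤ N → innerForm hκ q g = φ g := by
  let W := MvPolynomial.restrictTotalDegree (Fin d) ℝ N
  let Φ : W →ₗ[ℝ] Module.Dual ℝ W :=
    { toFun := fun q => (innerForm hκ q.1).comp W.subtype
      map_add' := fun q q' => by ext; simp
      map_smul' := fun c q => by ext; simp }
  have hinj : Function.Injective Φ := by
    rw [injective_iff_map_eq_zero]
    intro q hq
    have : innerForm hκ q.1 q.1 = 0 := by
      have := LinearMap.congr_fun hq q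
      simpa [Φ] using this
    exact Subtype.ext (eq_zero_of_innerForm_self hκ this)
  have hsurj := (LinearMap.injective_iff_surjective_of_finrank_eq_finrank
    (Subspace.dual_finrank_eq (K := ℝ) (V := W)).symm).1 hinj
  obtain ⟨q, hq⟩ := hsurj (φ.comp W.subtype)
  exact ⟨q.1, (MvPolynomial.mem_restrictTotalDegree _ _ _).1 q.2, fun g hg =>
    LinearMap.congr_fun hq ⟨g, (MvPolynomial.mem_restrictTotalDegree _ _ _).2 hg⟩⟩

lemma exists_projection (hκ : ∀ i, 0 ≤ κ i) (N : ℕ) (p : MvPolynomial (Fin d) ℝ) :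
    ∃ q : MvPolynomial (Fin d) ℝ, q.totalDegree ≤ N ∧
      ∀ g : MvPolynomial (Fin d) ℝ, g.totalDegree ≤ N → innerForm hκ (p - q) g = 0 := by
  obtain ⟨q, hq, h⟩ := exists_representer hκ N (innerForm hκ p)
  exact ⟨q, hq, fun g hg => by rw [map_sub, LinearMap.sub_apply, h g hg, sub_self]⟩

lemma InVn.innerForm_eq_zero (hκ : ∀ i, 0 ≤ κ i) {n : ℕ} {f g : MvPolynomial (Fin d) ℝ}
    (hf : InVn d n κ f) (hg : g.totalDegree < n) : innerForm hκ f g = 0 := by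
  rw [← ipk_eval]; exact hf.2 g hg

lemma inVn_iff (hκ : ∀ i, 0 ≤ κ i) {n : ℕ} {f : MvPolynomial (Fin d) ℝ} :
    InVn d n κ f ↔ f.totalDegree ≤ n ∧
      ∀ g : MvPolynomial (Fin d) ℝ, g.totalDegree < n → innerForm hκ f g = 0 := by
  simp only [InVn, ipk_eval hκ]

lemma InVn.innerForm_of_ne (hκ : ∀ i, 0 ≤ κ i) {m n : ℕ} (hmn : m ≠ n)
    {f g : MvPolynomial (Fin d) ℝ} (hf : InVn d m κ f) (hg : InVn d n κ g) :
    innerForm hκ f g = 0 := by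
  rcases lt_or_gt_of_ne hmn with h | h
  · rw [innerForm_comm]; exact hg.innerForm_eq_zero hκ (hf.1.trans_lt h)
  · exact hf.innerForm_eq_zero hκ (hg.1.trans_lt h)

lemma exists_decomposition (hκ : ∀ i, 0 ≤ κ i) (N : ℕ) (p : MvPolynomial (Fin d) ℝ)
    (hp : p.totalDegree ≤ N) : ∃ v : ℕ → MvPolynomial (Fin d) ℝ,
      (∀ j, InVn d j κ (v j)) ∧ p = ∑ j ∈ range (N + 1), v j := by
  have h0 : ∀ j, InVn d j κ 0 := fun j => (inVn_iff hκ).2 ⟨by simp, fun g _ => by simp⟩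
  induction N generalizing p with
  | zero =>
    refine ⟨fun j => if j = 0 then p else 0, fun j => ?_, by simp⟩
    rcases eq_or_ne j 0 with rfl | h
    · simp only [if_true]
      exact (inVn_iff hκ).2 ⟨hp, fun g hg => absurd hg (Nat.not_lt_zero _)⟩
    · simp only [h, if_false]; exact h0 j
  | succ N ih =>
    obtain ⟨q, hq, hpq⟩ := exists_projection hκ N p
    obtain ⟨v, hv, hqv⟩ := ih q hq
    refine ⟨fun j => if j = N + 1 then p - q else v j, fun j => ?_, ?_⟩
    · rcases eq_or_ne j (N + 1) with rfl | h
      · simp only [if_true]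
        refine (inVn_iff hκ).2 ⟨?_, fun g hg => hpq g (Nat.lt_succ_iff.1 hg)⟩
        exact (MvPolynomial.totalDegree_sub _ _).trans (max_le hp (by omega))
      · simp only [h, if_false]; exact hv j
    · rw [Finset.sum_range_succ, if_pos rfl, Finset.sum_congr rfl (g := v), ← hqv]
      · ring
      · intro j hj
        rw [if_neg (by have := Finset.mem_range.1 hj; omega)]

end Decomposition

section Reproducer

variable {d : ℕ} {κ : Fin (d+1) → ℝ}

lemma InVn.innerForm_sum (hκ : ∀ i, 0 ≤ κ i) {v : ℕ → MvPolynomial (Fin d) ℝ}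
    (hv : ∀ j, InVn d j κ (v j)) {M j : ℕ} (hj : j < M) {p : MvPolynomial (Fin d) ℝ}
    (hp : InVn d j κ p) : innerForm hκ (∑ i ∈ range M, v i) p = innerForm hκ (v j) p := by
  rw [map_sum, LinearMap.sum_apply, Finset.sum_eq_single j]
  · intro i _ hij; exact (hv i).innerForm_of_ne hκ hij hp
  · intro h; exact absurd (Finset.mem_range.2 hj) h

/-- A well localized polynomial reproducing point evaluation at `x` on polynomials of degree at
most `2 n`, together with its orthogonal decomposition. -/
lemma exists_reproducer (hκ : ∀ i, 0 ≤ κ i) (k : ℕ) : ∃ C > 0, ∃ D : ℕ, 2 ≤ D ∧ ∀ n : ℕ, 0 < n →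
    ∀ x ∈ Splx d, ∃ v : ℕ → MvPolynomial (Fin d) ℝ, (∀ j, InVn d j κ (v j)) ∧
      (∀ j ≤ 2 * n, ∀ p, InVn d j κ p → innerForm hκ (v j) p = MvPolynomial.eval x p) ∧
      ∫ w, ((1 + n * rootDist w x) ^ k * MvPolynomial.eval w (∑ j ∈ range (D * n + 1), v j)) ^ 2
        ∂jacobiMeasure κ ≤ C * (n:ℝ) ^ d / Wkn κ n x := by
  obtain ⟨C₁, hC₁, D₁, hpeak⟩ := exists_peak d k
  obtain ⟨C₂, hC₂, hchr⟩ := exists_christoffel hκ (2 + D₁)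
  refine ⟨C₁ ^ 2 * C₂, by positivity, 2 + 2 * D₁, by omega, fun n hn x hx => ?_⟩
  have hn' : (0:ℝ) < n := by exact_mod_cast hn
  obtain ⟨Q, hQd, hQ1, hQ⟩ := hpeak n hn x hx
  obtain ⟨K, hKd, hK⟩ := exists_representer hκ ((2 + D₁) * n)
    (MvPolynomial.aeval x : MvPolynomial (Fin d) ℝ →ₐ[ℝ] ℝ).toLinearMap
  replace hK : ∀ g : MvPolynomial (Fin d) ℝ, g.totalDegree ≤ (2 + D₁) * n →
      innerForm hκ K g = MvPolynomial.eval x g := fun g hg => by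
    rw [hK g hg]; simp [MvPolynomial.aeval_eq_eval]
  have hgd : (Q * K).totalDegree ≤ (2 + 2 * D₁) * n := by
    refine (MvPolynomial.totalDegree_mul _ _).trans ((add_le_add hQd hKd).trans (le_of_eq ?_))
    ring
  obtain ⟨v, hv, hgv⟩ := exists_decomposition hκ _ _ hgd
  refine ⟨v, hv, fun j hj p hp => ?_, ?_⟩
  · have hjM : j < (2 + 2 * D₁) * n + 1 := by nlinarith
    rw [← InVn.innerForm_sum hκ hv hjM hp, ← hgv]
    have h1 : innerForm hκ (Q * K) p = innerForm hκ K (Q * p) := by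
      simp only [innerForm_apply, map_mul]
      congr 1; ext w; ring
    rw [h1, hK, map_mul, hQ1, one_mul]
    refine (MvPolynomial.totalDegree_mul _ _).trans ((add_le_add hQd (hp.1.trans hj)).trans
      (le_of_eq ?_))
    ring
  · rw [← hgv]
    have hW := Wkn_pos (κ := κ) hn hx
    have hKx : ∫ w, (MvPolynomial.eval w K) ^ 2 ∂jacobiMeasure κ = MvPolynomial.eval x K := by
      rw [← hK K hKd, innerForm_apply]; simp only [pow_two]
    have hK0 : 0 ≤ MvPolynomial.eval x K := by
      rw [← hKx]; exact integral_nonneg fun w => sq_nonneg _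
    have hKle : MvPolynomial.eval x K ≤ C₂ * (n:ℝ) ^ d / Wkn κ n x := by
      have h1 := hchr n hn K hKd x hx
      rw [hKx] at h1
      rw [le_div_iff₀ hW]
      rcases hK0.eq_or_lt with h0 | hpos
      · rw [← h0]; simp; positivity
      · refine le_of_mul_le_mul_left ?_ hpos
        nlinarith
    have hle : ∀ᵐ w ∂jacobiMeasure κ,
        ((1 + n * rootDist w x) ^ k * MvPolynomial.eval w (Q * K)) ^ 2 ≤
          C₁ ^ 2 * (MvPolynomial.eval w K) ^ 2 := by
      filter_upwards [ae_mem_Splx κ] with w hw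
      have h1 := hQ w hw
      have h2 := rootDist_nonneg w x
      have e : ((1 + n * rootDist w x) ^ k * MvPolynomial.eval w (Q * K)) ^ 2 =
          (|MvPolynomial.eval w Q| * (1 + n * rootDist w x) ^ k) ^ 2 *
            (MvPolynomial.eval w K) ^ 2 := by
        rw [map_mul, mul_pow, mul_pow, mul_pow, sq_abs]; ring
      rw [e]
      gcongr
    have hcr : Continuous fun w => rootDist w x := by
      simp_rw [rootDist_comm _ x]; exact continuous_rootDist x
    calc _ ≤ ∫ w, C₁ ^ 2 * (MvPolynomial.eval w K) ^ 2 ∂jacobiMeasure κ := by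
          refine integral_mono_ae (integrable_jacobiMeasure hκ ?_) (integrable_jacobiMeasure hκ ?_) hle
          · have := continuous_eval (Q * K)
            fun_prop
          · have := continuous_eval K
            fun_prop
      _ = C₁ ^ 2 * MvPolynomial.eval x K := by rw [integral_const_mul, hKx]
      _ ≤ C₁ ^ 2 * (C₂ * (n:ℝ) ^ d / Wkn κ n x) := by gcongr
      _ = _ := by ring

lemma Lk_eq_sum (hκ : ∀ i, 0 ≤ κ i) {P : ℕ → (Fin d → ℝ) → (Fin d → ℝ) → ℝ} (hP : IsRK d κ P)
    {a : ℝ → ℝ} (ha : IsCutoff a) {n : ℕ} (hn : 0 < n) {x y : Fin d → ℝ}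
    {v u : ℕ → MvPolynomial (Fin d) ℝ} (huV : ∀ j, InVn d j κ (u j))
    (hv : ∀ j ≤ 2 * n, ∀ p, InVn d j κ p → innerForm hκ (v j) p = MvPolynomial.eval x p)
    (hu : ∀ j ≤ 2 * n, ∀ p, InVn d j κ p → innerForm hκ (u j) p = MvPolynomial.eval y p)
    {M : ℕ} (hM : 2 * n < M) :
    Lk a P n x y = ∑ j ∈ range M, a (j / n) * innerForm hκ (v j) (u j) := by
  have hn' : (0:ℝ) < n := by exact_mod_cast hn
  have ha0 : ∀ j : ℕ, 2 * n < j → a ((j:ℝ) / n) = 0 := fun j hj => ha.2.1 _ (by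
    rw [lt_div_iff₀ hn']; exact_mod_cast hj)
  rw [Lk, tsum_eq_sum (s := range M)]
  · refine Finset.sum_congr rfl fun j _ => ?_
    rcases le_or_gt j (2 * n) with hj | hj
    · congr 1
      obtain ⟨hsymm, hmem, hrep⟩ := hP j
      obtain ⟨p, hp, hpx⟩ := hmem x
      have h1 : innerForm hκ p (u j) = MvPolynomial.eval x (u j) := by
        rw [← hrep (u j) (huV j) x, innerForm_apply, integral_jacobiMeasure hκ]
        simp_rw [hsymm x, hpx]
      rw [hv j hj _ (huV j), hsymm, hpx, ← hu j hj p hp, innerForm_comm, h1]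
    · rw [ha0 j hj, zero_mul, zero_mul]
  · intro j hj
    rw [ha0 j (by have := Finset.mem_range.not.1 hj; omega), zero_mul]

end Reproducer

section EdgeIBP

variable {d : ℕ} {κ : Fin (d+1) → ℝ}

/-- The direction of the edge of the simplex from vertex `j` to vertex `i`. -/
def edge (i j : Fin (d+1)) : Fin d → ℝ :=
  fun l => (if l.castSucc = i then 1 else 0) - (if l.castSucc = j then 1 else 0)

lemma xe_add_edge (x : Fin d → ℝ) (s : ℝ) (i j k : Fin (d+1)) : xe (x + s • edge i j) k =
    xe x k + s * ((if k = i then 1 else 0) - (if k = j then 1 else 0)) := by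
  induction k using Fin.lastCases with
  | last =>
    have h : ∀ m : Fin (d+1), ∑ l : Fin d, (if l.castSucc = m then (1:ℝ) else 0) =
        1 - if Fin.last d = m then 1 else 0 := fun m => by
      have := Fin.sum_univ_castSucc fun l : Fin (d+1) => if l = m then (1:ℝ) else 0
      rw [Finset.sum_ite_eq' univ m] at this
      simp only [Finset.mem_univ, if_true] at this
      linarith
    simp only [xe_last, Pi.add_apply, Pi.smul_apply, smul_eq_mul, Finset.sum_add_distrib, edge,
      ← Finset.mul_sum, Finset.sum_sub_distrib, h]
    ring
  | cast l => simp [edge]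

lemma hasLineDerivAt_xe (x : Fin d → ℝ) (i j k : Fin (d+1)) : HasLineDerivAt ℝ
    (fun x => xe x k) ((if k = i then 1 else 0) - (if k = j then 1 else 0)) x (edge i j) := by
  simp only [HasLineDerivAt, xe_add_edge]
  simpa using ((hasDerivAt_id (0:ℝ)).mul_const _).const_add (xe x k)

lemma hasDerivAt_max_rpow {p : ℝ} (hp : 1 < p) (t : ℝ) :
    HasDerivAt (fun t : ℝ => (max t 0) ^ p) (p * (max t 0) ^ (p - 1)) t := by
  have hne : ∀ t : ℝ, t ≠ 0 →
      HasDerivAt (fun t : ℝ => (max t 0) ^ p) (p * (max t 0) ^ (p - 1)) t := by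
    intro t ht
    rcases lt_or_gt_of_ne ht with h | h
    · rw [max_eq_right h.le, Real.zero_rpow (by linarith), mul_zero]
      refine (hasDerivAt_const t (0:ℝ)).congr_of_eventuallyEq ?_
      filter_upwards [gt_mem_nhds h] with s hs
      rw [max_eq_right hs.le, Real.zero_rpow (by linarith)]
    · rw [max_eq_left h.le]
      refine (Real.hasDerivAt_rpow_const (Or.inr hp.le)).congr_of_eventuallyEq ?_
      filter_upwards [lt_mem_nhds h] with s hs
      rw [max_eq_left hs.le]
  by_cases ht : t = 0
  · subst ht
    have h1 : ∀ q : ℝ, 0 ≤ q → Continuous fun t : ℝ => (max t 0) ^ q := fun q hq =>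
      (continuous_id.max continuous_const).rpow_const fun _ => Or.inr hq
    exact hasDerivAt_of_hasDerivAt_of_ne (g := fun t => p * (max t 0) ^ (p - 1))
      (fun y hy => hne y hy) (h1 p (by linarith)).continuousAt
      (continuous_const.mul (h1 (p - 1) (by linarith))).continuousAt
  · exact hne t ht

/-- Integration by parts along an edge against a weight whose exponents in the two
directions of the edge exceed one. -/
lemma setIntegral_edge_ibp {i j : Fin (d+1)} (hij : i ≠ j) (hκ : ∀ k, 0 ≤ κ k) {p q : ℝ}
    (hp : 1 < p) (hq : 1 < q) {G G' : (Fin d → ℝ) → ℝ} (hG : Continuous G) (hG' : Continuous G')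
    (hder : ∀ x, HasLineDerivAt ℝ G (G' x) x (edge i j)) :
    ∫ x in Splx d, (∏ k ∈ univ \ {i, j}, xe x k ^ κ k) *
      ((p * xe x i ^ (p - 1) * xe x j ^ q - q * xe x i ^ p * xe x j ^ (q - 1)) * G x +
        xe x i ^ p * xe x j ^ q * G' x) = 0 := by
  set R : (Fin d → ℝ) → ℝ := fun x => ∏ k ∈ univ \ {i, j}, if 0 ≤ xe x k then xe x k ^ κ k else 0
    with hR
  set φ : ℝ → ℝ → ℝ := fun p t => (max t 0) ^ p with hφ
  set F : (Fin d → ℝ) → ℝ := fun x => R x * (φ p (xe x i) * φ q (xe x j) * G x) with hF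
  set F' : (Fin d → ℝ) → ℝ := fun x => R x * ((p * φ (p - 1) (xe x i) * φ q (xe x j) -
    q * φ p (xe x i) * φ (q - 1) (xe x j)) * G x + φ p (xe x i) * φ q (xe x j) * G' x) with hF'
  have hrest : ∀ {A : ℝ → ℝ → ℝ}, (∀ s t, (s < 0 ∨ t < 0) → A s t = 0) → ∀ x, x ∉ Splx d →
      R x * A (xe x i) (xe x j) = 0 := by
    intro A hA x hx
    rw [mem_Splx_iff] at hx
    push Not at hx
    obtain ⟨k, hk⟩ := hx
    by_cases h1 : k = i
    · rw [hA _ _ (Or.inl (h1 ▸ hk)), mul_zero]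
    by_cases h2 : k = j
    · rw [hA _ _ (Or.inr (h2 ▸ hk)), mul_zero]
    have : R x = 0 := Finset.prod_eq_zero (i := k) (by simp [h1, h2]) (if_neg (not_le.2 hk))
    rw [this, zero_mul]
  have hφ0 : ∀ {p : ℝ}, 0 < p → ∀ {t : ℝ}, t < 0 → φ p t = 0 := fun {p} hp {t} ht => by
    simp only [hφ]; rw [max_eq_right ht.le, Real.zero_rpow hp.ne']
  have hRon : ∀ x ∈ Splx d, R x = ∏ k ∈ univ \ {i, j}, xe x k ^ κ k := fun x hx =>
    Finset.prod_congr rfl fun k _ => if_pos (xe_nonneg hx k)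
  have hφc : ∀ p, 0 ≤ p → Continuous (φ p) := fun p hp =>
    (continuous_id.max continuous_const).rpow_const fun _ => Or.inr hp
  have hint : ∀ H : (Fin d → ℝ) → ℝ, Continuous H → (∀ x, x ∉ Splx d → R x * H x = 0) →
      Integrable fun x => R x * H x := by
    intro H hH h0
    have hc : Continuous fun x : Fin d → ℝ => (∏ k ∈ univ \ {i, j}, xe x k ^ κ k) * H x :=
      (continuous_finsetProd _ fun k _ => (continuous_xe k).rpow_const fun x => Or.inr (hκ k)).mul hH
    have := (integrable_indicator_iff (measurableSet_Splx d)).2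
      (hc.continuousOn.integrableOn_compact (μ := volume) (isCompact_Splx d))
    refine this.congr (ae_of_all _ fun x => ?_)
    by_cases hx : x ∈ Splx d
    · simp only [Set.indicator_of_mem hx, hRon x hx]
    · simp only [Set.indicator_of_notMem hx, h0 x hx]
  have hXi := continuous_xe (d := d) i
  have hXj := continuous_xe (d := d) j
  have c1 := (hφc p (by linarith)).comp hXi
  have c2 := (hφc q (by linarith)).comp hXj
  have c3 := (hφc (p - 1) (by linarith)).comp hXi
  have c4 := (hφc (q - 1) (by linarith)).comp hXj
  have hFi : Integrable F := hint _ ((c1.mul c2).mul hG) fun x hx => by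
    have := hrest (A := fun s t => φ p s * φ q t * G x) (fun s t h => by
      rcases h with h | h
      · simp [hφ0 (by linarith : 0 < p) h]
      · simp [hφ0 (by linarith : 0 < q) h]) x hx
    exact this
  have hF'0 : ∀ x, x ∉ Splx d → F' x = 0 := fun x hx =>
    hrest (A := fun s t => (p * φ (p - 1) s * φ q t -
      q * φ p s * φ (q - 1) t) * G x + φ p s * φ q t * G' x) (fun s t h => by
      rcases h with h | h
      · simp [hφ0 (by linarith : 0 < p) h, hφ0 (by linarith : 0 < p - 1) h]
      · simp [hφ0 (by linarith : 0 < q) h, hφ0 (by linarith : 0 < q - 1) h]) x hx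
  have hF'i : Integrable F' := hint _ (((((continuous_const.mul c3).mul c2).sub
    ((continuous_const.mul c1).mul c4)).mul hG).add ((c1.mul c2).mul hG')) hF'0
  have hFder : ∀ x, HasLineDerivAt ℝ F (F' x) x (edge i j) := by
    intro x
    have hRc : ∀ t : ℝ, R (x + t • edge i j) = R x := fun t =>
      Finset.prod_congr rfl fun k hk => by
        simp only [mem_sdiff, Finset.mem_univ, mem_insert, mem_singleton, not_or, true_and] at hk
        rw [xe_add_edge, if_neg hk.1, if_neg hk.2]; simp
    have hi : HasDerivAt (fun t : ℝ => xe (x + t • edge i j) i) 1 0 := by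
      simpa [hij, HasLineDerivAt] using hasLineDerivAt_xe x i j i
    have hj : HasDerivAt (fun t : ℝ => xe (x + t • edge i j) j) (-1) 0 := by
      simpa [hij.symm, HasLineDerivAt] using hasLineDerivAt_xe x i j j
    have h1 := (hasDerivAt_max_rpow hp (xe (x + (0:ℝ) • edge i j) i)).comp 0 hi
    have h2 := (hasDerivAt_max_rpow hq (xe (x + (0:ℝ) • edge i j) j)).comp 0 hj
    have h3 := ((h1.mul h2).mul (hder x)).const_mul (R x)
    refine (h3.congr_deriv ?_).congr_of_eventuallyEq (Filter.Eventually.of_forall fun t => ?_)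
    · simp only [hF', hφ, Pi.mul_apply, Function.comp, zero_smul, add_zero]
      ring
    · simp only [hF, hRc, hφ, Pi.mul_apply, Function.comp]
  have key := integral_bilinear_hasLineDerivAt_right_eq_neg_left_of_integrable
    (μ := (volume : Measure (Fin d → ℝ))) (f := fun _ => (1:ℝ)) (f' := fun _ => (0:ℝ))
    (g := F) (g' := F') (v := edge i j) (B := ContinuousLinearMap.mul ℝ ℝ)
    (by simp) (by simpa using hF'i) (by simpa using hFi)
    (fun x _ => by simpa [HasLineDerivAt] using hasDerivAt_const (0:ℝ) (1:ℝ))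
    (fun x _ => hFder x)
  simp only [ContinuousLinearMap.mul_apply', one_mul, zero_mul, integral_zero, neg_zero] at key
  rw [← key, ← setIntegral_eq_integral_of_forall_compl_eq_zero (s := Splx d) hF'0]
  refine setIntegral_congr_fun (measurableSet_Splx d) fun x hx => ?_
  simp only [hF', hRon x hx, hφ, max_eq_left (xe_nonneg hx i), max_eq_left (xe_nonneg hx j)]

lemma ae_xe_ne_zero (k : Fin (d+1)) : ∀ᵐ x : Fin d → ℝ, xe x k ≠ 0 := by
  have hc : ∀ l : Fin d, ∀ᵐ x : Fin d → ℝ, xe x l.castSucc ≠ 0 := fun l => by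
    simp only [xe_castSucc, ae_iff, not_not]
    exact Measure.pi_hyperplane (fun _ : Fin d => (volume : Measure ℝ)) l 0
  induction k using Fin.lastCases with
  | cast l => exact hc l
  | last =>
    rcases Nat.eq_zero_or_pos d with h | h
    · subst h; exact ae_of_all _ fun x => by rw [xe_last]; simp
    · obtain ⟨T, hT, hTx⟩ := exists_measurePreserving_swap (d := d) (Fin.castSucc ⟨0, h⟩)
      refine (hT.quasiMeasurePreserving.ae (hc ⟨0, h⟩)).mono fun x hx => ?_
      rwa [hTx, Equiv.swap_apply_left] at hx

/-- Integration by parts for the Jacobi weight along an edge of the simplex. -/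
lemma integral_edge_ibp {i j : Fin (d+1)} (hij : i ≠ j) (hκ : ∀ k, 0 ≤ κ k)
    {G G' : (Fin d → ℝ) → ℝ} (hG : Continuous G) (hG' : Continuous G')
    (hder : ∀ x, HasLineDerivAt ℝ G (G' x) x (edge i j)) :
    ∫ x, (((κ i + 1) * xe x j - (κ j + 1) * xe x i) * G x + xe x i * xe x j * G' x)
      ∂jacobiMeasure κ = 0 := by
  obtain ⟨C, hC⟩ := (isCompact_Splx d).exists_bound_of_continuousOn hG.continuousOn
  obtain ⟨C', hC'⟩ := (isCompact_Splx d).exists_bound_of_continuousOn hG'.continuousOn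
  set R : (Fin d → ℝ) → ℝ := fun x => ∏ k ∈ univ \ {i, j}, xe x k ^ κ k with hR
  have hRc : Continuous R :=
    continuous_finsetProd _ fun k _ => (continuous_xe k).rpow_const fun x => Or.inr (hκ k)
  have hWk : ∀ x, Wk κ x = R x * (xe x i ^ κ i * xe x j ^ κ j) := fun x => by
    rw [Wk_eq_prod, hR, ← Finset.prod_pair (f := fun k => xe x k ^ κ k) hij]
    exact (Finset.prod_sdiff (Finset.subset_univ _)).symm
  set f : ℝ → (Fin d → ℝ) → ℝ := fun ε x => R x *
      (((κ i + ε) * xe x i ^ (κ i + ε - 1) * xe x j ^ (κ j + ε) -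
        (κ j + ε) * xe x i ^ (κ i + ε) * xe x j ^ (κ j + ε - 1)) * G x +
        xe x i ^ (κ i + ε) * xe x j ^ (κ j + ε) * G' x) with hf
  have hzero : ∀ ε > 1, ∫ x in Splx d, f ε x = 0 := fun ε hε =>
    setIntegral_edge_ibp hij hκ (by linarith [hκ i]) (by linarith [hκ j]) hG hG' hder
  have hx1 : ∀ {x : Fin d → ℝ}, x ∈ Splx d → ∀ k, ∀ {p : ℝ}, 0 ≤ p →
      0 ≤ xe x k ^ p ∧ xe x k ^ p ≤ 1 := fun hx k p hp =>
    ⟨Real.rpow_nonneg (xe_nonneg hx k) _, Real.rpow_le_one (xe_nonneg hx k) (xe_le_one hx k) hp⟩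
  have hlim : Filter.Tendsto (fun ε => ∫ x in Splx d, f ε x) (nhdsWithin 1 (Set.Ioi 1))
      (nhds (∫ x in Splx d, f 1 x)) := by
    refine tendsto_integral_filter_of_dominated_convergence
      (fun _ => (κ i + κ j + 4) * C + C') ?_ ?_ ?_ ?_
    · filter_upwards [self_mem_nhdsWithin] with ε hε
      have hε : 1 < ε := hε
      have hc : ∀ k, ∀ p : ℝ, 0 ≤ p → Continuous fun x : Fin d → ℝ => xe x k ^ p := fun k p hp =>
        (continuous_xe k).rpow_const fun _ => Or.inr hp
      have := hc i (κ i + ε - 1) (by linarith [hκ i])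
      have := hc j (κ j + ε - 1) (by linarith [hκ j])
      have := hc i (κ i + ε) (by linarith [hκ i])
      have := hc j (κ j + ε) (by linarith [hκ j])
      exact Continuous.aestronglyMeasurable (by fun_prop)
    · filter_upwards [Ioo_mem_nhdsGT (show (1:ℝ) < 2 by norm_num)] with ε hε
      filter_upwards [ae_restrict_mem (measurableSet_Splx d)] with x hx
      obtain ⟨a0, a1⟩ := hx1 hx i (p := κ i + ε - 1) (by linarith [hκ i, hε.1])
      obtain ⟨b0, b1⟩ := hx1 hx j (p := κ j + ε - 1) (by linarith [hκ j, hε.1])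
      obtain ⟨c0, c1⟩ := hx1 hx i (p := κ i + ε) (by linarith [hκ i, hε.1])
      obtain ⟨e0, e1⟩ := hx1 hx j (p := κ j + ε) (by linarith [hκ j, hε.1])
      have hR0 : 0 ≤ R x := Finset.prod_nonneg fun k _ => (hx1 hx k (hκ k)).1
      have hR1 : R x ≤ 1 := Finset.prod_le_one (fun k _ => (hx1 hx k (hκ k)).1)
        fun k _ => (hx1 hx k (hκ k)).2
      have h1 := hC x hx
      have h2 := hC' x hx
      rw [Real.norm_eq_abs] at h1 h2 ⊢
      simp only [hf]
      rw [abs_mul, abs_of_nonneg hR0]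
      refine (mul_le_of_le_one_left (abs_nonneg _) hR1).trans ((abs_add_le _ _).trans ?_)
      rw [abs_mul, abs_mul (_ * _) (G' x)]
      have hi := hκ i
      have hj := hκ j
      have h3 : |(κ i + ε) * xe x i ^ (κ i + ε - 1) * xe x j ^ (κ j + ε) -
          (κ j + ε) * xe x i ^ (κ i + ε) * xe x j ^ (κ j + ε - 1)| ≤ κ i + κ j + 4 := by
        have h4 : xe x i ^ (κ i + ε - 1) * xe x j ^ (κ j + ε) ≤ 1 := mul_le_one₀ a1 e0 e1
        have h5 : xe x i ^ (κ i + ε) * xe x j ^ (κ j + ε - 1) ≤ 1 := mul_le_one₀ c1 b0 b1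
        have h6 := mul_nonneg a0 e0
        have h7 := mul_nonneg c0 b0
        have h8 : (0:ℝ) ≤ κ i + ε := by linarith [hε.1]
        have h9 : (0:ℝ) ≤ κ j + ε := by linarith [hε.1]
        have := hε.2
        rw [abs_le, mul_assoc, mul_assoc]
        constructor <;> nlinarith [mul_nonneg h8 h6, mul_nonneg h9 h7,
          mul_le_mul_of_nonneg_left h4 h8, mul_le_mul_of_nonneg_left h5 h9]
      have h4 : |xe x i ^ (κ i + ε) * xe x j ^ (κ j + ε)| ≤ 1 := by
        rw [abs_of_nonneg (mul_nonneg c0 e0)]; exact mul_le_one₀ c1 e0 e1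
      exact add_le_add (mul_le_mul h3 h1 (abs_nonneg _) (by linarith))
        ((mul_le_of_le_one_left (abs_nonneg _) h4).trans h2)
    · have : IsFiniteMeasure (volume.restrict (Splx d)) :=
        isFiniteMeasure_restrict.2 (isCompact_Splx d).measure_lt_top.ne
      exact integrable_const _
    · filter_upwards [ae_restrict_mem (measurableSet_Splx d), ae_restrict_of_ae (ae_xe_ne_zero i),
        ae_restrict_of_ae (ae_xe_ne_zero j)] with x hx hi hj
      have hc : ∀ k, xe x k ≠ 0 → ∀ p : ℝ, Continuous fun ε : ℝ => xe x k ^ (κ k + ε - p) :=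
        fun k hk p => Continuous.rpow continuous_const (by fun_prop) fun _ => Or.inl hk
      have h1 := hc i hi 1
      have h2 := hc j hj 1
      have h3 := hc i hi 0
      have h4 := hc j hj 0
      simp only [sub_zero] at h3 h4
      have : Continuous fun ε => f ε x := by simp only [hf]; fun_prop
      exact (this.tendsto 1).mono_left nhdsWithin_le_nhds
  have h0 : ∫ x in Splx d, f 1 x = 0 :=
    tendsto_nhds_unique (hlim.congr' (by
      filter_upwards [self_mem_nhdsWithin] with ε hε using hzero ε hε)) tendsto_const_nhds
  rw [integral_jacobiMeasure hκ, mul_eq_zero]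
  right
  rw [← h0]
  refine setIntegral_congr_fun (measurableSet_Splx d) fun x hx => ?_
  have hp : ∀ k, xe x k ^ (κ k + 1) = xe x k * xe x k ^ κ k := fun k => by
    rw [Real.rpow_add_one' (xe_nonneg hx k) (by linarith [hκ k]), mul_comm]
  simp only [hf, hWk, hp, add_sub_cancel_right]
  ring

end EdgeIBP

section SpectralOperator

variable {d : ℕ} {κ : Fin (d+1) → ℝ}

/-- The derivative of polynomials along an edge of the simplex. -/
def edgeDeriv (i j : Fin (d+1)) :
    Derivation ℝ (MvPolynomial (Fin d) ℝ) (MvPolynomial (Fin d) ℝ) :=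
  MvPolynomial.mkDerivation ℝ fun l => MvPolynomial.C (edge i j l)

lemma hasLineDerivAt_eval (i j : Fin (d+1)) (p : MvPolynomial (Fin d) ℝ) (x : Fin d → ℝ) :
    HasLineDerivAt ℝ (fun x => MvPolynomial.eval x p) (MvPolynomial.eval x (edgeDeriv i j p)) x
      (edge i j) := by
  induction p using MvPolynomial.induction_on with
  | C a => simpa [HasLineDerivAt, edgeDeriv] using hasDerivAt_const (0:ℝ) a
  | add p q hp hq =>
    simp only [HasLineDerivAt, map_add] at hp hq ⊢
    exact hp.add hq
  | mul_X p l hp =>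
    have hl : HasDerivAt (fun t : ℝ => (x + t • edge i j) l) (edge i j l) 0 := by
      simpa using ((hasDerivAt_id (0:ℝ)).mul_const (edge i j l)).const_add (x l)
    simp only [HasLineDerivAt, map_mul, MvPolynomial.eval_X, Derivation.leibniz] at hp ⊢
    refine (hp.mul hl).congr_deriv ?_
    simp [edgeDeriv]; ring

lemma edgeDeriv_baryPoly (i j k : Fin (d+1)) : edgeDeriv i j (baryPoly k) =
    MvPolynomial.C ((if k = i then 1 else 0) - (if k = j then 1 else 0)) := by
  refine MvPolynomial.funext fun x => ?_
  refine (hasLineDerivAt_eval i j (baryPoly k) x).unique ?_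
  simpa using hasLineDerivAt_xe x i j k

lemma edgeDeriv_symm (i j : Fin (d+1)) (p : MvPolynomial (Fin d) ℝ) :
    edgeDeriv j i p = -edgeDeriv i j p := by
  have : edgeDeriv (d := d) j i = -edgeDeriv i j := by
    refine MvPolynomial.derivation_ext fun l => ?_
    simp [edgeDeriv, edge]
  rw [this]; rfl

/-- Derivation at a vertex: `∂_k` for `k ≤ d`, zero for `k = d + 1`. -/
def vertexDeriv (k : Fin (d+1)) :
    Derivation ℝ (MvPolynomial (Fin d) ℝ) (MvPolynomial (Fin d) ℝ) :=
  MvPolynomial.mkDerivation ℝ fun l => MvPolynomial.C (if l.castSucc = k then 1 else 0)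

lemma edgeDeriv_eq (i j : Fin (d+1)) (p : MvPolynomial (Fin d) ℝ) :
    edgeDeriv i j p = vertexDeriv i p - vertexDeriv j p := by
  have : edgeDeriv (d := d) i j = vertexDeriv i - vertexDeriv j := by
    refine MvPolynomial.derivation_ext fun l => ?_
    simp [edgeDeriv, vertexDeriv, edge]
  rw [this]; rfl

lemma vertexDeriv_castSucc (k : Fin d) (p : MvPolynomial (Fin d) ℝ) :
    vertexDeriv k.castSucc p = MvPolynomial.pderiv k p := by
  have : vertexDeriv (d := d) k.castSucc = MvPolynomial.pderiv k := by
    refine MvPolynomial.derivation_ext fun l => ?_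
    simp [vertexDeriv, MvPolynomial.pderiv_X, Pi.single_apply, apply_ite MvPolynomial.C]
  rw [this]

lemma vertexDeriv_last (p : MvPolynomial (Fin d) ℝ) : vertexDeriv (Fin.last d) p = 0 := by
  have : vertexDeriv (d := d) (Fin.last d) = 0 := by
    refine MvPolynomial.derivation_ext fun l => ?_
    simp [vertexDeriv]
  rw [this]; rfl

lemma sum_baryPoly : ∑ k, baryPoly (d := d) k = 1 :=
  MvPolynomial.funext fun x => by simp [map_sum, sum_xe]

/-- The second order operator having the spaces `V_m` as eigenspaces, on polynomials. -/
def spectralOp (κ : Fin (d+1) → ℝ) : MvPolynomial (Fin d) ℝ →ₗ[ℝ] MvPolynomial (Fin d) ℝ :=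
  (1/2:ℝ) • ∑ i, ∑ j,
    (LinearMap.mulLeft ℝ (MvPolynomial.C (κ i + 1) * baryPoly j - MvPolynomial.C (κ j + 1) * baryPoly i)
        ∘ₗ (edgeDeriv i j).toLinearMap +
      LinearMap.mulLeft ℝ (baryPoly i * baryPoly j)
        ∘ₗ (edgeDeriv i j).toLinearMap ∘ₗ (edgeDeriv i j).toLinearMap)

lemma spectralOp_apply (p : MvPolynomial (Fin d) ℝ) : spectralOp κ p = MvPolynomial.C (1/2:ℝ) *
    ∑ i, ∑ j, ((MvPolynomial.C (κ i + 1) * baryPoly j - MvPolynomial.C (κ j + 1) * baryPoly i) *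
      edgeDeriv i j p + baryPoly i * baryPoly j * edgeDeriv i j (edgeDeriv i j p)) := by
  simp [spectralOp, LinearMap.sum_apply, MvPolynomial.smul_eq_C_mul, mul_assoc]

/-- The parameter `(|κ| + d) / 2`. -/
def specParam (κ : Fin (d+1) → ℝ) : ℝ := ((∑ i, κ i) + d) / 2

lemma spectralOp_baryPoly (k : Fin (d+1)) : spectralOp κ (baryPoly k) =
    MvPolynomial.C (κ k + 1) - MvPolynomial.C (2 * specParam κ + 1) * baryPoly k := by
  refine MvPolynomial.funext fun x => ?_
  simp only [spectralOp_apply, edgeDeriv_baryPoly, map_mul, map_sum, map_sub, map_add,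
    MvPolynomial.eval_C, MvPolynomial.derivation_C, sub_zero, mul_zero, add_zero, eval_baryPoly]
  have h : ∀ i j : Fin (d+1), ((κ i + 1) * xe x j - (κ j + 1) * xe x i) *
      ((if k = i then (1:ℝ) else 0) - (if k = j then 1 else 0)) =
      (if k = i then ((κ i + 1) * xe x j - (κ j + 1) * xe x i) else 0) -
      (if k = j then ((κ i + 1) * xe x j - (κ j + 1) * xe x i) else 0) := fun i j => by
    split_ifs <;> ring
  simp only [h, Finset.sum_sub_distrib, Finset.sum_ite_eq, Finset.mem_univ, if_true]
  rw [Finset.sum_comm]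
  simp only [Finset.sum_ite_eq, Finset.mem_univ, if_true, Finset.sum_sub_distrib, ← Finset.mul_sum,
    ← Finset.sum_mul, sum_xe, specParam, Finset.sum_add_distrib]
  simp
  ring

lemma spectralOp_X_mul (k : Fin d) (p : MvPolynomial (Fin d) ℝ) {m : ℕ} (hp : p.IsHomogeneous m) :
    spectralOp κ (MvPolynomial.X k * p) = MvPolynomial.X k * spectralOp κ p +
      MvPolynomial.C (κ k.castSucc + 1) * p -
      MvPolynomial.C (2 * specParam κ + 1 + 2 * m) * (MvPolynomial.X k * p) +
      MvPolynomial.C 2 * (MvPolynomial.X k * MvPolynomial.pderiv k p) := by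
  have hX : (MvPolynomial.X k : MvPolynomial (Fin d) ℝ) = baryPoly k.castSucc := by simp [baryPoly]
  have hE : ∑ j, baryPoly j * edgeDeriv k.castSucc j p = MvPolynomial.pderiv k p - m • p := by
    simp only [edgeDeriv_eq, mul_sub, Finset.sum_sub_distrib, ← Finset.sum_mul, sum_baryPoly,
      one_mul, vertexDeriv_castSucc]
    rw [Fin.sum_univ_castSucc, vertexDeriv_last, mul_zero, add_zero, ← hp.sum_X_mul_pderiv]
    simp [vertexDeriv_castSucc, baryPoly]
  have hleib : spectralOp κ (baryPoly k.castSucc * p) = baryPoly k.castSucc * spectralOp κ p +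
      p * spectralOp κ (baryPoly k.castSucc) + ∑ i, ∑ j, baryPoly i * baryPoly j *
        (edgeDeriv i j (baryPoly k.castSucc) * edgeDeriv i j p) := by
    have h2 : (2:MvPolynomial (Fin d) ℝ) * MvPolynomial.C (1/2:ℝ) = 1 := by
      rw [show (2:MvPolynomial (Fin d) ℝ) = MvPolynomial.C 2 from (map_ofNat _ 2).symm, ← map_mul]
      norm_num
    have h3 : ∑ i, ∑ j, baryPoly i * baryPoly j *
        (edgeDeriv i j (baryPoly k.castSucc) * edgeDeriv i j p) = MvPolynomial.C (1/2:ℝ) *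
        (2 * ∑ i, ∑ j, baryPoly i * baryPoly j *
        (edgeDeriv i j (baryPoly k.castSucc) * edgeDeriv i j p)) := by
      rw [← mul_assoc, mul_comm (MvPolynomial.C _), h2, one_mul]
    rw [h3]
    simp only [spectralOp_apply, Derivation.leibniz, smul_eq_mul, map_add]
    rw [mul_left_comm, mul_left_comm p, ← mul_add, ← mul_add]
    congr 1
    simp only [Finset.mul_sum, ← Finset.sum_add_distrib]
    exact Finset.sum_congr rfl fun i _ => Finset.sum_congr rfl fun j _ => by ring
  have hΓ : ∑ i, ∑ j, baryPoly i * baryPoly j *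
        (edgeDeriv i j (baryPoly k.castSucc) * edgeDeriv i j p) =
      2 * (baryPoly k.castSucc * ∑ j, baryPoly j * edgeDeriv k.castSucc j p) := by
    have h : ∀ i j : Fin (d+1), baryPoly i * baryPoly j *
        (edgeDeriv i j (baryPoly k.castSucc) * edgeDeriv i j p) =
        (if k.castSucc = i then baryPoly i * baryPoly j * edgeDeriv i j p else 0) -
        (if k.castSucc = j then baryPoly i * baryPoly j * edgeDeriv i j p else 0) := fun i j => by
      rw [edgeDeriv_baryPoly]
      split_ifs <;> simp
    simp only [h, Finset.sum_sub_distrib]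
    rw [Finset.sum_comm]
    simp only [Finset.sum_ite_eq, Finset.mem_univ, if_true]
    rw [← Finset.sum_sub_distrib, Finset.mul_sum, Finset.mul_sum]
    refine Finset.sum_congr rfl fun j _ => ?_
    rw [edgeDeriv_symm k.castSucc j]
    ring
  rw [hX, hleib, spectralOp_baryPoly, hΓ, hE, nsmul_eq_mul, ← hX]
  simp only [map_add, map_mul, map_ofNat, map_natCast]
  ring

lemma exists_spectralOp_monomial (m : ℕ) : ∀ s : Fin d →₀ ℕ, s.degree = m →
    ∃ r, spectralOp κ (MvPolynomial.monomial s 1) =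
      -MvPolynomial.C (m * (m + 2 * specParam κ)) * MvPolynomial.monomial s 1 + r ∧
      (r = 0 ∨ r.totalDegree < m) := by
  induction m with
  | zero =>
    intro s hs
    rw [Finsupp.degree_eq_zero_iff] at hs
    refine ⟨0, ?_, Or.inl rfl⟩
    rw [hs, spectralOp_apply]
    simp
  | succ m ih =>
    intro s hs
    obtain ⟨k, hk⟩ : ∃ k, s k ≠ 0 := by
      by_contra! h
      rw [show s = 0 from Finsupp.ext h] at hs
      simp at hs
    set s' := s - Finsupp.single k 1 with hs'
    have hss : s' + Finsupp.single k 1 = s :=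
      tsub_add_cancel_of_le (by simpa [Nat.one_le_iff_ne_zero] using hk)
    have hd' : s'.degree = m := by
      rw [← hss, map_add, Finsupp.degree_single] at hs
      omega
    obtain ⟨r, hr, hrd⟩ := ih s' hd'
    have hmon : (MvPolynomial.monomial s (1:ℝ)) = MvPolynomial.X k * MvPolynomial.monomial s' 1 := by
      rw [← hss, MvPolynomial.monomial_add_single, pow_one, mul_comm]
    have hdeg : (MvPolynomial.monomial s' (1:ℝ)).totalDegree = m := by
      rw [MvPolynomial.totalDegree_monomial _ one_ne_zero, ← hd']; rfl
    refine ⟨MvPolynomial.X k * r + MvPolynomial.C (κ k.castSucc + 1) * MvPolynomial.monomial s' 1 +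
      MvPolynomial.C 2 * (s' k • MvPolynomial.monomial s' 1), ?_, Or.inr (Nat.lt_succ_of_le ?_)⟩
    · rw [hmon, spectralOp_X_mul k _ (MvPolynomial.isHomogeneous_monomial _ hd'), hr,
        MvPolynomial.X_mul_pderiv_monomial]
      simp only [map_add, map_mul, map_ofNat, map_natCast, map_one]
      push_cast
      ring
    · have hC : ∀ (c : ℝ) {q : MvPolynomial (Fin d) ℝ}, q.totalDegree ≤ m →
          (MvPolynomial.C c * q).totalDegree ≤ m := fun c q hq => by
        rw [← MvPolynomial.smul_eq_C_mul]
        exact (MvPolynomial.totalDegree_smul_le _ _).trans hq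
      refine (MvPolynomial.totalDegree_add _ _).trans (max_le
        ((MvPolynomial.totalDegree_add _ _).trans (max_le ?_ (hC _ hdeg.le)))
        (hC _ ((MvPolynomial.totalDegree_smul_le _ _).trans hdeg.le)))
      rcases hrd with h | h
      · rw [h, mul_zero]; simp
      · refine (MvPolynomial.totalDegree_mul _ _).trans ?_
        rw [MvPolynomial.totalDegree_X]
        omega

lemma totalDegree_spectralOp_add {m : ℕ} {p : MvPolynomial (Fin d) ℝ} (hp : p.totalDegree ≤ m) :
    spectralOp κ p + MvPolynomial.C (m * (m + 2 * specParam κ)) * p = 0 ∨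
    (spectralOp κ p + MvPolynomial.C (m * (m + 2 * specParam κ)) * p).totalDegree < m := by
  have hmono : ∀ s ∈ p.support,
      spectralOp κ (MvPolynomial.monomial s 1) + MvPolynomial.C (m * (m + 2 * specParam κ)) *
        MvPolynomial.monomial s 1 = 0 ∨ (spectralOp κ (MvPolynomial.monomial s 1) +
        MvPolynomial.C (m * (m + 2 * specParam κ)) * MvPolynomial.monomial s 1).totalDegree < m := by
    intro s hs
    have hsm : s.degree ≤ m := (MvPolynomial.le_totalDegree hs).trans hp
    obtain ⟨r, hr, hrd⟩ := exists_spectralOp_monomial (κ := κ) s.degree s rfl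
    rcases hsm.eq_or_lt with h | h
    · rw [← h, hr, neg_mul, neg_add_eq_sub, sub_add_cancel]
      exact hrd
    · right
      have hC : ∀ c : ℝ, (MvPolynomial.C c * MvPolynomial.monomial s (1:ℝ)).totalDegree < m :=
        fun c => by
          rw [MvPolynomial.C_mul_monomial]
          exact (MvPolynomial.totalDegree_monomial_le _ _).trans_lt h
      rw [hr, ← map_neg]
      refine (MvPolynomial.totalDegree_add _ _).trans_lt (max_lt
        ((MvPolynomial.totalDegree_add _ _).trans_lt (max_lt (hC _) ?_)) (hC _))
      rcases hrd with h' | h'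
      · rw [h', MvPolynomial.totalDegree_zero]; omega
      · exact h'.trans h
  have hsum : spectralOp κ p + MvPolynomial.C (m * (m + 2 * specParam κ)) * p =
      ∑ s ∈ p.support, p.coeff s • (spectralOp κ (MvPolynomial.monomial s 1) +
        MvPolynomial.C (m * (m + 2 * specParam κ)) * MvPolynomial.monomial s 1) := by
    have hps : p = ∑ s ∈ p.support, p.coeff s • MvPolynomial.monomial s 1 := by
      conv_lhs => rw [p.as_sum]
      exact Finset.sum_congr rfl fun s _ => by rw [MvPolynomial.smul_monomial, smul_eq_mul, mul_one]
    conv_lhs => rw [hps]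
    simp only [map_sum, map_smul, Finset.mul_sum, ← Finset.sum_add_distrib, smul_add, mul_smul_comm]
  rw [hsum]
  rcases Nat.eq_zero_or_pos m with h | h
  · left
    refine Finset.sum_eq_zero fun s hs => ?_
    rcases hmono s hs with h' | h'
    · rw [h', smul_zero]
    · omega
  · right
    refine lt_of_le_of_lt (MvPolynomial.totalDegree_finsetSum_le (d := m - 1) fun s hs =>
      (MvPolynomial.totalDegree_smul_le _ _).trans ?_) (Nat.sub_lt h one_pos)
    rcases hmono s hs with h' | h'
    · rw [h', MvPolynomial.totalDegree_zero]; omega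
    · omega

end SpectralOperator

section Green

variable {d : ℕ} {κ : Fin (d+1) → ℝ}

/-- The polarized carré du champ associated with the spectral operator. -/
def gradProd (p q : MvPolynomial (Fin d) ℝ) : MvPolynomial (Fin d) ℝ :=
  MvPolynomial.C (1/2:ℝ) * ∑ i, ∑ j, baryPoly i * baryPoly j * (edgeDeriv i j p * edgeDeriv i j q)

lemma eval_gradProd (p q : MvPolynomial (Fin d) ℝ) (x : Fin d → ℝ) :
    MvPolynomial.eval x (gradProd p q) = 1 / 2 * ∑ i, ∑ j, xe x i * xe x j *
      (MvPolynomial.eval x (edgeDeriv i j p) * MvPolynomial.eval x (edgeDeriv i j q)) := by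
  simp [gradProd, map_sum]

/-- Green's formula for the spectral operator. -/
lemma integral_spectralOp_mul (hκ : ∀ i, 0 ≤ κ i) (p : MvPolynomial (Fin d) ℝ)
    {v : (Fin d → ℝ) → ℝ} {v' : Fin (d+1) → Fin (d+1) → (Fin d → ℝ) → ℝ} (hv : Continuous v)
    (hv' : ∀ i j, Continuous (v' i j))
    (hder : ∀ i j x, HasLineDerivAt ℝ v (v' i j x) x (edge i j)) :
    ∫ x, MvPolynomial.eval x (spectralOp κ p) * v x ∂jacobiMeasure κ =
      -∫ x, 1 / 2 * ∑ i, ∑ j, xe x i * xe x j *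
        (MvPolynomial.eval x (edgeDeriv i j p) * v' i j x) ∂jacobiMeasure κ := by
  have hx := fun k => continuous_xe (d := d) k
  have hp := fun p => continuous_eval (d := d) p
  set F : Fin (d+1) → Fin (d+1) → (Fin d → ℝ) → ℝ := fun i j x =>
    ((κ i + 1) * xe x j - (κ j + 1) * xe x i) * (MvPolynomial.eval x (edgeDeriv i j p) * v x) +
    xe x i * xe x j * (MvPolynomial.eval x (edgeDeriv i j (edgeDeriv i j p)) * v x +
      MvPolynomial.eval x (edgeDeriv i j p) * v' i j x) with hF
  have hFc : ∀ i j, Continuous (F i j) := fun i j => by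
    have := hx i
    have := hx j
    have := hp (edgeDeriv i j p)
    have := hp (edgeDeriv i j (edgeDeriv i j p))
    have := hv' i j
    simp only [hF]; fun_prop
  have h0 : ∀ i j, ∫ x, F i j x ∂jacobiMeasure κ = 0 := fun i j => by
    by_cases hij : i = j
    · subst hij
      have hz : ∀ q : MvPolynomial (Fin d) ℝ, edgeDeriv i i q = 0 := fun q => by
        rw [edgeDeriv_eq, sub_self]
      have hv0 : ∀ x, v' i i x = 0 := fun x => by
        have h1 := hder i i x
        have he : edge (d := d) i i = 0 := by ext l; simp [edge]
        rw [he] at h1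
        exact h1.unique (hasLineDerivAt_zero)
      simp [hF, hz, hv0]
    · refine integral_edge_ibp hij hκ ((hp _).mul hv)
        (((hp _).mul hv).add ((hp _).mul (hv' i j))) fun x => ?_
      have := HasDerivAt.mul (hasLineDerivAt_eval i j (edgeDeriv i j p) x) (hder i j x)
      refine this.congr_deriv ?_
      simp
  have h1 : ∫ x, 1 / 2 * ∑ i, ∑ j, F i j x ∂jacobiMeasure κ = 0 := by
    rw [integral_const_mul, integral_finsetSum _ fun i _ => integrable_jacobiMeasure hκ
      (continuous_finsetSum _ fun j _ => hFc i j)]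
    rw [Finset.sum_eq_zero, mul_zero]
    intro i _
    rw [integral_finsetSum _ fun j _ => integrable_jacobiMeasure hκ (hFc i j)]
    exact Finset.sum_eq_zero fun j _ => h0 i j
  have c1 : Continuous fun x => 1 / 2 * ∑ i, ∑ j, xe x i * xe x j *
        (MvPolynomial.eval x (edgeDeriv i j p) * v' i j x) :=
    continuous_const.mul (continuous_finsetSum _ fun i _ => continuous_finsetSum _ fun j _ =>
      ((hx i).mul (hx j)).mul ((hp _).mul (hv' i j)))
  have c0 : Continuous fun x => MvPolynomial.eval x (spectralOp κ p) * v x := (hp _).mul hv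
  rw [eq_neg_iff_add_eq_zero, ← integral_add (integrable_jacobiMeasure hκ c0)
    (integrable_jacobiMeasure hκ c1), ← h1]
  congr 1
  ext x
  rw [spectralOp_apply]
  simp only [map_mul, map_sum, map_add, map_sub, MvPolynomial.eval_C, eval_baryPoly]
  rw [mul_assoc, ← mul_add]
  congr 1
  simp only [Finset.sum_mul, ← Finset.sum_add_distrib]
  refine Finset.sum_congr rfl fun i _ => Finset.sum_congr rfl fun j _ => ?_
  simp only [hF]
  ring

lemma innerForm_spectralOp (hκ : ∀ i, 0 ≤ κ i) (p q : MvPolynomial (Fin d) ℝ) :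
    innerForm hκ (spectralOp κ p) q = -∫ x, MvPolynomial.eval x (gradProd p q) ∂jacobiMeasure κ := by
  rw [innerForm_apply, integral_spectralOp_mul hκ p (continuous_eval q)
    (fun i j => continuous_eval (edgeDeriv i j q)) fun i j x => hasLineDerivAt_eval i j q x]
  simp only [eval_gradProd]

lemma innerForm_spectralOp_comm (hκ : ∀ i, 0 ≤ κ i) (p q : MvPolynomial (Fin d) ℝ) :
    innerForm hκ (spectralOp κ p) q = innerForm hκ p (spectralOp κ q) := by
  rw [innerForm_comm hκ p, innerForm_spectralOp, innerForm_spectralOp]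
  simp only [gradProd, mul_comm (edgeDeriv _ _ p)]

lemma InVn.spectralOp_eq (hκ : ∀ i, 0 ≤ κ i) {m : ℕ} {p : MvPolynomial (Fin d) ℝ}
    (hp : InVn d m κ p) : spectralOp κ p = -((m * (m + 2 * specParam κ) : ℝ) • p) := by
  rw [MvPolynomial.smul_eq_C_mul, eq_neg_iff_add_eq_zero]
  rcases totalDegree_spectralOp_add (κ := κ) hp.1 with h | h
  · exact h
  set r := spectralOp κ p + MvPolynomial.C (m * (m + 2 * specParam κ)) * p with hr
  have hd : (spectralOp κ r).totalDegree < m := by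
    set c : ℝ := r.totalDegree * (r.totalDegree + 2 * specParam κ)
    have h1 : spectralOp κ r = (spectralOp κ r + MvPolynomial.C c * r) + (-c) • r := by
      rw [neg_smul, MvPolynomial.smul_eq_C_mul]; ring
    rw [h1]
    refine (MvPolynomial.totalDegree_add _ _).trans_lt (max_lt ?_
      ((MvPolynomial.totalDegree_smul_le _ _).trans_lt h))
    rcases totalDegree_spectralOp_add (κ := κ) (le_refl r.totalDegree) with h' | h'
    · rw [h', MvPolynomial.totalDegree_zero]; omega
    · exact h'.trans h
  have h2 : ∀ q, innerForm hκ r q = innerForm hκ (spectralOp κ p) q +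
      m * (m + 2 * specParam κ) * innerForm hκ p q := fun q => by
    rw [hr, ← MvPolynomial.smul_eq_C_mul, map_add, map_smul, LinearMap.add_apply,
      LinearMap.smul_apply, smul_eq_mul]
  apply eq_zero_of_innerForm_self hκ
  rw [h2, innerForm_spectralOp_comm, hp.innerForm_eq_zero hκ hd, hp.innerForm_eq_zero hκ h]
  simp

end Green

section WaveEnergy

lemma hasDerivAt_bilin_sum {V : Type*} [AddCommGroup V] [Module ℝ V] (B : V →ₗ[ℝ] V →ₗ[ℝ] ℝ)
    (hB : ∀ p q, B p q = B q p) (v : ℕ → V) (M : ℕ) {a : ℕ → ℝ → ℝ} {a' : ℕ → ℝ} {t : ℝ}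
    (ha : ∀ j, HasDerivAt (a j) (a' j) t) :
    HasDerivAt (fun s => B (∑ j ∈ range M, a j s • v j) (∑ j ∈ range M, a j s • v j))
      (2 * B (∑ j ∈ range M, a j t • v j) (∑ j ∈ range M, a' j • v j)) t := by
  have h1 : ∀ b c : ℕ → ℝ, B (∑ j ∈ range M, b j • v j) (∑ j ∈ range M, c j • v j) =
      ∑ i ∈ range M, ∑ j ∈ range M, b i * c j * B (v i) (v j) := fun b c => by
    simp only [map_sum, LinearMap.sum_apply, map_smul, LinearMap.smul_apply, smul_eq_mul,
      mul_assoc]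
    rw [Finset.sum_comm]
    refine Finset.sum_congr rfl fun i _ => ?_
    rw [Finset.mul_sum]
    exact Finset.sum_congr rfl fun j _ => by ring
  simp only [h1]
  have h2 : HasDerivAt (fun s => ∑ i ∈ range M, ∑ j ∈ range M, a i s * a j s * B (v i) (v j))
      (∑ i ∈ range M, ∑ j ∈ range M, (a' i * a j t + a i t * a' j) * B (v i) (v j)) t :=
    HasDerivAt.fun_sum fun i _ => HasDerivAt.fun_sum fun j _ => ((ha i).mul (ha j)).mul_const _
  refine h2.congr_deriv ?_
  simp only [add_mul, Finset.sum_add_distrib]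
  rw [two_mul, Finset.sum_comm]
  congr 1
  exact Finset.sum_congr rfl fun i _ => Finset.sum_congr rfl fun j _ => by rw [hB]; ring

variable {d : ℕ} {κ : Fin (d+1) → ℝ}

/-- The weighted Dirichlet form on polynomials. -/
def gradForm (hκ : ∀ i, 0 ≤ κ i) (ρ : (Fin d → ℝ) → ℝ) (hρ : Continuous ρ) :
    MvPolynomial (Fin d) ℝ →ₗ[ℝ] MvPolynomial (Fin d) ℝ →ₗ[ℝ] ℝ :=
  (1/2:ℝ) • ∑ i, ∑ j, (weightedForm hκ (fun w => ρ w * (xe w i * xe w j))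
    (hρ.mul ((continuous_xe i).mul (continuous_xe j)))).compl₁₂
      (edgeDeriv i j).toLinearMap (edgeDeriv i j).toLinearMap

lemma gradForm_apply (hκ : ∀ i, 0 ≤ κ i) (ρ : (Fin d → ℝ) → ℝ) (hρ : Continuous ρ)
    (p q : MvPolynomial (Fin d) ℝ) : gradForm hκ ρ hρ p q =
      ∫ w, ρ w * MvPolynomial.eval w (gradProd p q) ∂jacobiMeasure κ := by
  have hc : ∀ i j, Continuous fun w : Fin d → ℝ => ρ w * (xe w i * xe w j) *
      (MvPolynomial.eval w (edgeDeriv i j p) * MvPolynomial.eval w (edgeDeriv i j q)) := fun i j =>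
    (hρ.mul ((continuous_xe i).mul (continuous_xe j))).mul
      ((continuous_eval _).mul (continuous_eval _))
  simp only [gradForm, LinearMap.smul_apply, LinearMap.sum_apply, LinearMap.compl₁₂_apply,
    weightedForm_apply, smul_eq_mul, Derivation.coeFn_coe]
  have h1 : ∀ i, ∑ j, ∫ w, ρ w * (xe w i * xe w j) * (MvPolynomial.eval w (edgeDeriv i j p) *
      MvPolynomial.eval w (edgeDeriv i j q)) ∂jacobiMeasure κ = ∫ w, ∑ j, ρ w * (xe w i * xe w j) *
      (MvPolynomial.eval w (edgeDeriv i j p) * MvPolynomial.eval w (edgeDeriv i j q))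
      ∂jacobiMeasure κ := fun i =>
    (integral_finsetSum _ fun j _ => integrable_jacobiMeasure hκ (hc i j)).symm
  simp only [h1]
  rw [← integral_finsetSum _ fun i _ => integrable_jacobiMeasure hκ
    (continuous_finsetSum _ fun j _ => hc i j), ← integral_const_mul]
  congr 1
  ext w
  rw [eval_gradProd, mul_left_comm (ρ w)]
  simp only [Finset.mul_sum, mul_assoc]

lemma gradForm_comm (hκ : ∀ i, 0 ≤ κ i) (ρ : (Fin d → ℝ) → ℝ) (hρ : Continuous ρ)
    (p q : MvPolynomial (Fin d) ℝ) : gradForm hκ ρ hρ p q = gradForm hκ ρ hρ q p := by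
  rw [gradForm_apply, gradForm_apply]
  simp only [gradProd, mul_comm (edgeDeriv _ _ p)]

lemma specParam_pos (hd : 0 < d) (hκ : ∀ i, 0 ≤ κ i) : 0 < specParam κ := by
  have h1 : (0:ℝ) < d := by exact_mod_cast hd
  have h2 := Finset.sum_nonneg fun i (_ : i ∈ univ) => hκ i
  unfold specParam; positivity

/-- The solution `∑ cos (t (j + λ)) v_j` of the wave equation. -/
def waveCos (κ : Fin (d+1) → ℝ) (v : ℕ → MvPolynomial (Fin d) ℝ) (M : ℕ) (t : ℝ) :
    MvPolynomial (Fin d) ℝ :=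
  ∑ j ∈ range M, Real.cos ((j + specParam κ) * t) • v j

/-- The time integral of `waveCos`. -/
def waveSin (κ : Fin (d+1) → ℝ) (v : ℕ → MvPolynomial (Fin d) ℝ) (M : ℕ) (t : ℝ) :
    MvPolynomial (Fin d) ℝ :=
  ∑ j ∈ range M, (Real.sin ((j + specParam κ) * t) / (j + specParam κ)) • v j

/-- The energy density of the wave equation. -/
def waveDensity (κ : Fin (d+1) → ℝ) (v : ℕ → MvPolynomial (Fin d) ℝ) (M : ℕ) (t : ℝ) :
    MvPolynomial (Fin d) ℝ :=
  waveCos κ v M t * waveCos κ v M t + gradProd (waveSin κ v M t) (waveSin κ v M t) +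
    MvPolynomial.C (specParam κ ^ 2) * (waveSin κ v M t * waveSin κ v M t)

lemma eval_gradProd_self_nonneg {x : Fin d → ℝ} (hx : x ∈ Splx d) (p : MvPolynomial (Fin d) ℝ) :
    0 ≤ MvPolynomial.eval x (gradProd p p) := by
  rw [eval_gradProd]
  refine mul_nonneg (by norm_num) (Finset.sum_nonneg fun i _ => Finset.sum_nonneg fun j _ => ?_)
  exact mul_nonneg (mul_nonneg (xe_nonneg hx i) (xe_nonneg hx j)) (mul_self_nonneg _)

lemma le_eval_waveDensity (x : Fin d → ℝ) (v : ℕ → MvPolynomial (Fin d) ℝ)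
    (M : ℕ) (t : ℝ) : (MvPolynomial.eval x (waveCos κ v M t)) ^ 2 +
      MvPolynomial.eval x (gradProd (waveSin κ v M t) (waveSin κ v M t)) ≤
      MvPolynomial.eval x (waveDensity κ v M t) := by
  simp only [waveDensity, map_add, map_mul, MvPolynomial.eval_C]
  nlinarith [mul_nonneg (sq_nonneg (specParam κ))
    (mul_self_nonneg (MvPolynomial.eval x (waveSin κ v M t)))]

/-- The derivative of the weighted energy of a wave. -/
lemma hasDerivAt_waveEnergy (hd : 0 < d) (hκ : ∀ i, 0 ≤ κ i) {v : ℕ → MvPolynomial (Fin d) ℝ}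
    (hv : ∀ j, InVn d j κ (v j)) (M : ℕ) {h : (Fin d → ℝ) → ℝ}
    {h' : Fin (d+1) → Fin (d+1) → (Fin d → ℝ) → ℝ} (hh : Continuous h)
    (hh' : ∀ i j, Continuous (h' i j))
    (hder : ∀ i j x, HasLineDerivAt ℝ h (h' i j x) x (edge i j)) (t : ℝ) :
    HasDerivAt (fun t => ∫ x, h x * MvPolynomial.eval x (waveDensity κ v M t) ∂jacobiMeasure κ)
      (-∫ x, MvPolynomial.eval x (waveCos κ v M t) * ∑ i, ∑ j, xe x i * xe x j *
        (MvPolynomial.eval x (edgeDeriv i j (waveSin κ v M t)) * h' i j x) ∂jacobiMeasure κ) t := by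
  set l := specParam κ with hl
  have hl0 : 0 < l := specParam_pos hd hκ
  have hω : ∀ j : ℕ, (0:ℝ) < j + l := fun j => by positivity
  have hE : (fun t => ∫ x, h x * MvPolynomial.eval x (waveDensity κ v M t) ∂jacobiMeasure κ) =
      fun t => weightedForm hκ h hh (waveCos κ v M t) (waveCos κ v M t) +
        gradForm hκ h hh (waveSin κ v M t) (waveSin κ v M t) +
        l ^ 2 * weightedForm hκ h hh (waveSin κ v M t) (waveSin κ v M t) := by
    ext t
    rw [gradForm_apply, weightedForm_apply, weightedForm_apply, ← integral_const_mul,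
      ← integral_add, ← integral_add]
    · congr 1; ext x; simp [waveDensity, hl]; ring
    · exact integrable_jacobiMeasure hκ ((hh.mul ((continuous_eval _).mul (continuous_eval _))).add
        (hh.mul (continuous_eval _)))
    · exact integrable_jacobiMeasure hκ (continuous_const.mul
        (hh.mul ((continuous_eval _).mul (continuous_eval _))))
    · exact integrable_jacobiMeasure hκ (hh.mul ((continuous_eval _).mul (continuous_eval _)))
    · exact integrable_jacobiMeasure hκ (hh.mul (continuous_eval _))
  set z : MvPolynomial (Fin d) ℝ := ∑ j ∈ range M, (-((j + l) * Real.sin ((j + l) * t))) • v j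
    with hz
  have hlin : ∀ j : ℕ, HasDerivAt (fun t : ℝ => (j + l) * t) (j + l) t := fun j => by
    simpa using (hasDerivAt_id t).const_mul ((j:ℝ) + l)
  have hcos : ∀ j : ℕ, HasDerivAt (fun t => Real.cos ((j + l) * t))
      (-((j + l) * Real.sin ((j + l) * t))) t := fun j =>
    ((Real.hasDerivAt_cos _).comp t (hlin j)).congr_deriv (by ring)
  have hsin : ∀ j : ℕ, HasDerivAt (fun t => Real.sin ((j + l) * t) / (j + l))
      (Real.cos ((j + l) * t)) t := fun j =>
    (((Real.hasDerivAt_sin _).comp t (hlin j)).div_const _).congr_deriv (by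
      rw [mul_div_cancel_right₀ _ (hω j).ne'])
  have hzu : z = spectralOp κ (waveSin κ v M t) - l ^ 2 • waveSin κ v M t := by
    simp only [hz, waveSin, map_sum, map_smul, Finset.smul_sum, ← Finset.sum_sub_distrib]
    refine Finset.sum_congr rfl fun j _ => ?_
    rw [(hv j).spectralOp_eq hκ, ← hl, smul_neg, smul_smul, smul_smul, ← neg_smul, ← sub_smul]
    congr 1
    have := (hω j).ne'
    field_simp
    ring
  have hD := ((hasDerivAt_bilin_sum (weightedForm hκ h hh) (weightedForm_comm hκ h hh) v M hcos).add
    (hasDerivAt_bilin_sum (gradForm hκ h hh) (gradForm_comm hκ h hh) v M hsin)).add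
    ((hasDerivAt_bilin_sum (weightedForm hκ h hh) (weightedForm_comm hκ h hh) v M hsin).const_mul
      (l ^ 2))
  rw [hE]
  refine HasDerivAt.congr_deriv hD ?_
  change 2 * weightedForm hκ h hh (waveCos κ v M t) z +
    2 * gradForm hκ h hh (waveSin κ v M t) (waveCos κ v M t) +
    l ^ 2 * (2 * weightedForm hκ h hh (waveSin κ v M t) (waveCos κ v M t)) = _
  set u := waveSin κ v M t with hu
  set w := waveCos κ v M t with hw
  have hgreen : weightedForm hκ h hh w (spectralOp κ u) = -gradForm hκ h hh u w -
      1 / 2 * ∫ x, MvPolynomial.eval x w * ∑ i, ∑ j, xe x i * xe x j *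
        (MvPolynomial.eval x (edgeDeriv i j u) * h' i j x) ∂jacobiMeasure κ := by
    have h1 := integral_spectralOp_mul hκ u (v := fun x => h x * MvPolynomial.eval x w)
      (v' := fun i j x => h' i j x * MvPolynomial.eval x w +
        h x * MvPolynomial.eval x (edgeDeriv i j w))
      (hh.mul (continuous_eval w))
      (fun i j => ((hh' i j).mul (continuous_eval w)).add (hh.mul (continuous_eval _)))
      (fun i j x => by
        refine (HasDerivAt.mul (hder i j x) (hasLineDerivAt_eval i j w x)).congr_deriv ?_
        simp)
    have h2 : weightedForm hκ h hh w (spectralOp κ u) =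
        ∫ x, MvPolynomial.eval x (spectralOp κ u) * (h x * MvPolynomial.eval x w)
          ∂jacobiMeasure κ := by
      rw [weightedForm_apply]; congr 1; ext x; ring
    have hS : Continuous fun x => MvPolynomial.eval x w * ∑ i, ∑ j, xe x i * xe x j *
        (MvPolynomial.eval x (edgeDeriv i j u) * h' i j x) :=
      (continuous_eval w).mul (continuous_finsetSum _ fun i _ => continuous_finsetSum _ fun j _ =>
        ((continuous_xe i).mul (continuous_xe j)).mul ((continuous_eval _).mul (hh' i j)))
    rw [h2, h1, gradForm_apply, ← integral_const_mul, ← neg_add', ← integral_add]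
    · congr 2
      ext x
      rw [eval_gradProd, mul_left_comm (h x), ← mul_add]
      congr 1
      simp only [Finset.mul_sum, ← Finset.sum_add_distrib]
      exact Finset.sum_congr rfl fun i _ => Finset.sum_congr rfl fun j _ => by ring
    · exact integrable_jacobiMeasure hκ (hh.mul (continuous_eval _))
    · exact integrable_jacobiMeasure hκ (continuous_const.mul hS)
  rw [hzu, map_sub, map_smul, hgreen, weightedForm_comm hκ h hh u w, smul_eq_mul]
  ring

end WaveEnergy

section MomentGrowth

lemma energy_pointwise {c A w Γ D r η : ℝ} (hc : 0 ≤ c) (hη : 0 < η) (hΓ : 0 ≤ Γ)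
    (hA : A ^ 2 ≤ c ^ 2 * Γ) (hD : w ^ 2 + Γ ≤ D) (m : ℕ) :
    -(w * (2 * (m + 1) * r ^ (2 * m + 1) * A)) ≤
      (m + 1) * c / 2 * (η * (r ^ (2 * m) * D) + r ^ (2 * (m + 1)) * D / η) := by
  have hD0 : 0 ≤ D := (add_nonneg (sq_nonneg w) hΓ).trans hD
  have h1 : |w * A| ≤ c / 2 * D := by
    refine abs_le_of_sq_le_sq ?_ (by positivity)
    nlinarith [mul_nonneg (sq_nonneg c) (sq_nonneg (w ^ 2 - Γ)), mul_le_mul_of_nonneg_left hA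
      (sq_nonneg w), mul_nonneg (sq_nonneg c) (sub_nonneg.2 (pow_le_pow_left₀
      (add_nonneg (sq_nonneg w) hΓ) hD 2))]
  have h2 : 2 * |r| ≤ η + r ^ 2 / η := by
    rw [← sub_nonneg]
    have : η + r ^ 2 / η - 2 * |r| = (η - |r|) ^ 2 / η := by
      rw [← sq_abs r]; field_simp; ring
    rw [this]; positivity
  have h3 : 0 ≤ r ^ (2 * m) := by rw [pow_mul]; positivity
  calc -(w * (2 * (m + 1) * r ^ (2 * m + 1) * A))
      ≤ |w * (2 * (m + 1) * r ^ (2 * m + 1) * A)| := neg_le_abs _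
    _ = (m + 1) * r ^ (2 * m) * ((2 * |r|) * |w * A|) := by
        rw [show w * (2 * (m + 1) * r ^ (2 * m + 1) * A) =
          ((m + 1) * r ^ (2 * m)) * (2 * r * (w * A)) by ring, abs_mul, abs_mul (2 * r), abs_mul 2 r,
          abs_of_nonneg (mul_nonneg (by positivity) h3), abs_two]
    _ ≤ (m + 1) * r ^ (2 * m) * ((η + r ^ 2 / η) * (c / 2 * D)) := by
        refine mul_le_mul_of_nonneg_left ?_ (mul_nonneg (by positivity) h3)
        exact mul_le_mul h2 h1 (abs_nonneg _) (by positivity)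
    _ = _ := by ring

variable {d : ℕ} {κ : Fin (d+1) → ℝ}

lemma sq_edge_form_le {x : Fin d → ℝ} (hx : x ∈ Splx d) (f g : Fin (d+1) → Fin (d+1) → ℝ) :
    (∑ i, ∑ j, xe x i * xe x j * (f i j * g i j)) ^ 2 ≤
      (∑ i, ∑ j, xe x i * xe x j * (f i j * f i j)) *
        ∑ i, ∑ j, xe x i * xe x j * (g i j) ^ 2 := by
  have h (F : Fin (d+1) → Fin (d+1) → ℝ) : ∑ i, ∑ j, F i j = ∑ p : Fin (d+1) × Fin (d+1), F p.1 p.2 :=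
    (Fintype.sum_prod_type' F).symm
  simp only [h]
  refine Finset.sum_sq_le_sum_mul_sum_of_sq_le_mul _ (fun p _ => ?_) (fun p _ => ?_)
    (fun p _ => le_of_eq (by ring))
  · exact mul_nonneg (mul_nonneg (xe_nonneg hx _) (xe_nonneg hx _)) (mul_self_nonneg _)
  · exact mul_nonneg (mul_nonneg (xe_nonneg hx _) (xe_nonneg hx _)) (sq_nonneg _)

lemma waveDensity_zero (v : ℕ → MvPolynomial (Fin d) ℝ) (M : ℕ) (x : Fin d → ℝ) :
    MvPolynomial.eval x (waveDensity κ v M 0) =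
      (MvPolynomial.eval x (∑ j ∈ range M, v j)) ^ 2 := by
  have h1 : waveSin κ v M 0 = 0 := by simp [waveSin]
  have h2 : waveCos κ v M 0 = ∑ j ∈ range M, v j := by simp [waveCos]
  simp only [waveDensity, h1, h2, map_add, map_mul, eval_gradProd, map_zero]
  ring_nf
  simp

/-- Weighted energies of a wave grow at most polynomially when the weight is a power of a
Lipschitz function. -/
lemma waveEnergy_le (hd : 0 < d) (hκ : ∀ i, 0 ≤ κ i) {v : ℕ → MvPolynomial (Fin d) ℝ}
    (hv : ∀ j, InVn d j κ (v j)) (M : ℕ) {ρ : (Fin d → ℝ) → ℝ}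
    {ρ' : Fin (d+1) → Fin (d+1) → (Fin d → ℝ) → ℝ} (hρ : Continuous ρ)
    (hρ' : ∀ i j, Continuous (ρ' i j))
    (hder : ∀ i j x, HasLineDerivAt ℝ ρ (ρ' i j x) x (edge i j)) {c : ℝ} (hc : 0 < c)
    (hΓ : ∀ x ∈ Splx d, ∑ i, ∑ j, xe x i * xe x j * (ρ' i j x) ^ 2 ≤ c ^ 2 / 2)
    {S : ℝ} (hS : 0 < S) (k : ℕ)
    (hm : ∀ m ≤ k, ∫ w, ρ w ^ (2 * m) * (MvPolynomial.eval w (∑ j ∈ range M, v j)) ^ 2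
      ∂jacobiMeasure κ ≤ S) {t : ℝ} (ht : 0 ≤ t) :
    ∫ w, ρ w ^ (2 * k) * MvPolynomial.eval w (waveDensity κ v M t) ∂jacobiMeasure κ ≤
      S * (1 + c * t) ^ (2 * k) := by
  have h0 : ∀ m ≤ k, ∫ w, ρ w ^ (2 * m) * MvPolynomial.eval w (waveDensity κ v M 0)
      ∂jacobiMeasure κ ≤ S := fun m hmk => by
    simp only [waveDensity_zero]; exact hm m hmk
  clear hm
  induction k generalizing t with
  | zero =>
    have h1 := hasDerivAt_waveEnergy hd hκ hv M (h := fun _ => 1) (h' := fun _ _ _ => 0)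
      continuous_const (fun _ _ => continuous_const) (fun _ _ _ => hasDerivAt_const _ _)
    simp only [mul_zero, Finset.sum_const_zero, integral_zero, neg_zero] at h1
    have h2 := is_const_of_deriv_eq_zero (fun s => (h1 s).differentiableAt)
      (fun s => (h1 s).deriv) t 0
    have h3 := h0 0 le_rfl
    simp only [mul_zero, pow_zero, mul_one] at h3 ⊢
    exact h2.trans_le h3
  | succ m ih =>
    have hE : ∀ s, HasDerivAt
        (fun t => ∫ w, ρ w ^ (2 * (m + 1)) * MvPolynomial.eval w (waveDensity κ v M t)
          ∂jacobiMeasure κ) _ s :=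
      hasDerivAt_waveEnergy hd hκ hv M (h' := fun i j w => 2 * (m + 1) * ρ w ^ (2 * m + 1) * ρ' i j w)
        (hρ.pow _) (fun i j => (continuous_const.mul (hρ.pow _)).mul (hρ' i j))
        (fun i j x => by
          refine (HasDerivAt.fun_pow (hder i j x) (2 * (m + 1))).congr_deriv ?_
          simp only [zero_smul, add_zero]
          rw [show 2 * (m + 1) - 1 = 2 * m + 1 by omega]
          push_cast; ring)
    have hB : ∀ s, HasDerivAt (fun t => S * (1 + c * t) ^ (2 * (m + 1)))
        (2 * ((m + 1) * c * (S * (1 + c * s) ^ (2 * m + 1)))) s := fun s => by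
      have h1 : HasDerivAt (fun t : ℝ => 1 + c * t) c s := by
        simpa using ((hasDerivAt_id s).const_mul c).const_add 1
      refine ((h1.fun_pow (2 * (m + 1))).const_mul S).congr_deriv ?_
      rw [show 2 * (m + 1) - 1 = 2 * m + 1 by omega]
      push_cast; ring
    refine image_le_of_deriv_right_lt_deriv_boundary' (a := 0) (b := t)
      (fun s _ => (hE s).continuousAt.continuousWithinAt) (fun s _ => (hE s).hasDerivWithinAt)
      (by simpa using h0 (m + 1) le_rfl)
      (fun s _ => (hB s).continuousAt.continuousWithinAt) (fun s _ => (hB s).hasDerivWithinAt)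
      (fun s hs hEs => ?_) ⟨ht, le_rfl⟩
    have hη : 0 < 1 + c * s := by nlinarith [hs.1, mul_nonneg hc.le hs.1]
    have hprev := ih (t := s) hs.1 (fun q hq => h0 q (hq.trans m.le_succ))
    have hbound : -∫ x, MvPolynomial.eval x (waveCos κ v M s) * ∑ i, ∑ j, xe x i * xe x j *
        (MvPolynomial.eval x (edgeDeriv i j (waveSin κ v M s)) *
          (2 * (m + 1) * ρ x ^ (2 * m + 1) * ρ' i j x)) ∂jacobiMeasure κ ≤
        ∫ x, (m + 1) * c / 2 * ((1 + c * s) * (ρ x ^ (2 * m) *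
          MvPolynomial.eval x (waveDensity κ v M s)) + ρ x ^ (2 * (m + 1)) *
          MvPolynomial.eval x (waveDensity κ v M s) / (1 + c * s)) ∂jacobiMeasure κ := by
      rw [← integral_neg]
      refine integral_mono_ae (integrable_jacobiMeasure hκ ?_) (integrable_jacobiMeasure hκ ?_) ?_
      · exact ((continuous_eval _).mul (continuous_finsetSum _ fun i _ => continuous_finsetSum _
          fun j _ => ((continuous_xe i).mul (continuous_xe j)).mul ((continuous_eval _).mul
          ((continuous_const.mul (hρ.pow _)).mul (hρ' i j))))).neg
      · exact continuous_const.mul ((continuous_const.mul ((hρ.pow _).mul (continuous_eval _))).add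
          (((hρ.pow _).mul (continuous_eval _)).div_const _))
      · filter_upwards [ae_mem_Splx κ] with x hx
        have hA := sq_edge_form_le hx
          (fun i j => MvPolynomial.eval x (edgeDeriv i j (waveSin κ v M s))) (fun i j => ρ' i j x)
        have hG := eval_gradProd (waveSin κ v M s) (waveSin κ v M s) x
        have hG0 := eval_gradProd_self_nonneg hx (waveSin κ v M s)
        refine le_trans (le_of_eq ?_) (energy_pointwise (A := ∑ i, ∑ j, xe x i * xe x j *
          (MvPolynomial.eval x (edgeDeriv i j (waveSin κ v M s)) * ρ' i j x)) hc.le hη hG0 ?_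
          (le_eval_waveDensity x v M s) m)
        · simp only [Finset.mul_sum]
          congr 1
          exact Finset.sum_congr rfl fun i _ => Finset.sum_congr rfl fun j _ => by ring
        · refine hA.trans ?_
          calc _ ≤ _ * (c ^ 2 / 2) := mul_le_mul_of_nonneg_left (hΓ x hx) (by linarith)
            _ = _ := by rw [hG]; ring
    refine hbound.trans_lt ?_
    rw [integral_const_mul, integral_add, integral_const_mul, integral_div, hEs]
    · calc _ ≤ (m + 1) * c / 2 * ((1 + c * s) * (S * (1 + c * s) ^ (2 * m)) +
            S * (1 + c * s) ^ (2 * (m + 1)) / (1 + c * s)) := by gcongr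
        _ = (m + 1) * c * (S * (1 + c * s) ^ (2 * m + 1)) := by field_simp; ring
        _ < _ := by
          have : 0 < (m + 1) * c * (S * (1 + c * s) ^ (2 * m + 1)) := by positivity
          linarith
    · exact integrable_jacobiMeasure hκ (continuous_const.mul ((hρ.pow _).mul (continuous_eval _)))
    · exact integrable_jacobiMeasure hκ (((hρ.pow _).mul (continuous_eval _)).div_const _)

lemma waveCos_neg (v : ℕ → MvPolynomial (Fin d) ℝ) (M : ℕ) (t : ℝ) :
    waveCos κ v M (-t) = waveCos κ v M t := by
  simp [waveCos, mul_neg, Real.cos_neg]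

lemma wave_moment_le (hd : 0 < d) (hκ : ∀ i, 0 ≤ κ i) {v : ℕ → MvPolynomial (Fin d) ℝ}
    (hv : ∀ j, InVn d j κ (v j)) (M : ℕ) {ρ : (Fin d → ℝ) → ℝ}
    {ρ' : Fin (d+1) → Fin (d+1) → (Fin d → ℝ) → ℝ} (hρ : Continuous ρ)
    (hρ' : ∀ i j, Continuous (ρ' i j))
    (hder : ∀ i j x, HasLineDerivAt ℝ ρ (ρ' i j x) x (edge i j)) {c : ℝ} (hc : 0 < c)
    (hΓ : ∀ x ∈ Splx d, ∑ i, ∑ j, xe x i * xe x j * (ρ' i j x) ^ 2 ≤ c ^ 2 / 2)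
    {S : ℝ} (hS : 0 < S) (k : ℕ)
    (hm : ∀ m ≤ k, ∫ w, ρ w ^ (2 * m) * (MvPolynomial.eval w (∑ j ∈ range M, v j)) ^ 2
      ∂jacobiMeasure κ ≤ S) (t : ℝ) :
    ∫ w, ρ w ^ (2 * k) * (MvPolynomial.eval w (waveCos κ v M t)) ^ 2 ∂jacobiMeasure κ ≤
      S * (1 + c * |t|) ^ (2 * k) := by
  have hev : waveCos κ v M t = waveCos κ v M |t| := by
    rcases abs_choice t with h | h <;> rw [h]
    rw [waveCos_neg]
  refine le_trans ?_ (waveEnergy_le hd hκ hv M hρ hρ' hder hc hΓ hS k hm (abs_nonneg t))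
  rw [hev]
  refine integral_mono_ae (integrable_jacobiMeasure hκ ?_) (integrable_jacobiMeasure hκ ?_) ?_
  · exact (hρ.pow _).mul ((continuous_eval _).pow _)
  · exact (hρ.pow _).mul (continuous_eval _)
  · filter_upwards [ae_mem_Splx κ] with x hx
    refine mul_le_mul_of_nonneg_left ?_ (by rw [pow_mul]; positivity)
    linarith [le_eval_waveDensity (κ := κ) x v M |t|,
      eval_gradProd_self_nonneg hx (waveSin κ v M |t|)]

end MomentGrowth

section WaveDecay

/-- A smooth substitute for the square root. -/
def smoothRoot (ε t : ℝ) : ℝ := √√(t ^ 2 + ε)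

/-- The derivative of `smoothRoot`. -/
def smoothRootDeriv (ε t : ℝ) : ℝ := t / (2 * √(t ^ 2 + ε) * smoothRoot ε t)

lemma smoothRoot_pos {ε : ℝ} (hε : 0 < ε) (t : ℝ) : 0 < smoothRoot ε t := by
  unfold smoothRoot; positivity

lemma continuous_smoothRoot (ε : ℝ) : Continuous (smoothRoot ε) := by
  unfold smoothRoot; fun_prop

lemma continuous_smoothRootDeriv {ε : ℝ} (hε : 0 < ε) : Continuous (smoothRootDeriv ε) := by
  refine continuous_id.div ((by fun_prop : Continuous fun t : ℝ => 2 * √(t ^ 2 + ε)).mul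
    (continuous_smoothRoot ε)) fun t => ?_
  have := smoothRoot_pos hε t
  positivity

lemma hasDerivAt_smoothRoot {ε : ℝ} (hε : 0 < ε) (t : ℝ) :
    HasDerivAt (smoothRoot ε) (smoothRootDeriv ε t) t := by
  have h1 : HasDerivAt (fun t : ℝ => t ^ 2 + ε) (2 * t) t := by
    simpa using (hasDerivAt_pow 2 t).add_const ε
  have h2 : 0 < t ^ 2 + ε := by positivity
  have h3 : 0 < √(t ^ 2 + ε) := by positivity
  refine ((h1.sqrt h2.ne').sqrt h3.ne').congr_deriv ?_
  unfold smoothRootDeriv smoothRoot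
  field_simp

lemma mul_smoothRootDeriv_sq_le {ε t : ℝ} (hε : 0 < ε) (ht : 0 ≤ t) :
    t * smoothRootDeriv ε t ^ 2 ≤ 1 / 4 := by
  have h2 : 0 < t ^ 2 + ε := by positivity
  have h3 : 0 < √(t ^ 2 + ε) := by positivity
  have h4 : t ≤ √(t ^ 2 + ε) := Real.le_sqrt_of_sq_le (by linarith)
  have h5 : smoothRoot ε t ^ 2 = √(t ^ 2 + ε) := Real.sq_sqrt h3.le
  rw [smoothRootDeriv, div_pow, mul_pow, h5, mul_div_assoc', div_le_iff₀ (by positivity)]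
  calc t * t ^ 2 = t ^ 3 := by ring
    _ ≤ √(t ^ 2 + ε) ^ 3 := by gcongr
    _ = _ := by ring

lemma sqrt_le_smoothRoot {ε t : ℝ} (hε : 0 ≤ ε) : √t ≤ smoothRoot ε t :=
  Real.sqrt_le_sqrt (Real.le_sqrt_of_sq_le (by linarith))

lemma smoothRoot_le {ε t : ℝ} (ht : 0 ≤ t) : smoothRoot (ε ^ 4) t ≤ √t + |ε| := by
  have h1 := Real.sq_sqrt ht
  have h2 := Real.sqrt_nonneg t
  refine Real.sqrt_le_iff.2 ⟨by positivity, Real.sqrt_le_iff.2 ⟨by positivity, ?_⟩⟩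
  have h3 : t + ε ^ 2 ≤ (√t + |ε|) ^ 2 := by
    nlinarith [sq_abs ε, mul_nonneg h2 (abs_nonneg ε)]
  calc t ^ 2 + ε ^ 4 ≤ (t + ε ^ 2) ^ 2 := by nlinarith [mul_nonneg ht (sq_nonneg ε)]
    _ ≤ _ := by gcongr

lemma abs_smoothRoot_sub_sub_le {ε s t : ℝ} (hs : 0 ≤ s) (ht : 0 ≤ t) :
    |(smoothRoot (ε ^ 4) s - smoothRoot (ε ^ 4) t) - (√s - √t)| ≤ |ε| := by
  have h1 := smoothRoot_le (ε := ε) hs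
  have h2 := smoothRoot_le (ε := ε) ht
  have h3 := sqrt_le_smoothRoot (ε := ε ^ 4) (t := s) (by positivity)
  have h4 := sqrt_le_smoothRoot (ε := ε ^ 4) (t := t) (by positivity)
  rw [abs_le]; constructor <;> linarith

variable {d : ℕ} {κ : Fin (d+1) → ℝ}

/-- The smoothed and rescaled `l`-th coordinate. -/
def rootCoord (n : ℕ) (l : Fin (d+1)) (w : Fin d → ℝ) : ℝ :=
  n * smoothRoot ((1 / n) ^ 4) (xe w l)

lemma continuous_rootCoord (n : ℕ) (l : Fin (d+1)) :
    Continuous (rootCoord n l : (Fin d → ℝ) → ℝ) :=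
  continuous_const.mul ((continuous_smoothRoot _).comp (continuous_xe l))

lemma abs_rootCoord_sub_sub_le {n : ℕ} (hn : 0 < n) (l : Fin (d+1)) {x y : Fin d → ℝ}
    (hx : x ∈ Splx d) (hy : y ∈ Splx d) :
    |(rootCoord n l x - rootCoord n l y) - n * (√(xe x l) - √(xe y l))| ≤ 1 := by
  have hn' : (0:ℝ) < n := by exact_mod_cast hn
  have h1 := abs_smoothRoot_sub_sub_le (ε := 1 / (n:ℝ)) (xe_nonneg hx l) (xe_nonneg hy l)
  rw [rootCoord, rootCoord, ← mul_sub, ← mul_sub, abs_mul, abs_of_pos hn']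
  calc _ ≤ (n:ℝ) * |1 / (n:ℝ)| := by gcongr
    _ = 1 := by rw [abs_of_pos (by positivity)]; field_simp

lemma sum_edge_sq (l : Fin (d+1)) (x : Fin d → ℝ) : ∑ i, ∑ j, xe x i * xe x j *
    (((if l = i then 1 else 0) - (if l = j then 1 else 0) : ℝ)) ^ 2 =
      2 * (xe x l * (1 - xe x l)) := by
  have h : ∀ i j : Fin (d+1), xe x i * xe x j *
      (((if l = i then 1 else 0) - (if l = j then 1 else 0) : ℝ)) ^ 2 =
      (if l = i then xe x i else 0) * xe x j + xe x i * (if l = j then xe x j else 0) -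
      2 * ((if l = i then xe x i else 0) * (if l = j then xe x j else 0)) := fun i j => by
    split_ifs <;> ring
  simp only [h, Finset.sum_sub_distrib, Finset.sum_add_distrib, ← Finset.mul_sum,
    ← Finset.sum_mul, sum_xe]
  simp
  ring

/-- Moments of the wave started at a well localized reproducer. -/
lemma reproducer_wave_moment (hd : 0 < d) (hκ : ∀ i, 0 ≤ κ i) {v : ℕ → MvPolynomial (Fin d) ℝ}
    (hv : ∀ j, InVn d j κ (v j)) (M : ℕ) {n k : ℕ} (hn : 0 < n) {x : Fin d → ℝ} (hx : x ∈ Splx d)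
    {S : ℝ} (hS : 0 < S) (hm : ∫ w, ((1 + n * rootDist w x) ^ k *
      MvPolynomial.eval w (∑ j ∈ range M, v j)) ^ 2 ∂jacobiMeasure κ ≤ S)
    {m : ℕ} (hmk : m ≤ k) (l : Fin (d+1)) (t : ℝ) :
    ∫ w, ((rootCoord n l w - rootCoord n l x) ^ m * MvPolynomial.eval w (waveCos κ v M t)) ^ 2
      ∂jacobiMeasure κ ≤ S * (1 + n * |t|) ^ (2 * m) := by
  have hn' : (0:ℝ) < n := by exact_mod_cast hn
  have hε : (0:ℝ) < (1 / n) ^ 4 := by positivity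
  have hρ : Continuous fun w : Fin d → ℝ => rootCoord n l w - rootCoord n l x :=
    (continuous_rootCoord n l).sub continuous_const
  have h1 := wave_moment_le hd hκ hv M (ρ := fun w => rootCoord n l w - rootCoord n l x)
    (ρ' := fun i j w => n * (smoothRootDeriv ((1 / n) ^ 4) (xe w l) *
      ((if l = i then 1 else 0) - (if l = j then 1 else 0)))) hρ
    (fun i j => continuous_const.mul (((continuous_smoothRootDeriv hε).comp
      (continuous_xe l)).mul continuous_const))
    (fun i j w => by
      have h2 : HasDerivAt (fun s : ℝ => xe (w + s • edge i j) l) _ 0 := hasLineDerivAt_xe w i j l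
      have h3 := (hasDerivAt_smoothRoot hε (xe (w + (0:ℝ) • edge i j) l)).comp 0 h2
      refine HasDerivAt.congr_deriv ((h3.const_mul (n:ℝ)).sub_const _) ?_
      simp)
    hn' (fun w hw => by
      have h2 : ∀ i j, xe w i * xe w j * (n * (smoothRootDeriv ((1 / n) ^ 4) (xe w l) *
          ((if l = i then 1 else 0) - (if l = j then 1 else 0)))) ^ 2 =
          (n * smoothRootDeriv ((1 / n) ^ 4) (xe w l)) ^ 2 * (xe w i * xe w j *
          (((if l = i then 1 else 0) - (if l = j then 1 else 0) : ℝ)) ^ 2) := fun i j => by ring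
      simp only [h2, ← Finset.mul_sum, sum_edge_sq]
      have h3 := mul_smoothRootDeriv_sq_le hε (xe_nonneg hw l)
      set D := smoothRootDeriv ((1 / (n:ℝ)) ^ 4) (xe w l)
      have h4 := xe_nonneg hw l
      calc ((n:ℝ) * D) ^ 2 * (2 * (xe w l * (1 - xe w l)))
          = 2 * (n:ℝ) ^ 2 * (xe w l * D ^ 2) * (1 - xe w l) := by ring
        _ ≤ 2 * (n:ℝ) ^ 2 * (1 / 4) * 1 := by
            have h5 : 0 ≤ 1 - xe w l := sub_nonneg.2 (xe_le_one hw l)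
            gcongr
            linarith
        _ = _ := by ring)
    hS m (fun q hq => by
      refine le_trans (integral_mono_ae (integrable_jacobiMeasure hκ ?_)
        (integrable_jacobiMeasure hκ ?_) ?_) hm
      · exact (hρ.pow _).mul ((continuous_eval _).pow _)
      · simp only [rootDist_comm _ x]
        exact (((continuous_const.add (continuous_const.mul (continuous_rootDist x))).pow _).mul
          (continuous_eval _)).pow _
      · filter_upwards [ae_mem_Splx κ] with w hw
        have h2 := abs_rootCoord_sub_sub_le hn l hw hx
        have h3 := abs_sub_le_rootDist w x l
        have h4 : |rootCoord n l w - rootCoord n l x| ≤ 1 + n * rootDist w x := by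
          have h5 : |(n:ℝ) * (√(xe w l) - √(xe x l))| ≤ n * rootDist w x := by
            rw [abs_mul, abs_of_pos hn']; gcongr
          rw [abs_le] at h2 h5 ⊢
          constructor <;> linarith
        have h6 : 1 ≤ 1 + n * rootDist w x := by nlinarith [rootDist_nonneg w x]
        rw [mul_pow]
        refine mul_le_mul_of_nonneg_right ?_ (sq_nonneg _)
        calc (rootCoord n l w - rootCoord n l x) ^ (2 * q)
            = |rootCoord n l w - rootCoord n l x| ^ (2 * q) := by
              rw [pow_mul, pow_mul, sq_abs]
          _ ≤ (1 + n * rootDist w x) ^ (2 * q) := by gcongr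
          _ ≤ (1 + n * rootDist w x) ^ (k * 2) := pow_le_pow_right₀ h6 (by omega)
          _ = _ := by rw [pow_mul]) t
  refine le_trans (le_of_eq ?_) h1
  congr 1
  ext w
  rw [mul_pow, ← pow_mul, mul_comm m 2]

lemma integral_abs_mul_le (hκ : ∀ i, 0 ≤ κ i) {f g : (Fin d → ℝ) → ℝ} (hf : Continuous f)
    (hg : Continuous g) {A B : ℝ} (hA : 0 < A) (hB : 0 < B)
    (hfA : ∫ w, f w ^ 2 ∂jacobiMeasure κ ≤ A) (hgB : ∫ w, g w ^ 2 ∂jacobiMeasure κ ≤ B) :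
    ∫ w, |f w| * |g w| ∂jacobiMeasure κ ≤ √A * √B := by
  set r := √B / √A with hr
  have hA' : 0 < √A := by positivity
  have hB' : 0 < √B := by positivity
  have hr0 : 0 < r := by positivity
  have h1 : ∫ w, |f w| * |g w| ∂jacobiMeasure κ ≤
      ∫ w, (r / 2 * f w ^ 2 + 1 / (2 * r) * g w ^ 2) ∂jacobiMeasure κ := by
    refine integral_mono (integrable_jacobiMeasure hκ (hf.abs.mul hg.abs))
      (integrable_jacobiMeasure hκ ((continuous_const.mul (hf.pow 2)).add
        (continuous_const.mul (hg.pow 2)))) fun w => ?_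
    change |f w| * |g w| ≤ _
    rw [← sub_nonneg]
    have : r / 2 * f w ^ 2 + 1 / (2 * r) * g w ^ 2 - |f w| * |g w| =
        (r * |f w| - |g w|) ^ 2 / (2 * r) := by
      rw [← sq_abs (f w), ← sq_abs (g w)]; field_simp; ring
    rw [this]; positivity
  refine h1.trans ?_
  have h2 : ∀ (c : ℝ) {f : (Fin d → ℝ) → ℝ}, Continuous f →
      Integrable (fun w => c * f w ^ 2) (jacobiMeasure κ) := fun c f hf =>
    integrable_jacobiMeasure hκ (continuous_const.mul (hf.pow 2))
  rw [integral_add (h2 _ hf) (h2 _ hg), integral_const_mul, integral_const_mul]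
  calc _ ≤ r / 2 * A + 1 / (2 * r) * B := by gcongr
    _ = √A * √B := by
      have hA2 := Real.mul_self_sqrt hA.le
      have hB2 := Real.mul_self_sqrt hB.le
      rw [hr]
      nth_rewrite 2 [← hA2]
      nth_rewrite 3 [← hB2]
      field_simp
      ring

/-- The correlation of two waves started at well localized reproducers decays with the distance
of their centres. -/
lemma reproducer_wave_correlation (hd : 0 < d) (hκ : ∀ i, 0 ≤ κ i)
    {v u : ℕ → MvPolynomial (Fin d) ℝ} (hv : ∀ j, InVn d j κ (v j)) (hu : ∀ j, InVn d j κ (u j))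
    (M : ℕ) {n k : ℕ} (hn : 0 < n) {x y : Fin d → ℝ} (hx : x ∈ Splx d) (hy : y ∈ Splx d)
    {S T : ℝ} (hS : 0 < S) (hT : 0 < T)
    (hmv : ∫ w, ((1 + n * rootDist w x) ^ k * MvPolynomial.eval w (∑ j ∈ range M, v j)) ^ 2
      ∂jacobiMeasure κ ≤ S)
    (hmu : ∫ w, ((1 + n * rootDist w y) ^ k * MvPolynomial.eval w (∑ j ∈ range M, u j)) ^ 2
      ∂jacobiMeasure κ ≤ T) {m : ℕ} (hmk : m ≤ k) (l : Fin (d+1)) (t : ℝ) :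
    |rootCoord n l x - rootCoord n l y| ^ m *
      |innerForm hκ (∑ j ∈ range M, v j) (waveCos κ u M t)| ≤
      2 ^ m * (2 * (√S * √T * (1 + n * |t|) ^ m)) := by
  have hn' : (0:ℝ) < n := by exact_mod_cast hn
  have hv0 : waveCos κ v M 0 = ∑ j ∈ range M, v j := by simp [waveCos]
  set g := ∑ j ∈ range M, v j with hg
  set U := waveCos κ u M t with hU
  have hone : 1 ≤ 1 + n * |t| := by nlinarith [abs_nonneg t]
  have hpow : 1 ≤ (1 + n * |t|) ^ m := one_le_pow₀ hone
  have hρx : Continuous fun w : Fin d → ℝ => rootCoord n l w - rootCoord n l x :=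
    (continuous_rootCoord n l).sub continuous_const
  have hρy : Continuous fun w : Fin d → ℝ => rootCoord n l w - rootCoord n l y :=
    (continuous_rootCoord n l).sub continuous_const
  have hv1 := reproducer_wave_moment hd hκ hv M hn hx hS hmv hmk l 0
  have hv2 := reproducer_wave_moment hd hκ hv M hn hx hS hmv k.zero_le l 0
  have hu1 := reproducer_wave_moment hd hκ hu M hn hy hT hmu hmk l t
  have hu2 := reproducer_wave_moment hd hκ hu M hn hy hT hmu k.zero_le l t
  simp only [hv0, abs_zero, mul_zero, add_zero, one_pow, mul_one, pow_zero, one_mul, ← hU]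
    at hv1 hv2 hu1 hu2
  have hI1 := integral_abs_mul_le hκ ((hρx.pow m).mul (continuous_eval g)) (continuous_eval U)
    hS hT hv1 hu2
  have hI2 := integral_abs_mul_le hκ (continuous_eval g) ((hρy.pow m).mul (continuous_eval U))
    hS (by positivity) hv2 hu1
  have hsq : √(T * (1 + n * |t|) ^ (2 * m)) = √T * (1 + n * |t|) ^ m := by
    rw [Real.sqrt_mul hT.le, mul_comm 2 m, pow_mul, Real.sqrt_sq (by positivity)]
  rw [hsq] at hI2
  rw [innerForm_apply]
  calc |rootCoord n l x - rootCoord n l y| ^ m *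
        |∫ w, MvPolynomial.eval w g * MvPolynomial.eval w U ∂jacobiMeasure κ|
      ≤ |rootCoord n l x - rootCoord n l y| ^ m *
        ∫ w, |MvPolynomial.eval w g * MvPolynomial.eval w U| ∂jacobiMeasure κ := by
        gcongr; exact abs_integral_le_integral_abs
    _ = ∫ w, |rootCoord n l x - rootCoord n l y| ^ m *
        |MvPolynomial.eval w g * MvPolynomial.eval w U| ∂jacobiMeasure κ :=
        (integral_const_mul _ _).symm
    _ ≤ ∫ w, 2 ^ m * (|(rootCoord n l w - rootCoord n l x) ^ m * MvPolynomial.eval w g| *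
        |MvPolynomial.eval w U| + |MvPolynomial.eval w g| *
        |(rootCoord n l w - rootCoord n l y) ^ m * MvPolynomial.eval w U|) ∂jacobiMeasure κ := by
        refine integral_mono (integrable_jacobiMeasure hκ ?_) (integrable_jacobiMeasure hκ ?_)
          fun w => ?_
        · exact continuous_const.mul ((continuous_eval g).mul (continuous_eval U)).abs
        · exact continuous_const.mul ((((hρx.pow m).mul (continuous_eval g)).abs.mul
            (continuous_eval U).abs).add ((continuous_eval g).abs.mul
            ((hρy.pow m).mul (continuous_eval U)).abs))
        · simp only [abs_mul, abs_pow]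
          set p := |rootCoord n l w - rootCoord n l x|
          set q := |rootCoord n l w - rootCoord n l y|
          have h1 : |rootCoord n l x - rootCoord n l y| ≤ p + q := by
            have := abs_sub_le (rootCoord n l x) (rootCoord n l w) (rootCoord n l y)
            rwa [abs_sub_comm (rootCoord n l x) (rootCoord n l w)] at this
          have hp : 0 ≤ p := abs_nonneg _
          have hq : 0 ≤ q := abs_nonneg _
          have h2 : |rootCoord n l x - rootCoord n l y| ^ m ≤ 2 ^ m * (p ^ m + q ^ m) := by
            calc _ ≤ (p + q) ^ m := by gcongr
              _ ≤ (2 * max p q) ^ m := by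
                gcongr; linarith [le_max_left p q, le_max_right p q]
              _ ≤ _ := by
                rw [mul_pow]
                gcongr
                rcases max_choice p q with h | h <;> rw [h]
                · linarith [pow_nonneg hq m]
                · linarith [pow_nonneg hp m]
          calc _ ≤ 2 ^ m * (p ^ m + q ^ m) * (|MvPolynomial.eval w g| * |MvPolynomial.eval w U|) := by
                gcongr
            _ = _ := by ring
    _ ≤ 2 ^ m * (√S * √T + √S * (√T * (1 + n * |t|) ^ m)) := by
        rw [integral_const_mul, integral_add]
        · exact mul_le_mul_of_nonneg_left (add_le_add hI1 hI2) (by positivity)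
        · exact integrable_jacobiMeasure hκ (((hρx.pow m).mul (continuous_eval g)).abs.mul
            (continuous_eval U).abs)
        · exact integrable_jacobiMeasure hκ ((continuous_eval g).abs.mul
            ((hρy.pow m).mul (continuous_eval U)).abs)
    _ ≤ _ := by
        gcongr
        have : 0 ≤ √S * √T := by positivity
        nlinarith

lemma exists_coord_ge {n : ℕ} (hn : 0 < n) {x y : Fin d → ℝ} (hx : x ∈ Splx d)
    (hy : y ∈ Splx d) : ∃ l : Fin (d+1), 1 + n * rootDist x y ≤
      (d + 2) * (1 + |rootCoord n l x - rootCoord n l y|) := by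
  have hn' : (0:ℝ) < n := by exact_mod_cast hn
  obtain ⟨l, -, hl⟩ := Finset.exists_max_image univ
    (fun l : Fin (d+1) => |rootCoord n l x - rootCoord n l y|) univ_nonempty
  refine ⟨l, ?_⟩
  have h1 : n * rootDist x y ≤
      ∑ _i : Fin (d+1), (1 + |rootCoord n l x - rootCoord n l y|) := by
    rw [rootDist, Finset.mul_sum]
    refine Finset.sum_le_sum fun i _ => ?_
    have h2 := abs_rootCoord_sub_sub_le hn i hx hy
    have h3 := hl i (mem_univ i)
    have h4 : n * |√(xe x i) - √(xe y i)| = |(n:ℝ) * (√(xe x i) - √(xe y i))| := by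
      rw [abs_mul, abs_of_pos hn']
    rw [h4]
    have h5 := abs_sub_abs_le_abs_sub ((n:ℝ) * (√(xe x i) - √(xe y i)))
      (rootCoord n i x - rootCoord n i y)
    rw [abs_sub_comm (_ * _)] at h5
    linarith
  rw [Finset.sum_const, Finset.card_univ, Fintype.card_fin, nsmul_eq_mul] at h1
  push_cast at h1
  linarith [abs_nonneg (rootCoord n l x - rootCoord n l y)]

/-- Localized reproducers at `x` and `y` whose spectral correlation decays rapidly. -/
lemma exists_wave_decay (hd : 0 < d) (hκ : ∀ i, 0 ≤ κ i) (k : ℕ) : ∃ C > 0, ∃ D : ℕ, 2 ≤ D ∧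
    ∀ n : ℕ, 0 < n → ∀ x ∈ Splx d, ∀ y ∈ Splx d, ∃ v u : ℕ → MvPolynomial (Fin d) ℝ,
      (∀ j, InVn d j κ (u j)) ∧
      (∀ j ≤ 2 * n, ∀ p, InVn d j κ p → innerForm hκ (v j) p = MvPolynomial.eval x p) ∧
      (∀ j ≤ 2 * n, ∀ p, InVn d j κ p → innerForm hκ (u j) p = MvPolynomial.eval y p) ∧
      ∀ t : ℝ, |∑ j ∈ range (D * n + 1), Real.cos ((j + specParam κ) * t) *
        innerForm hκ (v j) (u j)| * (1 + n * rootDist x y) ^ k ≤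
        C * n ^ d / (√(Wkn κ n x) * √(Wkn κ n y)) * (1 + n * |t|) ^ k := by
  obtain ⟨C, hC, D, hD, hrep⟩ := exists_reproducer hκ (κ := κ) k
  refine ⟨((d + 2) * 2) ^ k * (2 + 2 ^ k * 2) * C, by positivity, D, hD, fun n hn x hx y hy => ?_⟩
  have hn' : (0:ℝ) < n := by exact_mod_cast hn
  obtain ⟨v, hv, hvr, hvm⟩ := hrep n hn x hx
  obtain ⟨u, hu, hur, hum⟩ := hrep n hn y hy
  refine ⟨v, u, hu, hvr, hur, fun t => ?_⟩
  have hWx := Wkn_pos (κ := κ) hn hx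
  have hWy := Wkn_pos (κ := κ) hn hy
  set S := C * (n:ℝ) ^ d / Wkn κ n x with hS
  set T := C * (n:ℝ) ^ d / Wkn κ n y with hT
  have hS0 : 0 < S := by positivity
  have hT0 : 0 < T := by positivity
  have hST : √S * √T = C * n ^ d / (√(Wkn κ n x) * √(Wkn κ n y)) := by
    rw [hS, hT, Real.sqrt_div (by positivity), Real.sqrt_div (by positivity), div_mul_div_comm,
      Real.mul_self_sqrt (by positivity)]
  have hsum : ∑ j ∈ range (D * n + 1), Real.cos ((j + specParam κ) * t) *
      innerForm hκ (v j) (u j) = innerForm hκ (∑ j ∈ range (D * n + 1), v j)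
        (waveCos κ u (D * n + 1) t) := by
    rw [waveCos, map_sum]
    refine Finset.sum_congr rfl fun j hj => ?_
    rw [map_smul, InVn.innerForm_sum hκ hv (mem_range.1 hj) (hu j), smul_eq_mul]
  obtain ⟨l, hl⟩ := exists_coord_ge hn hx hy
  have h1 := reproducer_wave_correlation hd hκ hv hu (D * n + 1) hn hx hy hS0 hT0 hvm hum
    le_rfl l t
  have h2 := reproducer_wave_correlation hd hκ hv hu (D * n + 1) hn hx hy hS0 hT0 hvm hum
    k.zero_le l t
  rw [hsum]
  set I := |innerForm hκ (∑ j ∈ range (D * n + 1), v j) (waveCos κ u (D * n + 1) t)|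
  set Δ := |rootCoord n l x - rootCoord n l y|
  have hΔ : 0 ≤ Δ := abs_nonneg _
  have hone : 1 ≤ 1 + n * |t| := by nlinarith [abs_nonneg t]
  have hpow : 1 ≤ (1 + n * |t|) ^ k := one_le_pow₀ hone
  have hI : 0 ≤ I := abs_nonneg _
  simp only [pow_zero, one_mul, mul_one] at h2
  have h3 : (1 + n * rootDist x y) ^ k ≤ ((d + 2) * 2) ^ k * (1 + Δ ^ k) := by
    have hr := rootDist_nonneg x y
    calc (1 + n * rootDist x y) ^ k ≤ ((d + 2) * (1 + Δ)) ^ k := by gcongr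
      _ ≤ ((d + 2) * (2 * max 1 Δ)) ^ k := by
        gcongr; linarith [le_max_left 1 Δ, le_max_right 1 Δ]
      _ = ((d + 2) * 2) ^ k * max 1 Δ ^ k := by rw [← mul_assoc, mul_pow]
      _ ≤ _ := by
        gcongr
        rcases max_choice 1 Δ with h | h <;> rw [h]
        · simp only [one_pow]; linarith [pow_nonneg hΔ k]
        · linarith
  have hST0 : 0 < √S * √T := by positivity
  calc I * (1 + n * rootDist x y) ^ k ≤ I * (((d + 2) * 2) ^ k * (1 + Δ ^ k)) := by gcongr
    _ = ((d + 2) * 2) ^ k * (I + Δ ^ k * I) := by ring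
    _ ≤ ((d + 2) * 2) ^ k * (2 * (√S * √T) * (1 + n * |t|) ^ k +
        2 ^ k * (2 * (√S * √T * (1 + n * |t|) ^ k))) := by
        gcongr
        exact h2.trans (le_mul_of_one_le_right (by positivity) hpow)
    _ = _ := by rw [hST]; ring

end WaveDecay

section Multiplier

open FourierTransform in
/-- Decay of the Fourier transform in terms of bounds for derivatives. -/
lemma fourier_decay {f : ℝ → ℂ} (hf : ContDiff ℝ (⊤ : ℕ∞) f) {R : ℝ} (hR : 0 < R)
    (hsupp : ∀ s, R < |s| → f s = 0) {m : ℕ} {B : ℝ}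
    (hB : ∀ s, ‖iteratedDeriv m f s‖ ≤ B) (ξ : ℝ) : |ξ| ^ m * ‖𝓕 f ξ‖ ≤ 2 * R * B := by
  have hzero : ∀ q s, R < |s| → iteratedDeriv q f s = 0 := fun q s hs => by
    have : f =ᶠ[nhds s] fun _ => 0 :=
      Filter.eventually_of_mem ((isOpen_lt continuous_const continuous_abs).mem_nhds hs) hsupp
    rw [this.iteratedDeriv_eq]
    simp
  have hcont : ∀ q, Continuous (iteratedDeriv q f) := fun q =>
    hf.continuous_iteratedDeriv q (by exact_mod_cast le_top)
  have hint : ∀ q, Integrable (iteratedDeriv q f) := fun q =>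
    (hcont q).integrable_of_hasCompactSupport
      (HasCompactSupport.intro (isCompact_Icc (a := -R) (b := R)) fun s hs =>
        hzero q s (by
          by_contra! h
          exact hs (abs_le.1 h)))
  have h1 := congrFun (Real.fourier_iteratedDeriv (N := ⊤) hf (fun q _ => hint q)
    (n := m) (by exact_mod_cast le_top)) ξ
  have h2 : ‖𝓕 (iteratedDeriv m f) ξ‖ ≤ ∫ s, ‖iteratedDeriv m f s‖ :=
    VectorFourier.norm_fourierIntegral_le_integral_norm _ _ _ _ _
  have h3 : ∫ s, ‖iteratedDeriv m f s‖ ≤ 2 * R * B := by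
    rw [← setIntegral_eq_integral_of_forall_compl_eq_zero (s := Set.Icc (-R) R) fun s hs => by
      rw [hzero m s (by by_contra! h; exact hs (abs_le.1 h)), norm_zero]]
    refine (setIntegral_mono (hint m).norm.integrableOn (integrableOn_const (by simp))
      fun s => hB s).trans (le_of_eq ?_)
    rw [setIntegral_const]
    simp only [measureReal_def, Real.volume_Icc, smul_eq_mul]
    rw [ENNReal.toReal_ofReal (by linarith)]
    ring
  rw [h1, norm_smul, norm_pow] at h2
  refine le_trans ?_ (h2.trans h3)
  gcongr
  simp only [norm_mul, Complex.norm_I, Complex.norm_real, mul_one, Real.norm_eq_abs,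
    Complex.norm_ofNat, abs_of_pos Real.pi_pos]
  nlinarith [abs_nonneg ξ, Real.two_le_pi]

/-- A cutoff function extended by `1` to the negative axis. -/
def cutoffExt (a : ℝ → ℝ) (s : ℝ) : ℂ := if s ≤ 0 then 1 else (a s : ℂ)

lemma cutoffExt_of_lt_one {a : ℝ → ℝ} (ha : IsCutoff a) {s : ℝ} (hs : s < 1) :
    cutoffExt a s = 1 := by
  unfold cutoffExt
  split_ifs with h
  · rfl
  · rw [ha.2.2 s (not_le.1 h).le hs.le, Complex.ofReal_one]

lemma cutoffExt_of_nonneg {a : ℝ → ℝ} (ha : IsCutoff a) {s : ℝ} (hs : 0 ≤ s) :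
    cutoffExt a s = a s := by
  unfold cutoffExt
  split_ifs with h
  · rw [le_antisymm h hs, ha.2.2 0 le_rfl zero_le_one, Complex.ofReal_one]
  · rfl

lemma contDiff_cutoffExt {a : ℝ → ℝ} (ha : IsCutoff a) :
    ContDiff ℝ (⊤ : ℕ∞) (cutoffExt a) := by
  rw [contDiff_iff_contDiffAt]
  intro s
  rcases lt_or_ge s 1 with hs | hs
  · exact (contDiffAt_const (c := (1:ℂ))).congr_of_eventuallyEq (Filter.eventually_of_mem
      (Iio_mem_nhds hs) fun t ht => cutoffExt_of_lt_one ha ht)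
  · exact (Complex.ofRealCLM.contDiff.comp ha.1).contDiffAt.congr_of_eventuallyEq
      (Filter.eventually_of_mem (Ioi_mem_nhds (zero_lt_one.trans_le hs)) fun t ht =>
        cutoffExt_of_nonneg ha (le_of_lt ht))

lemma exists_cutoffExt_bound {a : ℝ → ℝ} (ha : IsCutoff a) (m : ℕ) :
    ∃ B, ∀ s, ‖iteratedDeriv m (cutoffExt a) s‖ ≤ B := by
  obtain ⟨B, hB⟩ := (isCompact_Icc (a := (0:ℝ)) (b := 2)).exists_bound_of_continuousOn
    ((contDiff_cutoffExt ha).continuous_iteratedDeriv m (by exact_mod_cast le_top)).continuousOn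
  refine ⟨max B 1, fun s => ?_⟩
  have hconst : ∀ c : ℂ, ‖c‖ ≤ 1 → cutoffExt a =ᶠ[nhds s] (fun _ => c) →
      ‖iteratedDeriv m (cutoffExt a) s‖ ≤ max B 1 := fun c hc h => by
    rw [h.iteratedDeriv_eq, iteratedDeriv_const]
    split_ifs
    · exact hc.trans (le_max_right _ _)
    · simp
  by_cases h0 : s < 0
  · exact hconst 1 (by simp) (Filter.eventually_of_mem (Iio_mem_nhds (h0.trans zero_lt_one))
      fun t ht => cutoffExt_of_lt_one ha ht)
  by_cases h2 : 2 < s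
  · refine hconst 0 (by simp) (Filter.eventually_of_mem (Ioi_mem_nhds h2) fun t ht => ?_)
    have ht' : (2:ℝ) < t := ht
    rw [cutoffExt_of_nonneg ha (by linarith), ha.2.1 t ht, Complex.ofReal_zero]
  · exact (hB s ⟨not_lt.1 h0, not_lt.1 h2⟩).trans (le_max_left _ _)

/-- An even bump function interpolating a shifted cutoff function. -/
def evenCutoff (a : ℝ → ℝ) (μ s : ℝ) : ℂ := cutoffExt a (s - μ) * cutoffExt a (-μ - s)

lemma evenCutoff_neg (a : ℝ → ℝ) (μ s : ℝ) : evenCutoff a μ (-s) = evenCutoff a μ s := by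
  unfold evenCutoff
  rw [mul_comm]
  congr 2 <;> ring

lemma evenCutoff_add {a : ℝ → ℝ} (ha : IsCutoff a) {μ s : ℝ} (hμ : 0 ≤ μ) (hs : 0 ≤ s) :
    evenCutoff a μ (s + μ) = a s := by
  rw [evenCutoff, add_sub_cancel_right, cutoffExt_of_nonneg ha hs,
    cutoffExt_of_lt_one ha (by linarith), mul_one]

lemma contDiff_evenCutoff {a : ℝ → ℝ} (ha : IsCutoff a) (μ : ℝ) :
    ContDiff ℝ (⊤ : ℕ∞) (evenCutoff a μ) :=
  ((contDiff_cutoffExt ha).comp (contDiff_id.sub contDiff_const)).mul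
    ((contDiff_cutoffExt ha).comp (contDiff_const.sub contDiff_id))

lemma evenCutoff_eq_zero {a : ℝ → ℝ} (ha : IsCutoff a) {μ s : ℝ}
    (hs : 2 + μ < |s|) : evenCutoff a μ s = 0 := by
  unfold evenCutoff
  rcases lt_abs.1 hs with h | h
  · rw [cutoffExt_of_nonneg ha (by linarith : 0 ≤ s - μ), ha.2.1 _ (by linarith),
      Complex.ofReal_zero, zero_mul]
  · rw [cutoffExt_of_nonneg ha (by linarith : 0 ≤ -μ - s), ha.2.1 _ (by linarith),
      Complex.ofReal_zero, mul_zero]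

lemma exists_evenCutoff_bound {a : ℝ → ℝ} (ha : IsCutoff a) (m : ℕ) :
    ∃ B, ∀ μ s, ‖iteratedDeriv m (evenCutoff a μ) s‖ ≤ B := by
  choose B hB using exists_cutoffExt_bound ha
  have hB0 : ∀ q, 0 ≤ B q := fun q => (norm_nonneg _).trans (hB q 0)
  refine ⟨∑ i ∈ range (m + 1), m.choose i * B i * B (m - i), fun μ s => ?_⟩
  have hm : (m : WithTop ℕ∞) ≤ ((⊤ : ℕ∞) : WithTop ℕ∞) := by exact_mod_cast le_top
  have h1 : ContDiff ℝ m fun s => cutoffExt a (s - μ) :=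
    ((contDiff_cutoffExt ha).comp (contDiff_id.sub contDiff_const)).of_le hm
  have h2 : ContDiff ℝ m fun s => cutoffExt a (-μ - s) :=
    ((contDiff_cutoffExt ha).comp (contDiff_const.sub contDiff_id)).of_le hm
  have h3 : evenCutoff a μ = (fun s => cutoffExt a (s - μ)) * fun s => cutoffExt a (-μ - s) := rfl
  rw [h3, iteratedDeriv_mul h1.contDiffAt h2.contDiffAt]
  refine (norm_sum_le _ _).trans (Finset.sum_le_sum fun i _ => ?_)
  rw [iteratedDeriv_comp_sub_const, iteratedDeriv_comp_const_sub]
  simp only [norm_mul, norm_smul, norm_pow, norm_neg, norm_one, one_pow, one_mul]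
  rw [Complex.norm_natCast]
  gcongr
  · exact mul_nonneg (Nat.cast_nonneg _) (hB0 _)
  · exact hB _ _
  · exact hB _ _

open FourierTransform in
lemma exists_fourier_evenCutoff_bound {a : ℝ → ℝ} (ha : IsCutoff a) {l : ℝ} (hl : 0 ≤ l) (k : ℕ) :
    ∃ C > 0, ∀ μ, 0 ≤ μ → μ ≤ l → ∀ ξ, (1 + |ξ|) ^ k * ‖𝓕 (evenCutoff a μ) ξ‖ ≤ C := by
  obtain ⟨B₀, hB₀⟩ := exists_evenCutoff_bound ha 0
  obtain ⟨B, hB⟩ := exists_evenCutoff_bound ha k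
  have hB₀0 : 0 ≤ B₀ := (norm_nonneg _).trans (hB₀ 0 0)
  have hB0 : 0 ≤ B := (norm_nonneg _).trans (hB 0 0)
  refine ⟨2 ^ k * (2 * (2 + l) * B₀ + 2 * (2 + l) * B) + 1, by positivity,
    fun μ hμ hμl ξ => ?_⟩
  have hs : ∀ s, 2 + l < |s| → evenCutoff a μ s = 0 := fun s hs =>
    evenCutoff_eq_zero ha (by linarith)
  have h0 := fourier_decay (contDiff_evenCutoff ha μ) (by linarith : 0 < 2 + l) hs (hB₀ μ) ξ
  have h1 := fourier_decay (contDiff_evenCutoff ha μ) (by linarith : 0 < 2 + l) hs (hB μ) ξ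
  rw [pow_zero, one_mul] at h0
  have h2 : (1 + |ξ|) ^ k ≤ 2 ^ k * (1 + |ξ| ^ k) := by
    calc (1 + |ξ|) ^ k ≤ (2 * max 1 |ξ|) ^ k := by
          gcongr; linarith [le_max_left 1 |ξ|, le_max_right 1 |ξ|]
      _ ≤ _ := by
          rw [mul_pow]
          gcongr
          rcases max_choice 1 |ξ| with h | h <;> rw [h]
          · simp
          · linarith
  calc _ ≤ 2 ^ k * (1 + |ξ| ^ k) * ‖𝓕 (evenCutoff a μ) ξ‖ := by gcongr
    _ = 2 ^ k * (‖𝓕 (evenCutoff a μ) ξ‖ + |ξ| ^ k * ‖𝓕 (evenCutoff a μ) ξ‖) := by ring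
    _ ≤ 2 ^ k * (2 * (2 + l) * B₀ + 2 * (2 + l) * B) := by gcongr
    _ ≤ _ := by linarith

open FourierTransform in
lemma even_fourier_inversion {f : ℝ → ℂ} (hf : Continuous f) (hfi : Integrable f)
    (hFi : Integrable (𝓕 f)) (heven : ∀ s, f (-s) = f s) (s : ℝ) :
    f s = ∫ ξ, (Real.cos (2 * Real.pi * ξ * s) : ℂ) * 𝓕 f ξ := by
  have hcont : ∀ s : ℝ, Continuous fun ξ : ℝ =>
      Complex.exp (((2 * Real.pi * ξ * s : ℝ) : ℂ) * Complex.I) := fun s => by fun_prop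
  have hinv : ∀ s, f s = ∫ ξ, Complex.exp (((2 * Real.pi * ξ * s : ℝ) : ℂ) * Complex.I) * 𝓕 f ξ :=
    fun s => by
      conv_lhs => rw [← hf.fourierInv_fourier_eq hfi hFi]
      rw [Real.fourierInv_eq']
      congr 1
      ext ξ
      simp only [RCLike.inner_apply, conj_trivial, smul_eq_mul]
      congr 4
      ring
  have hint : ∀ s : ℝ, Integrable fun ξ : ℝ =>
      Complex.exp (((2 * Real.pi * ξ * s : ℝ) : ℂ) * Complex.I) * 𝓕 f ξ := fun s =>
    hFi.bdd_mul (c := 1) (hcont s).aestronglyMeasurable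
      (Filter.Eventually.of_forall fun ξ => (Complex.norm_exp_ofReal_mul_I _).le)
  have h1 : f s = (1 / 2 : ℂ) * (f s + f (-s)) := by rw [heven]; ring
  rw [h1, hinv s, hinv (-s), ← integral_add (hint s) (hint (-s)), ← integral_const_mul]
  congr 1
  ext ξ
  rw [Complex.ofReal_cos, Complex.cos, mul_neg, Complex.ofReal_neg]
  ring

/-- Spectral multipliers with cutoff symbol are controlled by wave multipliers. -/
lemma exists_multiplier_bound {a : ℝ → ℝ} (ha : IsCutoff a) {l : ℝ} (hl : 0 < l) (k : ℕ) :
    ∃ C > 0, ∀ n : ℕ, 0 < n → ∀ (M : ℕ) (I : ℕ → ℝ) (B : ℝ),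
      (∀ t : ℝ, |∑ j ∈ range M, Real.cos ((j + l) * t) * I j| ≤ B * (1 + n * |t|) ^ k) →
      |∑ j ∈ range M, a (j / n) * I j| ≤ C * B := by
  obtain ⟨C, hC, hF⟩ := exists_fourier_evenCutoff_bound ha hl.le (k + 2)
  refine ⟨7 ^ k * C * Real.pi, by positivity, fun n hn M I B hI => ?_⟩
  have hn' : (0:ℝ) < n := by exact_mod_cast hn
  have hn1 : (1:ℝ) ≤ n := by exact_mod_cast hn
  have hB : 0 ≤ B := by simpa using (abs_nonneg _).trans (hI 0)
  set μ := l / n with hμ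
  have hμ0 : 0 ≤ μ := by positivity
  replace hF := hF μ hμ0 (div_le_self hl.le hn1)
  set f := evenCutoff a μ with hf
  set F : ℝ → ℂ := FourierTransform.fourier f with hFdef
  have hfc : Continuous f := (contDiff_evenCutoff ha μ).continuous
  have hfi : Integrable f := hfc.integrable_of_hasCompactSupport
    (HasCompactSupport.intro (isCompact_Icc (a := -(2 + μ)) (b := 2 + μ)) fun s hs =>
      evenCutoff_eq_zero ha (by by_contra! h; exact hs (abs_le.1 h)))
  have hFc : Continuous F := VectorFourier.fourierIntegral_continuous Real.continuous_fourierChar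
    (by exact continuous_inner) hfi
  have hpt : ∀ ξ, (1 + |ξ|) ^ k * ‖F ξ‖ ≤ C * (1 + ξ ^ 2)⁻¹ := fun ξ => by
    rw [← div_eq_mul_inv, le_div_iff₀ (by positivity)]
    refine le_trans ?_ (hF ξ)
    have h1 : 1 + ξ ^ 2 ≤ (1 + |ξ|) ^ 2 := by nlinarith [sq_abs ξ, abs_nonneg ξ]
    calc (1 + |ξ|) ^ k * ‖F ξ‖ * (1 + ξ ^ 2) ≤ (1 + |ξ|) ^ k * ‖F ξ‖ * (1 + |ξ|) ^ 2 := by gcongr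
      _ = _ := by rw [pow_add]; ring
  have hFi : Integrable F := by
    refine (integrable_inv_one_add_sq.const_mul C).mono' hFc.aestronglyMeasurable
      (Filter.Eventually.of_forall fun ξ => ?_)
    refine le_trans ?_ (hpt ξ)
    exact le_mul_of_one_le_left (norm_nonneg _) (one_le_pow₀ (by linarith [abs_nonneg ξ]))
  have hinv := even_fourier_inversion hfc hfi hFi (evenCutoff_neg a μ)
  have hcos : ∀ s : ℝ, Integrable fun ξ : ℝ => (Real.cos (2 * Real.pi * ξ * s) : ℂ) * F ξ :=
    fun s => hFi.bdd_mul (c := 1)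
      (by fun_prop : Continuous fun ξ : ℝ => (Real.cos (2 * Real.pi * ξ * s) : ℂ)).aestronglyMeasurable
      (Filter.Eventually.of_forall fun ξ => by
        rw [Complex.norm_real]; exact Real.abs_cos_le_one _)
  have hsum : ((∑ j ∈ range M, a (j / n) * I j : ℝ) : ℂ) = ∫ ξ, ((∑ j ∈ range M,
      Real.cos ((j + l) * (2 * Real.pi * ξ / n)) * I j : ℝ) : ℂ) * F ξ := by
    have h1 : ∀ j : ℕ, ((a (j / n) * I j : ℝ) : ℂ) = ∫ ξ,
        ((Real.cos ((j + l) * (2 * Real.pi * ξ / n)) * I j : ℝ) : ℂ) * F ξ := fun j => by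
      rw [Complex.ofReal_mul, ← evenCutoff_add ha hμ0 (by positivity : (0:ℝ) ≤ j / n),
        ← hf, hinv, mul_comm, ← integral_const_mul]
      congr 1
      ext ξ
      rw [Complex.ofReal_mul, show 2 * Real.pi * ξ * (j / n + μ) =
        (j + l) * (2 * Real.pi * ξ / n) by rw [hμ]; field_simp]
      ring
    rw [Complex.ofReal_sum]
    simp only [h1]
    rw [← integral_finsetSum]
    · congr 1; ext ξ; rw [Complex.ofReal_sum, Finset.sum_mul]
    · intro j _
      have h2 := (hcos ((j + l) / n)).const_mul (I j : ℂ)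
      refine h2.congr (Filter.Eventually.of_forall fun ξ => ?_)
      dsimp only
      rw [Complex.ofReal_mul, show 2 * Real.pi * ξ * ((j + l) / n) =
        (j + l) * (2 * Real.pi * ξ / n) by field_simp]
      ring
  rw [← Real.norm_eq_abs, ← Complex.norm_real, hsum]
  have hbd : ∀ ξ : ℝ, ‖((∑ j ∈ range M,
      Real.cos ((j + l) * (2 * Real.pi * ξ / n)) * I j : ℝ) : ℂ) * F ξ‖ ≤
      7 ^ k * C * B * (1 + ξ ^ 2)⁻¹ := fun ξ => by
    rw [norm_mul, Complex.norm_real, Real.norm_eq_abs]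
    have h1 := hI (2 * Real.pi * ξ / n)
    have h2 : 1 + n * |2 * Real.pi * ξ / n| ≤ 7 * (1 + |ξ|) := by
      rw [abs_div, abs_mul, abs_mul, abs_two, abs_of_pos Real.pi_pos, abs_of_pos hn',
        mul_div_cancel₀ _ hn'.ne']
      nlinarith [abs_nonneg ξ, Real.pi_lt_d2]
    calc _ ≤ B * (1 + n * |2 * Real.pi * ξ / n|) ^ k * ‖F ξ‖ := by gcongr
      _ ≤ B * (7 * (1 + |ξ|)) ^ k * ‖F ξ‖ := by gcongr
      _ = B * 7 ^ k * ((1 + |ξ|) ^ k * ‖F ξ‖) := by rw [mul_pow]; ring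
      _ ≤ B * 7 ^ k * (C * (1 + ξ ^ 2)⁻¹) := mul_le_mul_of_nonneg_left (hpt ξ) (by positivity)
      _ = _ := by ring
  refine (norm_integral_le_of_norm_le (integrable_inv_one_add_sq.const_mul _)
    (Filter.Eventually.of_forall hbd)).trans (le_of_eq ?_)
  rw [integral_const_mul, integral_univ_inv_one_add_sq]
  ring

end Multiplier

section Localization

variable {d : ℕ} {κ : Fin (d+1) → ℝ}

/-- The localized kernel decays faster than any power of the distance. -/
lemma exists_Lk_decay (hd : 0 < d) (hκ : ∀ i, 0 ≤ κ i)
    {P : ℕ → (Fin d → ℝ) → (Fin d → ℝ) → ℝ} (hP : IsRK d κ P) {a : ℝ → ℝ} (ha : IsCutoff a)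
    (k : ℕ) : ∃ C > 0, ∀ n : ℕ, 0 < n → ∀ x ∈ Splx d, ∀ y ∈ Splx d,
      |Lk a P n x y| ≤
        C * n ^ d / (√(Wkn κ n x) * √(Wkn κ n y)) / (1 + n * rootDist x y) ^ k := by
  obtain ⟨C₁, hC₁, D, hD, hw⟩ := exists_wave_decay hd hκ k
  obtain ⟨C₂, hC₂, hm⟩ := exists_multiplier_bound ha (specParam_pos hd hκ) k
  refine ⟨C₂ * C₁, by positivity, fun n hn x hx y hy => ?_⟩
  obtain ⟨v, u, huV, hv, hu, hvu⟩ := hw n hn x hx y hy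
  have hr : 0 < (1 + n * rootDist x y) ^ k := by have := rootDist_nonneg x y; positivity
  have hM : 2 * n < D * n + 1 := Nat.lt_succ_of_le (Nat.mul_le_mul_right n hD)
  rw [Lk_eq_sum hκ hP ha hn huV hv hu hM]
  refine (hm n hn _ _ (C₁ * n ^ d / (√(Wkn κ n x) * √(Wkn κ n y)) / (1 + n * rootDist x y) ^ k)
    fun t => ?_).trans (le_of_eq (by ring))
  rw [div_mul_eq_mul_div, le_div_iff₀ hr]
  exact hvu t

/-- The localized kernel is a polynomial of degree at most `2 * n` in its first variable. -/
lemma exists_Lk_polynomial {P : ℕ → (Fin d → ℝ) → (Fin d → ℝ) → ℝ} (hP : IsRK d κ P) {a : ℝ → ℝ}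
    (ha : IsCutoff a) {n : ℕ} (hn : 0 < n) (y : Fin d → ℝ) :
    ∃ F : MvPolynomial (Fin d) ℝ, F.totalDegree ≤ 2 * n ∧
      ∀ x, Lk a P n x y = MvPolynomial.eval x F := by
  choose p hpV hp using fun j => (hP j).2.1 y
  refine ⟨∑ j ∈ range (2 * n + 1), MvPolynomial.C (a (j / n)) * p j,
    MvPolynomial.totalDegree_finsetSum_le fun j hj => ?_, fun x => ?_⟩
  · refine (MvPolynomial.totalDegree_mul _ _).trans ?_
    rw [MvPolynomial.totalDegree_C, zero_add]
    exact (hpV j).1.trans (Nat.lt_succ_iff.1 (mem_range.1 hj))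
  · rw [Lk, tsum_eq_sum (s := range (2 * n + 1)), map_sum]
    · exact Finset.sum_congr rfl fun j _ => by rw [map_mul, MvPolynomial.eval_C, hp]
    · intro j hj
      rw [ha.2.1, zero_mul]
      rw [lt_div_iff₀ (by exact_mod_cast hn)]
      exact_mod_cast Nat.lt_of_succ_le (not_lt.1 fun h => hj (mem_range.2 h))

/-- The majorant of the localized kernel varies slowly in its first variable. -/
lemma exists_majorant_le (hκ : ∀ i, 0 ≤ κ i) (k : ℕ) : ∃ m : ℕ, ∀ n : ℕ, 0 < n →
    ∀ x ∈ Splx d, ∀ y ∈ Splx d, ∀ w ∈ Splx d, ∀ A : ℝ, 0 ≤ A →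
      A / (√(Wkn κ n w) * √(Wkn κ n y)) / (1 + n * rootDist w y) ^ k ≤
        A / (√(Wkn κ n x) * √(Wkn κ n y)) / (1 + n * rootDist x y) ^ k *
          (1 + n * rootDist w x) ^ m := by
  set s := ⌈2 * ∑ i, κ i + (d + 1)⌉₊
  refine ⟨s + k, fun n hn x hx y hy w hw A hA => ?_⟩
  have hwx := rootDist_nonneg w x
  have hwy := rootDist_nonneg w y
  have hxy := rootDist_nonneg x y
  have hWx := Real.sqrt_pos.2 (Wkn_pos (κ := κ) hn hx)
  have hWy := Real.sqrt_pos.2 (Wkn_pos (κ := κ) hn hy)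
  have hWw := Real.sqrt_pos.2 (Wkn_pos (κ := κ) hn hw)
  have hR : 1 ≤ 1 + n * rootDist w x := by
    have : 0 ≤ n * rootDist w x := by positivity
    linarith
  have h1 : √(Wkn κ n x) ≤ √(Wkn κ n w) * (1 + n * rootDist w x) ^ s := by
    rw [Real.sqrt_le_left (by positivity), mul_pow, Real.sq_sqrt (Wkn_pos hn hw).le]
    refine (Wkn_le hκ hn hw hx).trans (mul_le_mul_of_nonneg_left ?_ (Wkn_pos hn hw).le)
    calc _ ≤ (1 + n * rootDist w x) ^ (s : ℝ) :=
          Real.rpow_le_rpow_of_exponent_le hR (Nat.le_ceil _)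
      _ = (1 + n * rootDist w x) ^ s := Real.rpow_natCast _ _
      _ ≤ _ := le_self_pow₀ (one_le_pow₀ hR) two_ne_zero
  have h2 : 1 + n * rootDist x y ≤ (1 + n * rootDist w y) * (1 + n * rootDist w x) := by
    have h3 := rootDist_triangle x w y
    rw [rootDist_comm x w] at h3
    have h4 : 0 ≤ n * rootDist w y * (n * rootDist w x) := by positivity
    have h5 : n * rootDist x y ≤ n * (rootDist w x + rootDist w y) := by gcongr
    linarith
  rw [div_div, div_div, div_mul_eq_mul_div, div_le_div_iff₀ (by positivity) (by positivity)]
  calc A * (√(Wkn κ n x) * √(Wkn κ n y) * (1 + n * rootDist x y) ^ k)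
      ≤ A * (√(Wkn κ n w) * (1 + n * rootDist w x) ^ s * √(Wkn κ n y) *
          ((1 + n * rootDist w y) * (1 + n * rootDist w x)) ^ k) := by gcongr
    _ = _ := by rw [pow_add, mul_pow]; ring

/-- A Lipschitz estimate for the localized kernel in terms of `rootDist`. -/
lemma exists_Lk_lipschitz (hd : 0 < d) (hκ : ∀ i, 0 ≤ κ i)
    {P : ℕ → (Fin d → ℝ) → (Fin d → ℝ) → ℝ} (hP : IsRK d κ P) {a : ℝ → ℝ} (ha : IsCutoff a)
    (k : ℕ) : ∃ C > 0, ∀ n : ℕ, 0 < n → ∀ x ∈ Splx d, ∀ y ∈ Splx d, ∀ z ∈ Splx d,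
      n * dT x z ≤ 1 → |Lk a P n x y - Lk a P n z y| ≤ C * n ^ (d + 1) * dT x z /
        (√(Wkn κ n x) * √(Wkn κ n y)) / (1 + n * rootDist x y) ^ k := by
  obtain ⟨C, hC, hL⟩ := exists_Lk_decay hd hκ hP ha k
  obtain ⟨m, hm⟩ := exists_majorant_le hκ k
  obtain ⟨C', hC', D, hQ⟩ := exists_peak d m
  refine ⟨14 * C * C' * ((2 + D) + D * (d + 2) ^ m), by positivity,
    fun n hn x hx y hy z hz hxz => ?_⟩
  obtain ⟨F, hFd, hF⟩ := exists_Lk_polynomial hP ha hn y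
  obtain ⟨Q, hQd, hQx, hQ⟩ := hQ n hn x hx
  have hR : ∀ w, 1 ≤ 1 + n * rootDist w x := fun w => by
    have : 0 ≤ n * rootDist w x := mul_nonneg (Nat.cast_nonneg n) (rootDist_nonneg w x)
    linarith
  have hxy := rootDist_nonneg x y
  have hT := dT_nonneg x z
  set A := C * n ^ d / (√(Wkn κ n x) * √(Wkn κ n y)) / (1 + n * rootDist x y) ^ k with hA
  have hA0 : 0 ≤ A := by positivity
  have hFw : ∀ w ∈ Splx d, |MvPolynomial.eval w F| ≤ A * (1 + n * rootDist w x) ^ m :=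
    fun w hw => by
      rw [← hF]
      exact (hL n hn w hw y hy).trans (hm n hn x hx y hy w hw _ (by positivity))
  have hQw : ∀ w ∈ Splx d, |MvPolynomial.eval w Q| ≤ C' := fun w hw =>
    (le_mul_of_one_le_right (abs_nonneg _) (one_le_pow₀ (hR w))).trans (hQ w hw)
  have hHw : ∀ w ∈ Splx d, |MvPolynomial.eval w (F * Q)| ≤ A * C' := fun w hw => by
    rw [map_mul, abs_mul]
    calc _ ≤ A * (1 + n * rootDist w x) ^ m * |MvPolynomial.eval w Q| := by
          gcongr; exact hFw w hw
      _ = A * (|MvPolynomial.eval w Q| * (1 + n * rootDist w x) ^ m) := by ring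
      _ ≤ A * C' := mul_le_mul_of_nonneg_left (hQ w hw) hA0
  have hHd : (F * Q).totalDegree ≤ 2 * n + D * n :=
    (MvPolynomial.totalDegree_mul _ _).trans (add_le_add hFd hQd)
  have h1 := abs_eval_sub_le _ (F * Q) hHd hHw hx hz
  have h2 := abs_eval_sub_le _ Q hQd hQw hx hz
  have h3 : |MvPolynomial.eval z F| ≤ A * (d + 2) ^ m := by
    refine (hFw z hz).trans (mul_le_mul_of_nonneg_left ?_ hA0)
    have h4 := hR z
    refine pow_le_pow_left₀ (by linarith) ?_ m
    have h5 : n * rootDist x z ≤ n * ((d + 1) * dT x z) := by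
      gcongr; exact rootDist_le_dT hx hz
    have h6 : ((d:ℝ) + 1) * (n * dT x z) ≤ (d + 1) * 1 := by gcongr
    rw [rootDist_comm z x]
    linarith
  rw [map_mul, map_mul, hQx, mul_one] at h1
  rw [hQx] at h2
  rw [hF, hF]
  calc |MvPolynomial.eval x F - MvPolynomial.eval z F|
      = |(MvPolynomial.eval x F - MvPolynomial.eval z F * MvPolynomial.eval z Q) +
          -(MvPolynomial.eval z F * (1 - MvPolynomial.eval z Q))| := by congr 1; ring
    _ ≤ |MvPolynomial.eval x F - MvPolynomial.eval z F * MvPolynomial.eval z Q| +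
          |MvPolynomial.eval z F| * |1 - MvPolynomial.eval z Q| := by
        rw [← abs_mul, ← abs_neg (MvPolynomial.eval z F * _)]
        exact abs_add_le _ _
    _ ≤ 14 * ((2 * n + D * n : ℕ) : ℝ) * (A * C') * dT x z +
          A * (d + 2) ^ m * (14 * ((D * n : ℕ) : ℝ) * C' * dT x z) :=
        add_le_add h1 (mul_le_mul h3 h2 (abs_nonneg _) (by positivity))
    _ = _ := by rw [hA]; push_cast; ring

end Localization

/-- the Lipschitz-type localization estimate for `L_n^κ` (Proposition 3.5). -/
theorem stmt17 (d : ℕ) (hd : 2 ≤ d) (κ : Fin (d+1) → ℝ) (hκ : ∀ i, 0 ≤ κ i)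
    (P : ℕ → (Fin d → ℝ) → (Fin d → ℝ) → ℝ) (hP : IsRK d κ P)
    (a : ℝ → ℝ) (ha : IsCutoff a)
    (γ : ℝ) (hγ : 2 * (∑ i, κ i) + 2 < γ) :
    ∃ δ₀ ∈ Set.Ioo (0:ℝ) 1, ∃ c > 0, ∀ n : ℕ, 0 < n → ∀ δ : ℝ, 0 < δ → δ ≤ δ₀ →
      ∀ x ∈ Splx d, ∀ y ∈ Splx d, ∀ z ∈ Splx d, dT x z ≤ δ / (n : ℝ) →
        |Lk a P n x y - Lk a P n z y| ≤
          c * (n : ℝ) ^ (d + 1) * dT x z /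
            (Real.sqrt (Wkn κ n x) * Real.sqrt (Wkn κ n y) *
              (1 + (n : ℝ) * dT x y) ^ (γ - 2 * (∑ i, κ i) - 2)) := by
  set k := ⌈γ⌉₊
  obtain ⟨C, hC, hL⟩ := exists_Lk_lipschitz (by omega) hκ hP ha k
  refine ⟨1 / 2, ⟨by norm_num, by norm_num⟩, C * 2 ^ k, by positivity,
    fun n hn δ _ hδ x hx y hy z hz hxz => ?_⟩
  have hn' : (0:ℝ) < n := by exact_mod_cast hn
  have hWx := Real.sqrt_pos.2 (Wkn_pos (κ := κ) hn hx)
  have hWy := Real.sqrt_pos.2 (Wkn_pos (κ := κ) hn hy)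
  have hT := dT_nonneg x z
  have hT' := dT_nonneg x y
  have hr := rootDist_nonneg x y
  rw [le_div_iff₀ hn'] at hxz
  refine (hL n hn x hx y hy z hz (by linarith)).trans ?_
  have hκs : 0 ≤ ∑ i, κ i := Finset.sum_nonneg fun i _ => hκ i
  have hb : 1 ≤ 1 + n * dT x y := by
    have : 0 ≤ n * dT x y := by positivity
    linarith
  have hpow : (1 + n * dT x y) ^ (γ - 2 * (∑ i, κ i) - 2) ≤
      2 ^ k * (1 + n * rootDist x y) ^ k := by
    calc _ ≤ (1 + n * dT x y) ^ (k : ℝ) :=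
          Real.rpow_le_rpow_of_exponent_le hb (by linarith [Nat.le_ceil γ])
      _ = (1 + n * dT x y) ^ k := Real.rpow_natCast _ _
      _ ≤ (2 * (1 + n * rootDist x y)) ^ k := by
          have h1 : n * dT x y ≤ n * (2 * rootDist x y) := by
            gcongr; exact dT_le_rootDist hx hy
          exact pow_le_pow_left₀ (by linarith) (by linarith) k
      _ = _ := mul_pow _ _ _
  rw [div_div, div_le_div_iff₀ (by positivity) (by positivity)]
  calc _ ≤ C * n ^ (d + 1) * dT x z * (√(Wkn κ n x) * √(Wkn κ n y) *
        (2 ^ k * (1 + n * rootDist x y) ^ k)) := by gcongr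
    _ = _ := by ring
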